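/- arXiv:1210.6270 — 3 statements merged into one kernel-verified Lean document; each statement's English description precedes it below -/
import Mathlib

section
/- Assume N ≥ 2 and α_p ∉ {1,2,…,N−1} for every p ∈ Z. Then there is no sequence ξ_n = (ξ₁ⁿ,…,ξ_Nⁿ) in ℳ together with real numbers β₁ⁿ, β₂ⁿ satisfying (β₁ⁿ)² + (β₂ⁿ)² = 1 such that simultaneously: min_{j≠k}|ξ_jⁿ − ξ_kⁿ| → 0 as n → ∞, the sequence (Ψ(ξ_n)) is bounded, and β₁ⁿ·∇Ψ(ξ_n) + β₂ⁿ·∇Φ(ξ_n) = 0 for every n. -/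
open Real Set Metric Filter MeasureTheory

/-- The Laplacian of a real-valued function on the plane ℝ² ≅ ℂ. -/
noncomputable def planeLap (f : ℂ → ℝ) (x : ℂ) : ℝ :=
  fderiv ℝ (fun y => fderiv ℝ f y 1) x 1 +
  fderiv ℝ (fun y => fderiv ℝ f y Complex.I) x Complex.I

/-- A function is harmonic on a set if it is C² there with vanishing Laplacian. -/
def HarmonicOnSet (f : ℂ → ℝ) (s : Set ℂ) : Prop :=
  ContDiffOn ℝ 2 f s ∧ ∀ x ∈ s, planeLap f x = 0

/-- `RegPart Ω H`: H is the regular part of the Dirichlet Green's function of −Δ on Ω: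
for each x ∈ Ω, y ↦ H(x,y) is harmonic on Ω, extends continuously to the closure of Ω,
with boundary values (1/(2π))·log|x−y| on ∂Ω; moreover H is symmetric on Ω × Ω. -/
def RegPart (Ω : Set ℂ) (H : ℂ → ℂ → ℝ) : Prop :=
  (∀ x ∈ Ω, HarmonicOnSet (fun y => H x y) Ω ∧
      ContinuousOn (fun y => H x y) (closure Ω) ∧
      ∀ y ∈ frontier Ω, H x y = (1 / (2 * π)) * Real.log ‖x - y‖) ∧
  (∀ x ∈ Ω, ∀ y ∈ Ω, H x y = H y x)

/-- The Green's function G(x,y) = (1/(2π))·log(1/|x−y|) + H(x,y). -/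
noncomputable def green (H : ℂ → ℂ → ℝ) (x y : ℂ) : ℝ :=
  (1 / (2 * π)) * Real.log (1 / ‖x - y‖) + H x y
/-- The standard inner product on ℝ² ≅ ℂ. -/
noncomputable def rinner (z w : ℂ) : ℝ := z.re * w.re + z.im * w.im

/-- The collar Ω₀ = {x ∈ Ω : dist(x,∂Ω) < δ₀}. -/
def collar (Ω : Set ℂ) (δ₀ : ℝ) : Set ℂ :=
  {x | x ∈ Ω ∧ Metric.infDist x (frontier Ω) < δ₀}

/-- `Ω has C² boundary`: there are δ₀ > 0 and C₀ > 0 such that the nearest-point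
projection onto ∂Ω is well defined and C¹ on the collar Ω₀, and the inward unit
normal ν satisfies |⟨z − w, ν_w⟩| ≤ C₀|z − w|² for w, z ∈ ∂Ω. -/
structure C2Boundary (Ω : Set ℂ) where
  δ₀ : ℝ
  C₀ : ℝ
  proj : ℂ → ℂ
  ν : ℂ → ℂ
  δ₀_pos : 0 < δ₀
  C₀_pos : 0 < C₀
  proj_mem : ∀ x ∈ collar Ω δ₀, proj x ∈ frontier Ω
  proj_dist : ∀ x ∈ collar Ω δ₀, ‖x - proj x‖ = Metric.infDist x (frontier Ω)
  proj_unique : ∀ x ∈ collar Ω δ₀, ∀ z ∈ frontier Ω,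
    ‖x - z‖ = Metric.infDist x (frontier Ω) → z = proj x
  proj_C1 : ContDiffOn ℝ 1 proj (collar Ω δ₀)
  ν_unit : ∀ w ∈ frontier Ω, ‖ν w‖ = 1
  ν_compat : ∀ x ∈ collar Ω δ₀, ν (proj x) = (‖x - proj x‖)⁻¹ • (x - proj x)
  quad : ∀ w ∈ frontier Ω, ∀ z ∈ frontier Ω, |rinner (z - w) (ν w)| ≤ C₀ * ‖z - w‖ ^ 2

/-- The reflection x̄ = 2p(x) − x of x across ∂Ω. -/
noncomputable def C2Boundary.refl {Ω : Set ℂ} (b : C2Boundary Ω) (x : ℂ) : ℂ :=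
  2 * b.proj x - x

/-- The inward unit normal ν_x = (x − p(x))/|x − p(x)| at p(x). -/
noncomputable def C2Boundary.nuAt {Ω : Set ℂ} (b : C2Boundary Ω) (x : ℂ) : ℂ :=
  (‖x - b.proj x‖)⁻¹ • (x - b.proj x)

/-- The function Ψ(ξ) = (1/2)ΣH(ξ_j,ξ_j) − Σ_p (α_p/2)Σ_j G(ξ_j,p) + (1/2)Σ_{j≠k}G(ξ_j,ξ_k). -/
noncomputable def PsiFun (H : ℂ → ℂ → ℝ) (Z : Finset ℂ) (α : ℂ → ℝ) {N : ℕ}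
    (ξ : Fin N → ℂ) : ℝ :=
  (1 / 2) * ∑ j, H (ξ j) (ξ j) - ∑ p ∈ Z, (α p / 2) * ∑ j, green H (ξ j) p +
    (1 / 2) * ∑ j, ∑ k, if j ≠ k then green H (ξ j) (ξ k) else 0

/-- The function Φ(ξ) = (1/2)ΣH(ξ_j,ξ_j) − Σ_p (α_p/2)Σ_j G(ξ_j,p) − (1/2)Σ_{j≠k}G(ξ_j,ξ_k). -/
noncomputable def PhiFun (H : ℂ → ℂ → ℝ) (Z : Finset ℂ) (α : ℂ → ℝ) {N : ℕ}
    (ξ : Fin N → ℂ) : ℝ :=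
  (1 / 2) * ∑ j, H (ξ j) (ξ j) - ∑ p ∈ Z, (α p / 2) * ∑ j, green H (ξ j) p -
    (1 / 2) * ∑ j, ∑ k, if j ≠ k then green H (ξ j) (ξ k) else 0

/-- Membership in the configuration space ℳ = {ξ ∈ (Ω∖Z)^N : ξ_j ≠ ξ_k for j ≠ k}. -/
def memM (Ω : Set ℂ) (Z : Finset ℂ) {N : ℕ} (ξ : Fin N → ℂ) : Prop :=
  (∀ j, ξ j ∈ Ω ∧ ξ j ∉ Z) ∧ Function.Injective ξ



open InnerProductSpace Topology Asymptotics

/-! ### Harmonic functions in the plane -/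

lemma harmonicOnNhd_of_harmonicOnSet {f : ℂ → ℝ} {s : Set ℂ} (hs : IsOpen s)
    (hf : HarmonicOnSet f s) : HarmonicOnNhd f s := by
  intro x hx
  have hC : ∀ y ∈ s, ContDiffAt ℝ 2 f y := fun y hy => hf.1.contDiffAt (hs.mem_nhds hy)
  refine ⟨hC x hx, ?_⟩
  filter_upwards [hs.mem_nhds hx] with y hy
  have hd : DifferentiableAt ℝ (fderiv ℝ f) y :=
    ((hC y hy).fderiv_right (m := 1) (by norm_num)).differentiableAt (by norm_num)
  have key : ∀ v : ℂ, fderiv ℝ (fun z => fderiv ℝ f z v) y v =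
      iteratedFDeriv ℝ 2 f y ![v, v] := by
    intro v
    rw [iteratedFDeriv_two_apply, fderiv_clm_apply hd (differentiableAt_const v)]
    simp
  have h0 := hf.2 y hy
  simp only [planeLap, key] at h0
  rw [laplacian_eq_iteratedFDeriv_complexPlane]
  exact h0

lemma harmonicAt_eventually_eq_of_isLocalMax {u : ℂ → ℝ} {c : ℂ} (hu : HarmonicAt u c)
    (hc : IsLocalMax u c) : ∀ᶠ y in 𝓝 c, u y = u c := by
  obtain ⟨r, hr, hball⟩ := Metric.eventually_nhds_iff_ball.1 hu.eventually
  obtain ⟨F, hF, hre⟩ := InnerProductSpace.HarmonicOnNhd.exists_analyticOnNhd_ball_re_eq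
    (f := u) (z := c) (R := r) hball
  have hmem : ball c r ∈ 𝓝 c := ball_mem_nhds c hr
  have hcu : (F c).re = u c := hre (mem_ball_self hr)
  have hloc : IsLocalMax (norm ∘ fun z => Complex.exp (F z)) c := by
    filter_upwards [hc, hmem] with y hy hyb
    have hyu : (F y).re = u y := hre hyb
    simpa [Complex.norm_exp, hcu, hyu] using hy
  have hd : ∀ᶠ z in 𝓝 c, DifferentiableAt ℂ (fun z => Complex.exp (F z)) z := by
    filter_upwards [hmem] with y hy
    exact (hF y hy).differentiableAt.cexp
  filter_upwards [Complex.eventually_eq_of_isLocalMax_norm hd hloc, hmem] with y hy hyb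
  have hyu : (F y).re = u y := hre hyb
  have h := congrArg norm hy
  simpa [Complex.norm_exp, hcu, hyu] using h

/-- The weak maximum principle on bounded open sets. -/
lemma harmonic_le_of_frontier_le {U : Set ℂ} {u : ℂ → ℝ} {M : ℝ} (hUo : IsOpen U)
    (hUb : Bornology.IsBounded U) (hu : HarmonicOnNhd u U) (hc : ContinuousOn u (closure U))
    (hM : ∀ z ∈ frontier U, u z ≤ M) {z : ℂ} (hz : z ∈ closure U) : u z ≤ M := by
  have hK : IsCompact (closure U) := hUb.isCompact_closure
  obtain ⟨a, ha, hamax⟩ := hK.exists_isMaxOn ⟨z, hz⟩ hc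
  refine (hamax hz).trans ?_
  have hS : IsCompact (closure U ∩ u ⁻¹' {u a}) :=
    hK.of_isClosed_subset (hc.preimage_isClosed_of_isClosed isClosed_closure isClosed_singleton)
      inter_subset_left
  obtain ⟨b, hb, hbmax⟩ := hS.exists_isMaxOn ⟨a, ha, rfl⟩ Complex.continuous_re.continuousOn
  have hba : u b = u a := hb.2
  by_cases hbU : b ∈ U
  · exfalso
    have hloc : IsLocalMax u b := by
      filter_upwards [hUo.mem_nhds hbU] with y hy
      rw [hba]
      exact hamax (subset_closure hy)
    obtain ⟨r, hr, hball⟩ := Metric.eventually_nhds_iff_ball.1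
      ((harmonicAt_eventually_eq_of_isLocalMax (hu b hbU) hloc).and (hUo.mem_nhds hbU))
    have hy : b + ((r / 2 : ℝ) : ℂ) ∈ ball b r := by
      rw [mem_ball, dist_eq_norm, add_sub_cancel_left, Complex.norm_real, Real.norm_eq_abs,
        abs_of_pos (by positivity)]
      linarith
    have h1 := hball _ hy
    have h2 : (b + ((r / 2 : ℝ) : ℂ)).re ≤ b.re :=
      hbmax ⟨subset_closure h1.2, by simpa [hba] using h1.1⟩
    simp only [Complex.add_re, Complex.ofReal_re] at h2
    linarith
  · rw [← hba]
    exact hM b (by rw [hUo.frontier_eq]; exact ⟨hb.1, hbU⟩)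

lemma harmonic_abs_le_of_frontier_abs_le {U : Set ℂ} {u : ℂ → ℝ} {M : ℝ} (hUo : IsOpen U)
    (hUb : Bornology.IsBounded U) (hu : HarmonicOnNhd u U) (hc : ContinuousOn u (closure U))
    (hM : ∀ z ∈ frontier U, |u z| ≤ M) {z : ℂ} (hz : z ∈ closure U) : |u z| ≤ M := by
  refine abs_le'.2 ⟨harmonic_le_of_frontier_le hUo hUb hu hc
    (fun w hw => (le_abs_self _).trans (hM w hw)) hz, ?_⟩
  exact harmonic_le_of_frontier_le (u := -u) hUo hUb hu.neg hc.neg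
    (fun w hw => (neg_le_abs _).trans (hM w hw)) hz

/-- The interior gradient estimate for harmonic functions. -/
lemma harmonic_abs_fderiv_le {u : ℂ → ℝ} {c : ℂ} {r M : ℝ} (hr : 0 < r) (hM : 0 < M)
    (hu : HarmonicOnNhd u (ball c r)) (hb : ∀ z ∈ ball c r, |u z| ≤ M) (v : ℂ) :
    |fderiv ℝ u c v| ≤ 8 * M / r * ‖v‖ := by
  obtain ⟨F, hF, hre⟩ := InnerProductSpace.HarmonicOnNhd.exists_analyticOnNhd_ball_re_eq hu
  have hcm : c ∈ ball c r := mem_ball_self hr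
  have hmaps : ∀ z ∈ ball (0 : ℂ) r, c + z ∈ ball c r := by
    intro z hz
    simpa [mem_ball, dist_eq_norm] using hz
  have hdiff : DifferentiableOn ℂ (fun z => F (c + z) - F c) (ball 0 r) := by
    intro z hz
    have := (hF _ (hmaps z hz)).differentiableAt
    exact ((this.comp z (by fun_prop)).sub_const _).differentiableWithinAt
  have hbc : ∀ z ∈ ball (0 : ℂ) r, ‖F (c + z) - F c‖ ≤ 2 * (2 * M) * ‖z‖ / (r - ‖z‖) := by
    intro z hz
    refine Complex.borelCaratheodory_zero (f := fun z => F (c + z) - F c) (by positivity) hdiff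
      ?_ hr hz (by simp)
    intro w hw
    have h1 : (F (c + w)).re = u (c + w) := hre (hmaps w hw)
    have h2 : (F c).re = u c := hre hcm
    have h3 := abs_le.1 (hb _ (hmaps w hw))
    have h4 := abs_le.1 (hb _ hcm)
    simp only [Set.mem_ofPred_eq, Complex.sub_re, h1, h2]
    linarith
  have hder : ‖deriv (fun z => F z - F c) c‖ ≤ 4 * M / (r / 2) := by
    refine Complex.norm_deriv_le_of_forall_mem_sphere_norm_le (by positivity) ?_ ?_
    · refine DifferentiableOn.diffContOnCl fun z hz => ?_
      have hz' : z ∈ ball c r := by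
        rw [closure_ball _ (by positivity), mem_closedBall] at hz
        rw [mem_ball]; linarith
      exact ((hF z hz').differentiableAt.sub_const _).differentiableWithinAt
    · intro z hz
      rw [mem_sphere, dist_eq_norm] at hz
      have := hbc (z - c) (by rw [mem_ball, dist_zero_right, hz]; linarith)
      rw [hz, add_sub_cancel] at this
      refine this.trans (le_of_eq ?_)
      field_simp
      ring
  have hFd : HasFDerivAt (fun z => (F z).re)
      (Complex.reCLM.comp ((fderiv ℂ F c).restrictScalars ℝ)) c :=
    Complex.reCLM.hasFDerivAt.comp c
      ((hF c hcm).differentiableAt.hasFDerivAt.restrictScalars ℝ)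
  have hud : fderiv ℝ u c = Complex.reCLM.comp ((fderiv ℂ F c).restrictScalars ℝ) := by
    refine (hFd.congr_of_eventuallyEq ?_).fderiv
    filter_upwards [ball_mem_nhds c hr] with y hy
    exact (hre hy).symm
  have hv : fderiv ℝ u c v = (deriv F c * v).re := by
    rw [hud]
    simp [mul_comm]
  rw [hv]
  rw [deriv_sub_const] at hder
  calc |(deriv F c * v).re| ≤ ‖deriv F c * v‖ := Complex.abs_re_le_norm _
    _ = ‖deriv F c‖ * ‖v‖ := norm_mul _ _
    _ ≤ 4 * M / (r / 2) * ‖v‖ := by gcongr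
    _ = 8 * M / r * ‖v‖ := by ring

lemma harmonicAt_log_norm_sub {x y : ℂ} (h : x ≠ y) :
    HarmonicAt (fun z => Real.log ‖x - z‖) y :=
  AnalyticAt.harmonicAt_log_norm (f := fun z => x - z) (by fun_prop) (sub_ne_zero.2 h)

lemma hasFDerivAt_log_norm {z : ℂ} (h : z ≠ 0) :
    HasFDerivAt (fun z : ℂ => Real.log ‖z‖) ((‖z‖ ^ 2)⁻¹ • innerSL ℝ z) z := by
  have h2 : ‖z‖ ^ 2 ≠ 0 := by simpa using h
  have h1 : HasFDerivAt (fun z : ℂ => (1 / 2 : ℝ) * Real.log (‖z‖ ^ 2))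
      ((1 / 2 : ℝ) • ((‖z‖ ^ 2)⁻¹ • (2 • innerSL ℝ z))) z :=
    ((hasStrictFDerivAt_norm_sq z).hasFDerivAt.log h2).const_mul _
  refine (h1.congr_fderiv ?_).congr_of_eventuallyEq (.of_forall fun w => ?_)
  · ext v
    simp only [smul_apply, smul_eq_mul, nsmul_eq_mul]
    push_cast
    ring
  · simp [Real.log_pow]

lemma fderiv_log_norm_sub {x y : ℂ} (h : x ≠ y) (v : ℂ) :
    fderiv ℝ (fun z => Real.log ‖x - z‖) y v = inner ℝ (y - x) v / ‖y - x‖ ^ 2 := by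
  have h1 : HasFDerivAt (fun z => Real.log ‖z - x‖) ((‖y - x‖ ^ 2)⁻¹ • innerSL ℝ (y - x)) y := by
    have := (hasFDerivAt_log_norm (sub_ne_zero.2 h.symm)).comp y
      ((hasFDerivAt_id (𝕜 := ℝ) y).sub_const x)
    simpa [Function.comp_def] using this
  simp_rw [norm_sub_rev x]
  rw [h1.fderiv]
  rw [smul_apply, innerSL_apply_apply, smul_eq_mul, div_eq_inv_mul]

/-! ### Geometry of the boundary -/

lemma rinner_eq_inner (z w : ℂ) : rinner z w = inner ℝ z w := by
  simp [rinner, Complex.inner]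
  ring

lemma norm_sub_smul_sq {ν : ℂ} (hν : ‖ν‖ = 1) (u : ℂ) (s : ℝ) :
    ‖u - s • ν‖ ^ 2 = ‖u‖ ^ 2 - 2 * s * inner ℝ u ν + s ^ 2 := by
  rw [norm_sub_sq_real, inner_smul_right, norm_smul, hν, Real.norm_eq_abs, mul_one, sq_abs]
  ring

lemma norm_add_smul_sq {ν : ℂ} (hν : ‖ν‖ = 1) (u : ℂ) (s : ℝ) :
    ‖u + s • ν‖ ^ 2 = ‖u‖ ^ 2 + 2 * s * inner ℝ u ν + s ^ 2 := by
  have := norm_sub_smul_sq hν u (-s)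
  rw [neg_smul, sub_neg_eq_add] at this
  rw [this]
  ring

/-- Distance to the boundary of `Ω`. -/
noncomputable def bdist (Ω : Set ℂ) (x : ℂ) : ℝ := infDist x (frontier Ω)

lemma bdist_nonneg (Ω : Set ℂ) (x : ℂ) : 0 ≤ bdist Ω x := infDist_nonneg

lemma bdist_le_norm_sub {Ω : Set ℂ} {x w : ℂ} (hw : w ∈ frontier Ω) : bdist Ω x ≤ ‖x - w‖ := by
  rw [← dist_eq_norm]
  exact infDist_le_dist_of_mem hw

lemma bdist_le_add (Ω : Set ℂ) (x y : ℂ) : bdist Ω x ≤ bdist Ω y + ‖x - y‖ := by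
  rw [← dist_eq_norm]
  exact infDist_le_infDist_add_dist

lemma continuous_bdist (Ω : Set ℂ) : Continuous (bdist Ω) := continuous_infDist_pt _

lemma frontier_nonempty_of_bounded {Ω : Set ℂ} (hΩ : Ω.Nonempty)
    (hΩb : Bornology.IsBounded Ω) : (frontier Ω).Nonempty := by
  rw [nonempty_frontier_iff]
  refine ⟨hΩ, fun h => ?_⟩
  rw [h] at hΩb
  exact NormedSpace.unbounded_univ ℝ ℂ hΩb

lemma bdist_pos {Ω : Set ℂ} (hΩo : IsOpen Ω) (hne : (frontier Ω).Nonempty) {x : ℂ}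
    (hx : x ∈ Ω) : 0 < bdist Ω x := by
  refine (isClosed_frontier.notMem_iff_infDist_pos hne).1 fun h => ?_
  rw [hΩo.frontier_eq] at h
  exact h.2 hx

lemma subset_of_disjoint_frontier {E Ω : Set ℂ} (hE : IsPreconnected E)
    (hd : Disjoint E (frontier Ω)) (hne : (E ∩ Ω).Nonempty) : E ⊆ Ω := by
  have hcover : E ⊆ interior Ω ∪ (closure Ω)ᶜ := by
    intro z hz
    by_contra h
    rw [mem_union, not_or, mem_compl_iff, not_not] at h
    exact disjoint_left.1 hd hz ⟨h.2, h.1⟩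
  have hne' : (E ∩ interior Ω).Nonempty := by
    obtain ⟨z, hzE, hzΩ⟩ := hne
    exact ⟨z, hzE, (hcover hzE).resolve_right fun h => h (subset_closure hzΩ)⟩
  refine (hE.subset_left_of_subset_union isOpen_interior isClosed_closure.isOpen_compl
    ?_ hcover hne').trans interior_subset
  exact disjoint_compl_right.mono_left (interior_subset.trans subset_closure)

lemma ball_bdist_subset {Ω : Set ℂ} {x : ℂ} (hx : x ∈ Ω) :
    ball x (bdist Ω x) ⊆ Ω := by
  by_cases hr : 0 < bdist Ω x
  · refine subset_of_disjoint_frontier (convex_ball x _).isPreconnected ?_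
      ⟨x, mem_ball_self hr, hx⟩
    rw [disjoint_left]
    intro y hy hyf
    have := bdist_le_norm_sub (x := x) hyf
    rw [mem_ball, dist_comm, dist_eq_norm] at hy
    linarith
  · simp [ball_eq_empty.2 (not_lt.1 hr)]

lemma bdist_le_norm_sub_of_notMem {Ω : Set ℂ} {x y : ℂ} (hx : x ∈ Ω) (hy : y ∉ Ω) :
    bdist Ω x ≤ ‖x - y‖ := by
  by_contra! h
  refine hy (ball_bdist_subset hx ?_)
  rwa [mem_ball, dist_comm, dist_eq_norm]

/-- The points near the boundary of `Ω`, written as `foot x + bdist x • normal x`, with quadratic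
contact of the boundary with its tangent lines, outer reflections and Lipschitz normals. -/
structure BoundaryFrame (Ω : Set ℂ) where
  δ : ℝ
  C : ℝ
  foot : ℂ → ℂ
  normal : ℂ → ℂ
  δ_pos : 0 < δ
  C_pos : 0 < C
  small : C * δ ≤ 1 / 4
  foot_mem : ∀ x ∈ Ω, bdist Ω x < δ → foot x ∈ frontier Ω
  norm_normal : ∀ x ∈ Ω, bdist Ω x < δ → ‖normal x‖ = 1
  eq_add : ∀ x ∈ Ω, bdist Ω x < δ → x = foot x + bdist Ω x • normal x
  quad : ∀ x ∈ Ω, bdist Ω x < δ → ∀ z ∈ frontier Ω,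
    |inner ℝ (z - foot x) (normal x)| ≤ C * ‖z - foot x‖ ^ 2
  refl_notMem : ∀ x ∈ Ω, bdist Ω x < δ → foot x - bdist Ω x • normal x ∉ closure Ω
  lip : ∀ x ∈ Ω, bdist Ω x < δ → ∀ y ∈ Ω, bdist Ω y < δ →
    ‖normal x - normal y‖ ≤ 4 * C * ‖foot x - foot y‖

/-- The reflection of a point across the boundary. -/
noncomputable def BoundaryFrame.refl {Ω : Set ℂ} (F : BoundaryFrame Ω) (x : ℂ) : ℂ :=
  F.foot x - bdist Ω x • F.normal x

lemma mem_ball_tangent_iff {C : ℝ} (hC : 0 < C) {w ν z : ℂ} (hν : ‖ν‖ = 1) :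
    z ∈ ball (w + (1 / (2 * C)) • ν) (1 / (2 * C)) ↔ C * ‖z - w‖ ^ 2 < inner ℝ (z - w) ν := by
  have hR : 0 < 1 / (2 * C) := by positivity
  rw [mem_ball, dist_eq_norm, ← sub_sub, ← sq_lt_sq₀ (norm_nonneg _) hR.le, norm_sub_smul_sq hν]
  have h : 2 * (1 / (2 * C)) * inner ℝ (z - w) ν = inner ℝ (z - w) ν / C := by
    field_simp
  rw [h, add_lt_iff_neg_right, sub_lt_zero, lt_div_iff₀ hC, mul_comm]

section frame

variable {Ω : Set ℂ}

lemma C2Boundary.disjoint_ball_frontier (b : C2Boundary Ω) {w : ℂ} (hw : w ∈ frontier Ω) {ν : ℂ}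
    (hν : ν = b.ν w ∨ ν = -b.ν w) :
    Disjoint (ball (w + (1 / (2 * b.C₀)) • ν) (1 / (2 * b.C₀))) (frontier Ω) := by
  have hν1 : ‖ν‖ = 1 := by
    rcases hν with rfl | rfl
    · exact b.ν_unit w hw
    · rw [norm_neg]; exact b.ν_unit w hw
  rw [disjoint_left]
  intro z hz hzf
  rw [mem_ball_tangent_iff b.C₀_pos hν1] at hz
  have h := b.quad w hw z hzf
  rw [rinner_eq_inner] at h
  have h' : |inner ℝ (z - w) ν| ≤ b.C₀ * ‖z - w‖ ^ 2 := by
    rcases hν with rfl | rfl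
    · exact h
    · rwa [inner_neg_right, abs_neg]
  exact absurd (le_abs_self _) (not_le.2 (h'.trans_lt hz))

lemma C2Boundary.exterior_ball (b : C2Boundary Ω) {w : ℂ}
    (hw : w ∈ frontier Ω) :
    Disjoint (ball (w + (1 / (2 * b.C₀)) • (-b.ν w)) (1 / (2 * b.C₀))) (closure Ω) := by
  have hν1 := b.ν_unit w hw
  have hC := b.C₀_pos
  refine Disjoint.closure_right ?_ isOpen_ball
  rw [disjoint_iff_inter_eq_empty, ← not_nonempty_iff_eq_empty]
  intro hne
  have hsub := subset_of_disjoint_frontier (convex_ball _ _).isPreconnected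
    (b.disjoint_ball_frontier hw (Or.inr rfl)) hne
  obtain ⟨s, hs0, hs⟩ := exists_between (lt_min b.δ₀_pos (show 0 < 1 / (2 * b.C₀) by positivity))
  have hs1 : s < b.δ₀ := hs.trans_le (min_le_left _ _)
  have hs2 : s * (2 * b.C₀) < 1 := (lt_div_iff₀ (by positivity)).1 (hs.trans_le (min_le_right _ _))
  have hx'Ω : w - s • b.ν w ∈ Ω := by
    refine hsub ?_
    rw [mem_ball_tangent_iff hC (by rwa [norm_neg]), sub_sub_cancel_left, inner_neg_neg,
      real_inner_smul_left, real_inner_self_eq_norm_sq, hν1, norm_neg, norm_smul, hν1,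
      Real.norm_eq_abs, mul_one, sq_abs]
    nlinarith
  have hdist : ‖w - s • b.ν w - w‖ = s := by
    rw [sub_sub_cancel_left, norm_neg, norm_smul, hν1, Real.norm_eq_abs, mul_one, abs_of_pos hs0]
  have hinf : infDist (w - s • b.ν w) (frontier Ω) = s := by
    refine le_antisymm ?_ ((le_infDist ⟨w, hw⟩).2 fun z hz => ?_)
    · exact (infDist_le_dist_of_mem hw).trans_eq (by rw [dist_eq_norm, hdist])
    · have h := (abs_le.1 (b.quad w hw z hz)).1
      rw [rinner_eq_inner] at h
      have h1 := norm_add_smul_sq hν1 (z - w) s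
      rw [dist_comm, dist_eq_norm, ← sub_add, ← sq_le_sq₀ hs0.le (norm_nonneg _), h1]
      have : 2 * s * (b.C₀ * ‖z - w‖ ^ 2) ≤ ‖z - w‖ ^ 2 := by
        nlinarith [sq_nonneg ‖z - w‖]
      nlinarith
  have hcol : w - s • b.ν w ∈ collar Ω b.δ₀ := ⟨hx'Ω, by rw [hinf]; exact hs1⟩
  have hp := b.proj_unique _ hcol w hw (by rw [hdist, hinf])
  have hc := b.ν_compat _ hcol
  rw [← hp, hdist, sub_sub_cancel_left, smul_neg, smul_smul, inv_mul_cancel₀ hs0.ne', one_smul]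
    at hc
  have : b.ν w = 0 := self_eq_neg.1 hc
  rw [this, norm_zero] at hν1
  exact zero_ne_one hν1

/-- A boundary of class C² carries a boundary frame. -/
noncomputable def C2Boundary.frame (hΩo : IsOpen Ω) (b : C2Boundary Ω) : BoundaryFrame Ω := by
  have hC := b.C₀_pos
  have hcol : ∀ x ∈ Ω, bdist Ω x < min b.δ₀ (1 / (4 * b.C₀)) → x ∈ collar Ω b.δ₀ :=
    fun x hx hd => ⟨hx, hd.trans_le (min_le_left _ _)⟩
  have hCd : ∀ x, bdist Ω x < min b.δ₀ (1 / (4 * b.C₀)) → bdist Ω x * (4 * b.C₀) < 1 :=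
    fun x hd => (lt_div_iff₀ (by positivity)).1 (hd.trans_le (min_le_right _ _))
  have hpos : ∀ x ∈ Ω, bdist Ω x < min b.δ₀ (1 / (4 * b.C₀)) → 0 < bdist Ω x :=
    fun x hx hd => bdist_pos hΩo ⟨_, b.proj_mem x (hcol x hx hd)⟩ hx
  have heq : ∀ x ∈ Ω, bdist Ω x < min b.δ₀ (1 / (4 * b.C₀)) →
      x = b.proj x + bdist Ω x • b.ν (b.proj x) := by
    intro x hx hd
    have h := b.ν_compat x (hcol x hx hd)
    rw [b.proj_dist x (hcol x hx hd)] at h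
    rw [h, ← bdist, smul_smul, mul_inv_cancel₀ (hpos x hx hd).ne', one_smul, add_sub_cancel]
  exact
  { δ := min b.δ₀ (1 / (4 * b.C₀))
    C := b.C₀
    foot := b.proj
    normal := fun x => b.ν (b.proj x)
    δ_pos := lt_min b.δ₀_pos (by positivity)
    C_pos := hC
    small := by
      calc b.C₀ * min b.δ₀ (1 / (4 * b.C₀)) ≤ b.C₀ * (1 / (4 * b.C₀)) := by
            gcongr; exact min_le_right _ _
        _ = 1 / 4 := by field_simp
    foot_mem := fun x hx hd => b.proj_mem x (hcol x hx hd)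
    norm_normal := fun x hx hd => b.ν_unit _ (b.proj_mem x (hcol x hx hd))
    eq_add := heq
    quad := fun x hx hd z hz => by
      rw [← rinner_eq_inner]
      exact b.quad _ (b.proj_mem x (hcol x hx hd)) z hz
    refl_notMem := fun x hx hd hmem => by
      have hw := b.proj_mem x (hcol x hx hd)
      have hν1 := b.ν_unit _ hw
      refine disjoint_left.1 (b.exterior_ball hw) ?_ hmem
      have h1 := hCd x hd
      have h2 := hpos x hx hd
      rw [mem_ball_tangent_iff hC (by rwa [norm_neg]), sub_sub_cancel_left, inner_neg_neg,
        real_inner_smul_left, real_inner_self_eq_norm_sq, hν1, norm_neg, norm_smul, hν1,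
        Real.norm_eq_abs, mul_one, sq_abs]
      nlinarith
    lip := fun x hx hdx y hy hdy => by
      have hwx := b.proj_mem x (hcol x hx hdx)
      have hwy := b.proj_mem y (hcol y hy hdy)
      have hνx := b.ν_unit _ hwx
      have hνy := b.ν_unit _ hwy
      have hR : 0 < 1 / (2 * b.C₀) := by positivity
      have hint : ball (b.proj x + (1 / (2 * b.C₀)) • b.ν (b.proj x)) (1 / (2 * b.C₀)) ⊆ Ω := by
        refine subset_of_disjoint_frontier (convex_ball _ _).isPreconnected
          (b.disjoint_ball_frontier hwx (Or.inl rfl)) ⟨x, ?_, hx⟩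
        have h1 := hCd x hdx
        have h2 := hpos x hx hdx
        have h3 : x - b.proj x = bdist Ω x • b.ν (b.proj x) :=
          sub_eq_of_eq_add' (heq x hx hdx)
        rw [mem_ball_tangent_iff hC hνx, h3, real_inner_smul_left, real_inner_self_eq_norm_sq,
          norm_smul, hνx, Real.norm_eq_abs, mul_one, sq_abs]
        nlinarith
      have hdisj := (b.exterior_ball hwy).symm.mono_left (hint.trans subset_closure)
      rw [disjoint_ball_ball_iff hR hR, dist_eq_norm] at hdisj
      have hq1 := (abs_le.1 (b.quad _ hwy _ hwx)).2
      have hq2 := (abs_le.1 (b.quad _ hwx _ hwy)).1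
      rw [rinner_eq_inner] at hq1 hq2
      generalize b.proj x = p at *
      generalize b.proj y = q at *
      set R := 1 / (2 * b.C₀) with hRdef
      have hRC : b.C₀ * (2 * R) = 1 := by rw [hRdef]; field_simp
      have e1 : p + R • b.ν p - (q + R • (-b.ν q)) = (p - q) + R • (b.ν p + b.ν q) := by
        simp only [smul_add, smul_neg]; ring
      have h4 : (R + R) ^ 2 ≤ ‖(p - q) + R • (b.ν p + b.ν q)‖ ^ 2 := by
        rw [← e1]; gcongr
      rw [norm_add_sq_real, inner_smul_right, inner_add_right, norm_smul, mul_pow,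
        norm_add_sq_real, hνx, hνy, Real.norm_eq_abs, sq_abs] at h4
      have h5 : inner ℝ (p - q) (b.ν p) ≤ b.C₀ * ‖p - q‖ ^ 2 := by
        rw [← neg_sub p q, inner_neg_left, norm_neg] at hq2
        linarith
      have h6 : ‖b.ν p - b.ν q‖ ^ 2 = 2 - 2 * inner ℝ (b.ν p) (b.ν q) := by
        rw [norm_sub_sq_real, hνx, hνy]; ring
      have h7 : R ^ 2 * ‖b.ν p - b.ν q‖ ^ 2 ≤ 3 * ‖p - q‖ ^ 2 := by
        rw [h6]
        have : 2 * R * (inner ℝ (p - q) (b.ν p) + inner ℝ (p - q) (b.ν q)) ≤ 2 * ‖p - q‖ ^ 2 := by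
          calc _ ≤ 2 * R * (b.C₀ * ‖p - q‖ ^ 2 + b.C₀ * ‖p - q‖ ^ 2) := by gcongr
            _ = (b.C₀ * (2 * R)) * (2 * ‖p - q‖ ^ 2) := by ring
            _ = _ := by rw [hRC, one_mul]
        nlinarith
      refine le_of_sq_le_sq ?_ (by positivity)
      have h8 : ‖b.ν p - b.ν q‖ ^ 2 =
          4 * b.C₀ ^ 2 * (R ^ 2 * ‖b.ν p - b.ν q‖ ^ 2) := by
        have : 4 * b.C₀ ^ 2 * R ^ 2 = 1 := by
          calc _ = (b.C₀ * (2 * R)) ^ 2 := by ring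
            _ = 1 := by rw [hRC, one_pow]
        rw [← mul_assoc, this, one_mul]
      rw [h8, mul_pow]
      nlinarith [mul_nonneg (sq_nonneg b.C₀) (sq_nonneg ‖p - q‖),
        mul_le_mul_of_nonneg_left h7 (sq_nonneg b.C₀)] }

end frame

/-! ### Estimates for the regular part and the Green's function -/

lemma abs_log_sub_log_le {a b K : ℝ} (ha : 0 < a) (hb : 0 < b) (h1 : |a - b| ≤ K * a)
    (h2 : |a - b| ≤ K * b) : |Real.log a - Real.log b| ≤ K := by
  have key : ∀ s t : ℝ, 0 < s → 0 < t → |s - t| ≤ K * t → Real.log s - Real.log t ≤ K := by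
    intro s t hs ht h
    rw [← Real.log_div hs.ne' ht.ne']
    refine (Real.log_le_sub_one_of_pos (div_pos hs ht)).trans ?_
    rw [div_sub_one ht.ne', div_le_iff₀ ht]
    exact (le_abs_self _).trans h
  rw [abs_le']
  refine ⟨key a b ha hb h2, ?_⟩
  rw [neg_sub]
  exact key b a hb ha (by rwa [abs_sub_comm])

lemma one_div_two_pi_pos : 0 < 1 / (2 * π) := by positivity

lemma one_div_two_pi_le_one : 1 / (2 * π) ≤ 1 := by
  rw [div_le_one (by positivity)]
  linarith [Real.pi_gt_three]

/-- The derivative of `green H x` at `y` in the direction `v`, for `x ≠ y`. -/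
noncomputable def gradGreen (H : ℂ → ℂ → ℝ) (x y v : ℂ) : ℝ :=
  fderiv ℝ (H x) y v - 1 / (2 * π) * (inner ℝ (y - x) v / ‖y - x‖ ^ 2)

lemma green_eq (H : ℂ → ℂ → ℝ) (x y : ℂ) :
    green H x y = H x y - 1 / (2 * π) * Real.log ‖x - y‖ := by
  rw [green, one_div ‖x - y‖, Real.log_inv]
  ring

namespace BoundaryFrame

variable {Ω : Set ℂ} (F : BoundaryFrame Ω)

lemma sub_refl {x : ℂ} (hx : x ∈ Ω) (hd : bdist Ω x < F.δ) :
    x - F.refl x = (2 * bdist Ω x) • F.normal x := by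
  nth_rw 1 [F.eq_add x hx hd]
  rw [BoundaryFrame.refl, two_mul, add_smul]
  ring

lemma norm_sub_refl {x : ℂ} (hx : x ∈ Ω) (hd : bdist Ω x < F.δ) :
    ‖x - F.refl x‖ = 2 * bdist Ω x := by
  rw [F.sub_refl hx hd, norm_smul, F.norm_normal x hx hd, mul_one, Real.norm_eq_abs,
    abs_of_nonneg (by have := bdist_nonneg Ω x; positivity)]

lemma refl_ne {x y : ℂ} (hx : x ∈ Ω) (hd : bdist Ω x < F.δ) (hy : y ∈ closure Ω) :
    F.refl x ≠ y := fun h => F.refl_notMem x hx hd (by rw [← h] at hy; exact hy)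

lemma bdist_le_norm_sub_refl {x y : ℂ} (hx : x ∈ Ω) (hd : bdist Ω x < F.δ) (hy : y ∈ Ω) :
    bdist Ω y ≤ ‖y - F.refl x‖ :=
  bdist_le_norm_sub_of_notMem hy fun h => F.refl_notMem x hx hd (subset_closure h)

lemma abs_log_sub_log_refl_le (hΩo : IsOpen Ω) {x z : ℂ} (hx : x ∈ Ω) (hd : bdist Ω x < F.δ)
    (hz : z ∈ frontier Ω) :
    |Real.log ‖x - z‖ - Real.log ‖F.refl x - z‖| ≤ 4 * F.C * bdist Ω x := by
  have hν := F.norm_normal x hx hd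
  have hq := F.quad x hx hd z hz
  have hxe := F.eq_add x hx hd
  have hd0 : 0 < bdist Ω x := bdist_pos hΩo ⟨z, hz⟩ hx
  have hC := F.C_pos
  have hsm : F.C * bdist Ω x ≤ 1 / 4 := (by gcongr : _ ≤ F.C * F.δ).trans F.small
  have hzc : z ∈ closure Ω := frontier_subset_closure hz
  have hzx : x ≠ z := fun h => by
    rw [hΩo.frontier_eq, ← h] at hz
    exact hz.2 hx
  have hzr : F.refl x ≠ z := F.refl_ne hx hd hzc
  have ha : 0 < ‖x - z‖ ^ 2 := by
    have := norm_pos_iff.2 (sub_ne_zero.2 hzx); positivity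
  have hb : 0 < ‖F.refl x - z‖ ^ 2 := by
    have := norm_pos_iff.2 (sub_ne_zero.2 hzr); positivity
  set u := z - F.foot x with hu
  have ea : ‖x - z‖ ^ 2 = ‖u‖ ^ 2 - 2 * bdist Ω x * inner ℝ u (F.normal x) + bdist Ω x ^ 2 := by
    rw [← norm_sub_smul_sq hν, ← norm_neg]
    nth_rw 1 [hxe]
    congr 2
    rw [hu]; ring
  have eb : ‖F.refl x - z‖ ^ 2 =
      ‖u‖ ^ 2 + 2 * bdist Ω x * inner ℝ u (F.normal x) + bdist Ω x ^ 2 := by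
    rw [← norm_add_smul_sq hν, ← norm_neg, BoundaryFrame.refl]
    congr 2
    rw [hu]; ring
  have hq' := abs_le.1 hq
  have h0 : bdist Ω x * |inner ℝ u (F.normal x)| ≤ bdist Ω x * (F.C * ‖u‖ ^ 2) := by gcongr
  have h1 : bdist Ω x * (F.C * ‖u‖ ^ 2) ≤ 1 / 4 * ‖u‖ ^ 2 := by
    nlinarith [sq_nonneg ‖u‖]
  have h2 := abs_le.1 (le_of_eq_of_le (by rw [abs_mul, abs_of_pos hd0]) h0 :
    |bdist Ω x * inner ℝ u (F.normal x)| ≤ _)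
  have hdiff : |‖x - z‖ ^ 2 - ‖F.refl x - z‖ ^ 2| ≤ 4 * (bdist Ω x * (F.C * ‖u‖ ^ 2)) := by
    rw [ea, eb, abs_le]
    constructor <;> linarith [h2.1, h2.2]
  have hu0 := sq_nonneg ‖u‖
  have key : ∀ t : ℝ, ‖u‖ ^ 2 / 2 ≤ t →
      4 * (bdist Ω x * (F.C * ‖u‖ ^ 2)) ≤ 8 * F.C * bdist Ω x * t := by
    intro t ht
    have : 8 * F.C * bdist Ω x * (‖u‖ ^ 2 / 2) ≤ 8 * F.C * bdist Ω x * t := by gcongr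
    linarith
  have hlog := abs_log_sub_log_le (K := 8 * F.C * bdist Ω x) ha hb
    (hdiff.trans (key _ (by rw [ea]; nlinarith [h2.1, h2.2])))
    (hdiff.trans (key _ (by rw [eb]; nlinarith [h2.1, h2.2])))
  rw [Real.log_pow, Real.log_pow, ← mul_sub, abs_mul] at hlog
  norm_num at hlog
  linarith

end BoundaryFrame

section estimates

variable {Ω : Set ℂ} {H : ℂ → ℂ → ℝ}

lemma RegPart.harmonic (hΩo : IsOpen Ω) (hH : RegPart Ω H) {x : ℂ} (hx : x ∈ Ω) :
    HarmonicOnNhd (H x) Ω :=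
  harmonicOnNhd_of_harmonicOnSet hΩo (hH.1 x hx).1

lemma RegPart.symm (hH : RegPart Ω H) {x y : ℂ} (hx : x ∈ Ω) (hy : y ∈ Ω) : H x y = H y x :=
  hH.2 x hx y hy

lemma RegPart.green_symm (hH : RegPart Ω H) {x y : ℂ} (hx : x ∈ Ω) (hy : y ∈ Ω) :
    green H x y = green H y x := by
  rw [green_eq, green_eq, hH.symm hx hy, norm_sub_rev]

lemma harmonicAt_const_mul_log_norm_sub {x y : ℂ} (c : ℝ) (h : x ≠ y) :
    HarmonicAt (fun z => c * Real.log ‖x - z‖) y :=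
  (harmonicAt_log_norm_sub h).const_smul (c := c)

lemma RegPart.harmonicAt_green (hΩo : IsOpen Ω) (hH : RegPart Ω H) {x y : ℂ} (hx : x ∈ Ω)
    (hy : y ∈ Ω) (hxy : x ≠ y) : HarmonicAt (green H x) y := by
  have : green H x = H x - fun z => 1 / (2 * π) * Real.log ‖x - z‖ :=
    funext fun z => green_eq H x z
  rw [this]
  exact (hH.harmonic hΩo hx y hy).sub (harmonicAt_const_mul_log_norm_sub _ hxy)

lemma fderiv_const_mul_log_norm_sub {x y : ℂ} (c : ℝ) (h : x ≠ y) (v : ℂ) :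
    fderiv ℝ (fun z => c * Real.log ‖x - z‖) y v = c * (inner ℝ (y - x) v / ‖y - x‖ ^ 2) := by
  rw [fderiv_const_mul ((harmonicAt_log_norm_sub h).1.differentiableAt (by norm_num)),
    smul_apply, smul_eq_mul, fderiv_log_norm_sub h]

lemma RegPart.differentiableAt (hΩo : IsOpen Ω) (hH : RegPart Ω H) {x y : ℂ} (hx : x ∈ Ω)
    (hy : y ∈ Ω) : DifferentiableAt ℝ (H x) y :=
  (hH.harmonic hΩo hx y hy).1.differentiableAt (by norm_num)

lemma RegPart.fderiv_green (hΩo : IsOpen Ω) (hH : RegPart Ω H) {x y : ℂ} (hx : x ∈ Ω)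
    (hy : y ∈ Ω) (hxy : x ≠ y) (v : ℂ) : fderiv ℝ (green H x) y v = gradGreen H x y v := by
  have : green H x = H x - fun z => 1 / (2 * π) * Real.log ‖x - z‖ :=
    funext fun z => green_eq H x z
  rw [this, fderiv_sub (hH.differentiableAt hΩo hx hy)
    ((harmonicAt_const_mul_log_norm_sub _ hxy).1.differentiableAt (by norm_num)),
    sub_apply, fderiv_const_mul_log_norm_sub _ hxy, gradGreen]

/-- The regular part differs from the logarithm centred at the reflected pole by `O(bdist x)`. -/
lemma RegPart.abs_sub_log_refl_le (hΩo : IsOpen Ω) (hΩb : Bornology.IsBounded Ω)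
    (F : BoundaryFrame Ω) (hH : RegPart Ω H) {x y : ℂ} (hx : x ∈ Ω) (hd : bdist Ω x < F.δ)
    (hy : y ∈ closure Ω) :
    |H x y - 1 / (2 * π) * Real.log ‖F.refl x - y‖| ≤ 4 * F.C * bdist Ω x := by
  refine harmonic_abs_le_of_frontier_abs_le (U := Ω)
    (u := fun y => H x y - 1 / (2 * π) * Real.log ‖F.refl x - y‖) hΩo hΩb ?_ ?_ ?_ hy
  · intro z hz
    exact (hH.harmonic hΩo hx z hz).sub
      (harmonicAt_const_mul_log_norm_sub _ (F.refl_ne hx hd (subset_closure hz)))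
  · refine (hH.1 x hx).2.1.sub (continuousOn_const.mul (ContinuousOn.log (by fun_prop) ?_))
    intro z hz
    exact norm_ne_zero_iff.2 (sub_ne_zero.2 (F.refl_ne hx hd hz))
  · intro z hz
    have h1 := F.abs_log_sub_log_refl_le hΩo hx hd hz
    simp only [(hH.1 x hx).2.2 z hz, ← mul_sub, abs_mul, abs_of_pos one_div_two_pi_pos]
    calc _ ≤ 1 * (4 * F.C * bdist Ω x) := by
          gcongr; exact one_div_two_pi_le_one
      _ = _ := one_mul _

lemma RegPart.abs_fderiv_sub_refl_le (hΩo : IsOpen Ω) (hΩb : Bornology.IsBounded Ω)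
    (F : BoundaryFrame Ω) (hH : RegPart Ω H) {x y : ℂ} (hx : x ∈ Ω) (hd : bdist Ω x < F.δ)
    (hy : y ∈ Ω) (v : ℂ) :
    |fderiv ℝ (H x) y v -
        1 / (2 * π) * (inner ℝ (y - F.refl x) v / ‖y - F.refl x‖ ^ 2)| ≤
      32 * F.C * bdist Ω x / bdist Ω y * ‖v‖ := by
  have hfr : (frontier Ω).Nonempty := ⟨_, F.foot_mem x hx hd⟩
  have hne := F.refl_ne hx hd (subset_closure hy)
  have h := harmonic_abs_fderiv_le (u := fun y => H x y - 1 / (2 * π) * Real.log ‖F.refl x - y‖)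
    (c := y) (r := bdist Ω y) (M := 4 * F.C * bdist Ω x) (bdist_pos hΩo hfr hy)
    (by have := bdist_pos hΩo hfr hx; have := F.C_pos; positivity)
    (fun z hz => (hH.harmonic hΩo hx z (ball_bdist_subset hy hz)).sub
      (harmonicAt_const_mul_log_norm_sub _
        (F.refl_ne hx hd (subset_closure (ball_bdist_subset hy hz)))))
    (fun z hz => hH.abs_sub_log_refl_le hΩo hΩb F hx hd
      (subset_closure (ball_bdist_subset hy hz))) v
  rw [fderiv_fun_sub (hH.differentiableAt hΩo hx hy)
    ((harmonicAt_const_mul_log_norm_sub _ hne).1.differentiableAt (by norm_num)),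
    sub_apply, fderiv_const_mul_log_norm_sub _ hne] at h
  refine h.trans (le_of_eq ?_)
  ring

lemma RegPart.exists_le (hΩo : IsOpen Ω) (hΩb : Bornology.IsBounded Ω) (hH : RegPart Ω H) :
    ∃ D : ℝ, 0 < D ∧ (∀ x ∈ closure Ω, ∀ y ∈ closure Ω, ‖x - y‖ ≤ D) ∧
      ∀ x ∈ Ω, ∀ y ∈ closure Ω, H x y ≤ D := by
  have hdiam : ∀ x ∈ closure Ω, ∀ y ∈ closure Ω, ‖x - y‖ ≤ diam (closure Ω) := by
    intro x hx y hy
    rw [← dist_eq_norm]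
    exact dist_le_diam_of_mem hΩb.closure hx hy
  have hD0 : 0 ≤ diam (closure Ω) := diam_nonneg
  refine ⟨diam (closure Ω) + 1, by positivity, fun x hx y hy => ?_, fun x hx y hy => ?_⟩
  · linarith [hdiam x hx y hy]
  refine harmonic_le_of_frontier_le hΩo hΩb (hH.harmonic hΩo hx) (hH.1 x hx).2.1 ?_ hy
  intro z hz
  rw [(hH.1 x hx).2.2 z hz]
  have h1 := hdiam x (subset_closure hx) z (frontier_subset_closure hz)
  have h2 : Real.log ‖x - z‖ ≤ diam (closure Ω) :=
    (Real.log_le_self (norm_nonneg _)).trans h1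
  calc 1 / (2 * π) * Real.log ‖x - z‖ ≤ 1 / (2 * π) * diam (closure Ω) := by gcongr
    _ ≤ 1 * diam (closure Ω) := by gcongr; exact one_div_two_pi_le_one
    _ ≤ _ := by linarith

lemma abs_inner_div_norm_sq_le (z v : ℂ) : |inner ℝ z v / ‖z‖ ^ 2| ≤ ‖v‖ / ‖z‖ := by
  rcases eq_or_ne z 0 with rfl | hz
  · simp
  have hz' := norm_pos_iff.2 hz
  rw [abs_div, abs_of_pos (by positivity : 0 < ‖z‖ ^ 2), div_le_div_iff₀ (by positivity) hz']
  calc |inner ℝ z v| * ‖z‖ ≤ (‖z‖ * ‖v‖) * ‖z‖ := by gcongr; exact abs_real_inner_le_norm _ _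
    _ = _ := by ring

lemma RegPart.exists_abs_fderiv_le (hΩo : IsOpen Ω) (hΩb : Bornology.IsBounded Ω)
    (hne : Ω.Nonempty) (F : BoundaryFrame Ω) (hH : RegPart Ω H) :
    ∃ K : ℝ, 0 < K ∧ ∀ x ∈ Ω, ∀ y ∈ Ω, ∀ v : ℂ,
      |fderiv ℝ (H x) y v| ≤ K * (‖v‖ / bdist Ω y) := by
  have hfr := frontier_nonempty_of_bounded hne hΩb
  have hC := F.C_pos
  have hδ := F.δ_pos
  obtain ⟨D, hD, hDdist, -⟩ := hH.exists_le hΩo hΩb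
  set M := max |Real.log F.δ| |Real.log D| + 1 with hM
  have hM0 : 0 < M := by positivity
  have hsm := F.small
  refine ⟨8 * M + 9, by positivity, fun x hx y hy v => ?_⟩
  have hy0 := bdist_pos hΩo hfr hy
  rcases lt_or_ge (bdist Ω x) F.δ with hd | hd
  · have h1 := hH.abs_fderiv_sub_refl_le hΩo hΩb F hx hd hy v
    have h2 := abs_inner_div_norm_sq_le (y - F.refl x) v
    have h3 : ‖v‖ / ‖y - F.refl x‖ ≤ ‖v‖ / bdist Ω y := by
      gcongr; exact F.bdist_le_norm_sub_refl hx hd hy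
    have h4 : |1 / (2 * π) * (inner ℝ (y - F.refl x) v / ‖y - F.refl x‖ ^ 2)| ≤
        ‖v‖ / bdist Ω y := by
      rw [abs_mul, abs_of_pos one_div_two_pi_pos]
      calc _ ≤ 1 * (‖v‖ / bdist Ω y) := by
            gcongr
            · exact one_div_two_pi_le_one
            · exact h2.trans h3
        _ = _ := one_mul _
    have h5 : 32 * F.C * bdist Ω x / bdist Ω y * ‖v‖ ≤ 8 * (‖v‖ / bdist Ω y) := by
      have : 32 * F.C * bdist Ω x ≤ 8 := by nlinarith
      calc _ = 32 * F.C * bdist Ω x * (‖v‖ / bdist Ω y) := by ring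
        _ ≤ _ := by gcongr
    have h6 := abs_sub_abs_le_abs_sub (fderiv ℝ (H x) y v)
      (1 / (2 * π) * (inner ℝ (y - F.refl x) v / ‖y - F.refl x‖ ^ 2))
    have h7 : 0 ≤ M * (‖v‖ / bdist Ω y) := by positivity
    linarith
  · have hb : ∀ z ∈ closure Ω, |H x z| ≤ M := by
      intro z hz
      refine harmonic_abs_le_of_frontier_abs_le hΩo hΩb (hH.harmonic hΩo hx) (hH.1 x hx).2.1
        (fun w hw => ?_) hz
      rw [(hH.1 x hx).2.2 w hw, abs_mul, abs_of_pos one_div_two_pi_pos]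
      have h1 : F.δ ≤ ‖x - w‖ := hd.trans (bdist_le_norm_sub hw)
      have h2 := hDdist x (subset_closure hx) w (frontier_subset_closure hw)
      have h3 : |Real.log ‖x - w‖| ≤ M := by
        have := Real.log_le_log hδ h1
        have := Real.log_le_log (hδ.trans_le h1) h2
        rw [abs_le]
        constructor
        · linarith [neg_abs_le (Real.log F.δ), le_max_left |Real.log F.δ| |Real.log D|]
        · linarith [le_abs_self (Real.log D), le_max_right |Real.log F.δ| |Real.log D|]
      calc _ ≤ 1 * M := by gcongr; exact one_div_two_pi_le_one
        _ = M := one_mul M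
    have h := harmonic_abs_fderiv_le hy0 hM0
      (fun z hz => hH.harmonic hΩo hx z (ball_bdist_subset hy hz))
      (fun z hz => hb z (subset_closure (ball_bdist_subset hy hz))) v
    calc _ ≤ 8 * M / bdist Ω y * ‖v‖ := h
      _ = 8 * M * (‖v‖ / bdist Ω y) := by ring
      _ ≤ _ := by gcongr; linarith

/-- The Green's function decays like `bdist x / ‖x - y‖`. -/
lemma RegPart.exists_green_le (hΩo : IsOpen Ω) (hΩb : Bornology.IsBounded Ω)
    (F : BoundaryFrame Ω) (hH : RegPart Ω H) :
    ∃ K : ℝ, 0 < K ∧ ∀ x ∈ Ω, bdist Ω x < F.δ → ∀ y ∈ Ω, x ≠ y →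
      green H x y ≤ K * (bdist Ω x / ‖x - y‖) ∧
      (4 * bdist Ω x ≤ ‖x - y‖ → |green H x y| ≤ K * (bdist Ω x / ‖x - y‖)) := by
  obtain ⟨D, hD, hDdist, -⟩ := hH.exists_le hΩo hΩb
  have hC := F.C_pos
  refine ⟨4 + 4 * F.C * D, by positivity, fun x hx hd y hy hxy => ?_⟩
  have hd0 := bdist_nonneg Ω x
  have hb : 0 < ‖x - y‖ := norm_pos_iff.2 (sub_ne_zero.2 hxy)
  have ha : 0 < ‖F.refl x - y‖ :=
    norm_pos_iff.2 (sub_ne_zero.2 (F.refl_ne hx hd (subset_closure hy)))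
  have hdiff : |‖F.refl x - y‖ - ‖x - y‖| ≤ 2 * bdist Ω x := by
    have h := abs_norm_sub_norm_le (F.refl x - y) (x - y)
    rwa [sub_sub_sub_cancel_right, norm_sub_rev (F.refl x) x, F.norm_sub_refl hx hd] at h
  have hψ := hH.abs_sub_log_refl_le hΩo hΩb F hx hd (subset_closure hy)
  have hψ' : 4 * F.C * bdist Ω x ≤ 4 * F.C * D * (bdist Ω x / ‖x - y‖) := by
    have h1 : 1 ≤ D / ‖x - y‖ :=
      (one_le_div hb).2 (hDdist x (subset_closure hx) y (subset_closure hy))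
    calc 4 * F.C * bdist Ω x = 4 * F.C * bdist Ω x * 1 := (mul_one _).symm
      _ ≤ 4 * F.C * bdist Ω x * (D / ‖x - y‖) := by gcongr
      _ = _ := by ring
  have hG : green H x y = (H x y - 1 / (2 * π) * Real.log ‖F.refl x - y‖) +
      1 / (2 * π) * (Real.log ‖F.refl x - y‖ - Real.log ‖x - y‖) := by
    rw [green_eq]; ring
  have hr0 : 0 ≤ bdist Ω x / ‖x - y‖ := by positivity
  constructor
  · have h1 : Real.log ‖F.refl x - y‖ - Real.log ‖x - y‖ ≤ 2 * (bdist Ω x / ‖x - y‖) := by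
      rw [← Real.log_div ha.ne' hb.ne']
      refine (Real.log_le_sub_one_of_pos (div_pos ha hb)).trans ?_
      rw [div_sub_one hb.ne', ← mul_div_assoc]
      gcongr
      exact (le_abs_self _).trans hdiff
    have h2 : 1 / (2 * π) * (Real.log ‖F.refl x - y‖ - Real.log ‖x - y‖) ≤
        2 * (bdist Ω x / ‖x - y‖) := by
      calc _ ≤ 1 / (2 * π) * (2 * (bdist Ω x / ‖x - y‖)) := by gcongr
        _ ≤ 1 * (2 * (bdist Ω x / ‖x - y‖)) := by gcongr; exact one_div_two_pi_le_one
        _ = _ := one_mul _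
    rw [hG]
    linarith [(abs_le.1 hψ).2]
  · intro hfar
    have h1 : |Real.log ‖F.refl x - y‖ - Real.log ‖x - y‖| ≤ 4 * (bdist Ω x / ‖x - y‖) := by
      refine abs_log_sub_log_le ha hb (hdiff.trans ?_) (hdiff.trans ?_)
      · have h2 : ‖x - y‖ / 2 ≤ ‖F.refl x - y‖ := by linarith [(abs_le.1 hdiff).1]
        calc 2 * bdist Ω x = 4 * (bdist Ω x / ‖x - y‖) * (‖x - y‖ / 2) := by
              field_simp; ring
          _ ≤ _ := by gcongr
      · calc 2 * bdist Ω x ≤ 4 * bdist Ω x := by linarith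
          _ = _ := by field_simp
    have h2 : |1 / (2 * π) * (Real.log ‖F.refl x - y‖ - Real.log ‖x - y‖)| ≤
        4 * (bdist Ω x / ‖x - y‖) := by
      rw [abs_mul, abs_of_pos one_div_two_pi_pos]
      calc _ ≤ 1 * (4 * (bdist Ω x / ‖x - y‖)) := by
            gcongr; exact one_div_two_pi_le_one
        _ = _ := one_mul _
    rw [hG]
    refine (abs_add_le _ _).trans ?_
    linarith

lemma RegPart.exists_abs_gradGreen_le (hΩo : IsOpen Ω) (hΩb : Bornology.IsBounded Ω)
    (hne : Ω.Nonempty) (F : BoundaryFrame Ω) (hH : RegPart Ω H) :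
    ∃ K : ℝ, 0 < K ∧ ∀ x ∈ Ω, ∀ y ∈ Ω, 2 * bdist Ω y < F.δ → 8 * bdist Ω y ≤ ‖x - y‖ →
      ∀ v : ℂ, |gradGreen H x y v| ≤ K * (‖v‖ / ‖x - y‖) := by
  obtain ⟨K, hK, hG⟩ := hH.exists_green_le hΩo hΩb F
  refine ⟨48 * K, by positivity, fun x hx y hy hd hfar v => ?_⟩
  have hy0 := bdist_pos hΩo (frontier_nonempty_of_bounded hne hΩb) hy
  have hxy : 0 < ‖x - y‖ := by linarith
  have hball : ∀ z ∈ ball y (bdist Ω y / 2), z ∈ Ω ∧ bdist Ω z ≤ 3 / 2 * bdist Ω y ∧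
      ‖x - y‖ / 2 ≤ ‖x - z‖ ∧ 4 * bdist Ω z ≤ ‖x - z‖ := by
    intro z hz
    have hzΩ := ball_bdist_subset hy (ball_subset_ball (by linarith) hz)
    rw [mem_ball, dist_eq_norm] at hz
    have h1 := bdist_le_add Ω z y
    have h2 : ‖x - y‖ ≤ ‖x - z‖ + ‖z - y‖ := norm_sub_le_norm_sub_add_norm_sub x z y
    exact ⟨hzΩ, by linarith, by linarith, by linarith⟩
  rw [← hH.fderiv_green hΩo hx hy (fun h => by simp [h] at hxy) v]
  have h := harmonic_abs_fderiv_le (u := green H x) (c := y) (r := bdist Ω y / 2)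
    (M := 3 * K * (bdist Ω y / ‖x - y‖)) (by positivity) (by positivity)
    (fun z hz => hH.harmonicAt_green hΩo hx (hball z hz).1 fun h => ?_)
    (fun z hz => ?_) v
  · refine h.trans (le_of_eq ?_)
    field_simp
    ring
  · have := (hball z hz).2.2.1
    rw [h, sub_self, norm_zero] at this
    linarith [h ▸ hxy]
  · obtain ⟨hzΩ, h1, h2, h3⟩ := hball z hz
    have hzx : z ≠ x := fun h => by
      rw [h, sub_self, norm_zero] at h2; linarith
    rw [hH.green_symm hx hzΩ]
    have h4 := (hG z hzΩ (by linarith) x hx hzx).2 (by rwa [norm_sub_rev])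
    rw [norm_sub_rev] at h4
    calc _ ≤ K * (bdist Ω z / ‖x - z‖) := h4
      _ ≤ K * ((3 / 2 * bdist Ω y) / (‖x - y‖ / 2)) := by
          gcongr
      _ = _ := by ring

end estimates

/-! ### The equation satisfied by configurations with dependent gradients -/

section gradient

variable {Ω : Set ℂ} {H : ℂ → ℂ → ℝ}

/-- The derivative of the one-body part of the energy at a point `x`. -/
noncomputable def gradSelf (H : ℂ → ℂ → ℝ) (Z : Finset ℂ) (α : ℂ → ℝ) (x v : ℂ) : ℝ :=
  fderiv ℝ (H x) x v - ∑ p ∈ Z, (α p / 2) * gradGreen H p x v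

lemma RegPart.exists_hasFDerivAt_pair (hΩo : IsOpen Ω) (hH : RegPart Ω H)
    (hHC1 : ContDiffOn ℝ 1 (fun q : ℂ × ℂ => H q.1 q.2) (Ω ×ˢ Ω)) {x y : ℂ} (hx : x ∈ Ω)
    (hy : y ∈ Ω) :
    ∃ L : ℂ × ℂ →L[ℝ] ℝ, HasFDerivAt (fun q : ℂ × ℂ => H q.1 q.2) L (x, y) ∧
      ∀ u v, L (u, v) = fderiv ℝ (H y) x u + fderiv ℝ (H x) y v := by
  have hmem : Ω ×ˢ Ω ∈ 𝓝 (x, y) := (hΩo.prod hΩo).mem_nhds ⟨hx, hy⟩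
  have hd := ((hHC1.contDiffAt hmem).differentiableAt (by norm_num)).hasFDerivAt
  set L := fderiv ℝ (fun q : ℂ × ℂ => H q.1 q.2) (x, y)
  refine ⟨L, hd, fun u v => ?_⟩
  have h1 : HasFDerivAt (fun z => H z y) (L.comp (ContinuousLinearMap.inl ℝ ℂ ℂ)) x :=
    HasFDerivAt.comp (g := fun q : ℂ × ℂ => H q.1 q.2) (f := fun z => (z, y)) x hd
      (hasFDerivAt_prodMk_left x y)
  have h2 : HasFDerivAt (H x) (L.comp (ContinuousLinearMap.inr ℝ ℂ ℂ)) y :=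
    HasFDerivAt.comp (g := fun q : ℂ × ℂ => H q.1 q.2) (f := fun z => (x, z)) y hd
      (hasFDerivAt_prodMk_right x y)
  have h3 : fderiv ℝ (H y) x = fderiv ℝ (fun z => H z y) x := by
    refine Filter.EventuallyEq.fderiv_eq ?_
    filter_upwards [hΩo.mem_nhds hx] with z hz using hH.symm hy hz
  rw [h3, h1.fderiv, h2.fderiv]
  simp [← map_add]

lemma RegPart.exists_hasFDerivAt_green (hΩo : IsOpen Ω) (hH : RegPart Ω H)
    (hHC1 : ContDiffOn ℝ 1 (fun q : ℂ × ℂ => H q.1 q.2) (Ω ×ˢ Ω)) {x y : ℂ} (hx : x ∈ Ω)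
    (hy : y ∈ Ω) (hxy : x ≠ y) :
    ∃ L : ℂ × ℂ →L[ℝ] ℝ, HasFDerivAt (fun q : ℂ × ℂ => green H q.1 q.2) L (x, y) ∧
      ∀ u v, L (u, v) = gradGreen H y x u + gradGreen H x y v := by
  obtain ⟨L, hL, hLe⟩ := hH.exists_hasFDerivAt_pair hΩo hHC1 hx hy
  have hlog : HasFDerivAt (fun q : ℂ × ℂ => Real.log ‖q.1 - q.2‖) _ (x, y) :=
    (hasFDerivAt_log_norm (sub_ne_zero.2 hxy)).comp (x, y)
      (f := fun q : ℂ × ℂ => q.1 - q.2) (hasFDerivAt_fst.sub hasFDerivAt_snd)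
  refine ⟨_, ((hL.sub (hlog.const_mul (1 / (2 * π)))).congr_of_eventuallyEq
    (Eventually.of_forall fun q => green_eq H q.1 q.2)), fun u v => ?_⟩
  have e : inner ℝ (y - x) v = - inner ℝ (x - y) v := by rw [← inner_neg_left, neg_sub]
  simp [hLe, gradGreen, e, norm_sub_rev y x]
  ring

lemma RegPart.gradient_eq (hΩo : IsOpen Ω) (hH : RegPart Ω H)
    (hHC1 : ContDiffOn ℝ 1 (fun q : ℂ × ℂ => H q.1 q.2) (Ω ×ˢ Ω)) {Z : Finset ℂ}
    (hZ : (Z : Set ℂ) ⊆ Ω) (α : ℂ → ℝ) {N : ℕ} {ξ : Fin N → ℂ} (hξ : memM Ω Z ξ) {β₁ β₂ : ℝ}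
    (h : β₁ • fderiv ℝ (fun ξ : Fin N → ℂ => PsiFun H Z α ξ) ξ +
      β₂ • fderiv ℝ (fun ξ : Fin N → ℂ => PhiFun H Z α ξ) ξ = 0) (j : Fin N) (v : ℂ) :
    (β₁ + β₂) * gradSelf H Z α (ξ j) v +
      (β₁ - β₂) * ∑ k, (if j ≠ k then gradGreen H (ξ k) (ξ j) v else 0) = 0 := by
  have hproj : ∀ i, HasFDerivAt (fun η : Fin N → ℂ => η i)
      (ContinuousLinearMap.proj (R := ℝ) (φ := fun _ => ℂ) i) ξ := fun i => hasFDerivAt_apply i ξ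
  have hself : ∀ i, ∃ L : (Fin N → ℂ) →L[ℝ] ℝ,
      HasFDerivAt (fun η : Fin N → ℂ => H (η i) (η i)) L ξ ∧
      ∀ w, L w = 2 * fderiv ℝ (H (ξ i)) (ξ i) (w i) := by
    intro i
    obtain ⟨L, hL, hLe⟩ := hH.exists_hasFDerivAt_pair hΩo hHC1 (hξ.1 i).1 (hξ.1 i).1
    refine ⟨_, HasFDerivAt.comp (g := fun q : ℂ × ℂ => H q.1 q.2)
      (f := fun η : Fin N → ℂ => (η i, η i)) ξ hL ((hproj i).prodMk (hproj i)), fun w => ?_⟩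
    simp [hLe]; ring
  have hpole : ∀ i, ∀ p : Z, ∃ L : (Fin N → ℂ) →L[ℝ] ℝ,
      HasFDerivAt (fun η : Fin N → ℂ => green H (η i) p) L ξ ∧
      ∀ w, L w = gradGreen H p (ξ i) (w i) := by
    intro i p
    obtain ⟨L, hL, hLe⟩ := hH.exists_hasFDerivAt_green hΩo hHC1 (hξ.1 i).1 (hZ p.2)
      (fun e => (hξ.1 i).2 (e ▸ p.2))
    refine ⟨_, HasFDerivAt.comp (g := fun q : ℂ × ℂ => green H q.1 q.2)
      (f := fun η : Fin N → ℂ => (η i, (p : ℂ))) ξ hL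
      ((hproj i).prodMk (hasFDerivAt_const _ _)), fun w => ?_⟩
    simp [hLe, gradGreen]
  have hpair : ∀ i k, ∃ L : (Fin N → ℂ) →L[ℝ] ℝ,
      HasFDerivAt (fun η : Fin N → ℂ => if i ≠ k then green H (η i) (η k) else 0) L ξ ∧
      ∀ w, L w = (if i ≠ k then gradGreen H (ξ k) (ξ i) (w i) else 0) +
        (if i ≠ k then gradGreen H (ξ i) (ξ k) (w k) else 0) := by
    intro i k
    by_cases hik : i = k
    · exact ⟨0, by simpa [hik] using hasFDerivAt_const _ _, by simp [hik]⟩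
    · obtain ⟨L, hL, hLe⟩ := hH.exists_hasFDerivAt_green hΩo hHC1 (hξ.1 i).1 (hξ.1 k).1
        (fun e => hik (hξ.2 e))
      simp only [ne_eq, hik, not_false_eq_true, if_true]
      refine ⟨_, HasFDerivAt.comp (g := fun q : ℂ × ℂ => green H q.1 q.2)
        (f := fun η : Fin N → ℂ => (η i, η k)) ξ hL ((hproj i).prodMk (hproj k)), fun w => ?_⟩
      simp [hLe]
  choose L1 hL1 hL1e using hself
  choose L2 hL2 hL2e using hpole
  choose L3 hL3 hL3e using hpair
  have hA : HasFDerivAt (fun η : Fin N → ℂ => (1 / 2) * ∑ j, H (η j) (η j) -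
      ∑ p ∈ Z, (α p / 2) * ∑ j, green H (η j) p)
      ((1 / 2 : ℝ) • ∑ i, L1 i - ∑ p : Z, (α p / 2) • ∑ i, L2 i p) ξ := by
    simp_rw [← Finset.sum_coe_sort Z]
    exact ((HasFDerivAt.fun_sum fun i _ => hL1 i).const_mul (1 / 2)).sub
      (HasFDerivAt.fun_sum fun p _ =>
        (HasFDerivAt.fun_sum fun i _ => hL2 i p).const_mul (α p / 2))
  have hB : HasFDerivAt (fun η : Fin N → ℂ => (1 / 2) * ∑ j, ∑ k,
      if j ≠ k then green H (η j) (η k) else 0) ((1 / 2 : ℝ) • ∑ i, ∑ k, L3 i k) ξ :=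
    (HasFDerivAt.fun_sum fun i _ => HasFDerivAt.fun_sum fun k _ => hL3 i k).const_mul (1 / 2)
  unfold PsiFun PhiFun at h
  rw [(hA.fun_add hB).fderiv, (hA.fun_sub hB).fderiv] at h
  have h1 := congrArg (fun L => L (Pi.single j v)) h
  have hS1 : ((1 / 2 : ℝ) • ∑ i, L1 i - ∑ p : Z, (α p / 2) • ∑ i, L2 i p) (Pi.single j v) =
      gradSelf H Z α (ξ j) v := by
    have e1 : ∀ i, fderiv ℝ (H (ξ i)) (ξ i) ((Pi.single j v : Fin N → ℂ) i) =
        if i = j then fderiv ℝ (H (ξ j)) (ξ j) v else 0 := by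
      intro i
      by_cases hij : i = j
      · subst hij; simp
      · simp [hij]
    have e2 : ∀ p i, gradGreen H p (ξ i) ((Pi.single j v : Fin N → ℂ) i) =
        if i = j then gradGreen H p (ξ j) v else 0 := by
      intro p i
      by_cases hij : i = j
      · subst hij; simp
      · simp [hij, gradGreen]
    simp only [sub_apply, smul_apply, sum_apply, hL1e, hL2e, e1, e2, smul_eq_mul, gradSelf]
    simp [Finset.sum_attach Z fun p => α p / 2 * gradGreen H p (ξ j) v]
  have hS2 : ((1 / 2 : ℝ) • ∑ i, ∑ k, L3 i k) (Pi.single j v) =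
      ∑ k, (if j ≠ k then gradGreen H (ξ k) (ξ j) v else 0) := by
    simp only [smul_apply, sum_apply, hL3e, smul_eq_mul]
    simp only [Finset.sum_add_distrib]
    rw [Finset.sum_comm (f := fun i k => if i ≠ k then
      gradGreen H (ξ i) (ξ k) ((Pi.single j v : Fin N → ℂ) k) else 0)]
    have e : ∀ i, ∑ k, (if i ≠ k then
        gradGreen H (ξ k) (ξ i) ((Pi.single j v : Fin N → ℂ) i) else 0) =
        if i = j then ∑ k, (if j ≠ k then gradGreen H (ξ k) (ξ j) v else 0) else 0 := by
      intro i
      by_cases hij : i = j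
      · subst hij; simp
      · simp [hij, gradGreen]
    have e' : ∀ i, ∑ k, (if k ≠ i then
        gradGreen H (ξ k) (ξ i) ((Pi.single j v : Fin N → ℂ) i) else 0) =
        if i = j then ∑ k, (if j ≠ k then gradGreen H (ξ k) (ξ j) v else 0) else 0 := by
      intro i
      rw [← e i]
      simp only [ne_comm]
    simp only [e, e', Finset.sum_ite_eq', Finset.mem_univ, if_true]
    ring
  simp only [add_apply, smul_apply, sub_apply, zero_apply, smul_eq_mul] at h1 hS1 hS2
  rw [hS1, hS2] at h1
  linarith

end gradient

/-! ### Balance identities along an ultrafilter -/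

section ultrafilter

variable {β E E' : Type*} [SeminormedAddCommGroup E] [SeminormedAddCommGroup E']

lemma Ultrafilter.exists_eventually_of_eventually_exists {ι : Type*} [Finite ι]
    (ℓ : Ultrafilter β) {p : ι → β → Prop} (h : ∀ᶠ n in ℓ, ∃ j, p j n) :
    ∃ j, ∀ᶠ n in ℓ, p j n := by
  by_contra! hcon
  have h1 : ∀ j, ∀ᶠ n in ℓ, ¬ p j n := fun j =>
    Ultrafilter.eventually_not.2 (by simpa using hcon j)
  obtain ⟨n, ⟨j, hj⟩, hn⟩ := (h.and (eventually_all.2 h1)).exists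
  exact hn j hj

lemma Ultrafilter.isLittleO_of_not_isBigO (ℓ : Ultrafilter β) {f : β → E} {g : β → E'}
    (h : ¬ f =O[ℓ] g) : g =o[ℓ] f := by
  rw [isLittleO_iff]
  intro c hc
  by_contra hcon
  refine h (IsBigO.of_bound c⁻¹ ?_)
  filter_upwards [Ultrafilter.eventually_not.2 hcon] with n hn
  rw [not_le] at hn
  rw [inv_mul_eq_div, le_div_iff₀ hc, mul_comm]
  exact hn.le

lemma Ultrafilter.exists_tendsto_of_norm_le [ProperSpace E] (ℓ : Ultrafilter β) {f : β → E}
    {C : ℝ} (h : ∀ᶠ n in ℓ, ‖f n‖ ≤ C) : ∃ a, Tendsto f ℓ (𝓝 a) := by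
  obtain ⟨a, -, ha⟩ := (isCompact_closedBall (0 : E) C).ultrafilter_le_nhds (ℓ.map f)
    (le_principal_iff.2 (by simpa [Filter.Eventually, Set.preimage] using h))
  exact ⟨a, ha⟩

end ultrafilter

lemma inner_div_add_inner_div {x y : ℂ} (h : x - y ≠ 0) (c : ℂ) :
    inner ℝ (x - y) (x - c) / ‖x - y‖ ^ 2 + inner ℝ (y - x) (y - c) / ‖y - x‖ ^ 2 = 1 := by
  have hn : ‖x - y‖ ^ 2 ≠ 0 := by simpa using h
  rw [norm_sub_rev y x, ← add_div, div_eq_one_iff_eq hn, ← neg_sub x y, inner_neg_left,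
    ← sub_eq_add_neg, ← inner_sub_right, sub_sub_sub_cancel_right, real_inner_self_eq_norm_sq]

/-- A sequence of configurations solving the weighted gradient equation, with all points and
weights converging along an ultrafilter. -/
structure BalancedSequence (Ω : Set ℂ) (H : ℂ → ℂ → ℝ) (Z : Finset ℂ) (α : ℂ → ℝ) (N : ℕ) where
  isOpen : IsOpen Ω
  isBounded : Bornology.IsBounded Ω
  nonempty : Ω.Nonempty
  frame : BoundaryFrame Ω
  regPart : RegPart Ω H
  subset : (Z : Set ℂ) ⊆ Ω
  filter : Ultrafilter ℕ
  point : Fin N → ℕ → ℂ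
  weightSelf : ℕ → ℝ
  weightPair : ℕ → ℝ
  limPoint : Fin N → ℂ
  limSelf : ℝ
  limPair : ℝ
  mem : ∀ j n, point j n ∈ Ω
  notMem : ∀ j n, point j n ∉ Z
  ne : ∀ n j k, j ≠ k → point j n ≠ point k n
  equation : ∀ n j v, weightSelf n * gradSelf H Z α (point j n) v +
    weightPair n * ∑ k, (if j ≠ k then gradGreen H (point k n) (point j n) v else 0) = 0
  tendsto_point : ∀ j, Tendsto (point j) filter (𝓝 (limPoint j))
  tendsto_self : Tendsto weightSelf filter (𝓝 limSelf)
  tendsto_pair : Tendsto weightPair filter (𝓝 limPair)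

namespace BalancedSequence

variable {Ω : Set ℂ} {H : ℂ → ℂ → ℝ} {Z : Finset ℂ} {α : ℂ → ℝ} {N : ℕ}
  (B : BalancedSequence Ω H Z α N)

lemma frontier_nonempty (B : BalancedSequence Ω H Z α N) : (frontier Ω).Nonempty :=
  frontier_nonempty_of_bounded B.nonempty B.isBounded

lemma bdist_point_pos (j : Fin N) (n : ℕ) : 0 < bdist Ω (B.point j n) :=
  bdist_pos B.isOpen B.frontier_nonempty (B.mem j n)

lemma tendsto_bdist (j : Fin N) :
    Tendsto (fun n => bdist Ω (B.point j n)) B.filter (𝓝 (bdist Ω (B.limPoint j))) :=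
  ((continuous_bdist Ω).tendsto _).comp (B.tendsto_point j)

lemma balance (I : Finset (Fin N)) (V : Fin N → ℕ → ℂ) {a b : ℝ}
    (hself : ∀ j ∈ I, Tendsto (fun n => gradSelf H Z α (B.point j n) (V j n)) B.filter (𝓝 a))
    (hout : ∀ j ∈ I, ∀ k ∉ I,
      Tendsto (fun n => gradGreen H (B.point k n) (B.point j n) (V j n)) B.filter (𝓝 0))
    (hin : ∀ j ∈ I, ∀ k ∈ I, j ≠ k →
      Tendsto (fun n => gradGreen H (B.point k n) (B.point j n) (V j n) +
        gradGreen H (B.point j n) (B.point k n) (V k n)) B.filter (𝓝 b)) :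
    2 * B.limSelf * (I.card * a) + B.limPair * (I.card * (I.card - 1) * b) = 0 := by
  classical
  set g : Fin N → Fin N → ℕ → ℝ := fun j k n =>
    if j ≠ k then gradGreen H (B.point k n) (B.point j n) (V j n) else 0 with hg
  have h1 : Tendsto (fun n => ∑ j ∈ I, gradSelf H Z α (B.point j n) (V j n)) B.filter
      (𝓝 (I.card * a)) := by
    simpa using tendsto_finsetSum I hself
  have h2 : Tendsto (fun n => ∑ j ∈ I, ∑ k ∈ Iᶜ, g j k n) B.filter (𝓝 0) := by
    have : Tendsto (fun n => ∑ j ∈ I, ∑ k ∈ Iᶜ, g j k n) B.filter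
        (𝓝 (∑ j ∈ I, ∑ k ∈ Iᶜ, 0)) := by
      refine tendsto_finsetSum I fun j hj => tendsto_finsetSum _ fun k hk => ?_
      rw [Finset.mem_compl] at hk
      have hjk : j ≠ k := fun e => hk (e ▸ hj)
      simpa only [hg, if_pos hjk] using hout j hj k hk
    simpa using this
  have h3 : Tendsto (fun n => ∑ j ∈ I, ∑ k ∈ I, (g j k n + g k j n)) B.filter
      (𝓝 (I.card * (I.card - 1) * b)) := by
    have : Tendsto (fun n => ∑ j ∈ I, ∑ k ∈ I, (g j k n + g k j n)) B.filter
        (𝓝 (∑ j ∈ I, ∑ k ∈ I, if j ≠ k then b else 0)) := by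
      refine tendsto_finsetSum I fun j hj => tendsto_finsetSum _ fun k hk => ?_
      by_cases hjk : j = k
      · simp [hg, hjk]
      · simpa only [hg, ne_eq, hjk, Ne.symm hjk, eq_comm (a := k), not_false_eq_true, if_true]
          using hin j hj k hk hjk
    have e : ∑ j ∈ I, ∑ k ∈ I, (if j ≠ k then b else 0) = I.card * (I.card - 1) * b := by
      have : ∀ j ∈ I, ∑ k ∈ I, (if j ≠ k then b else 0) = (I.card - 1) * b := by
        intro j hj
        have : ∀ k, (if j ≠ k then b else 0) = b - if j = k then b else 0 := by
          intro k; by_cases h : j = k <;> simp [h]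
        simp only [this, Finset.sum_sub_distrib, Finset.sum_ite_eq, hj, if_true]
        simp
        ring
      rw [Finset.sum_congr rfl this]
      simp
      ring
    rwa [e] at this
  have h4 : ∀ n, 2 * B.weightSelf n * ∑ j ∈ I, gradSelf H Z α (B.point j n) (V j n) +
      B.weightPair n * (∑ j ∈ I, ∑ k ∈ I, (g j k n + g k j n) +
        2 * ∑ j ∈ I, ∑ k ∈ Iᶜ, g j k n) = 0 := by
    intro n
    have e1 : ∑ j ∈ I, ∑ k ∈ I, (g j k n + g k j n) = 2 * ∑ j ∈ I, ∑ k ∈ I, g j k n := by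
      simp only [Finset.sum_add_distrib]
      rw [Finset.sum_comm (f := fun j k => g k j n)]
      ring
    have e2 : ∑ j ∈ I, (B.weightSelf n * gradSelf H Z α (B.point j n) (V j n) +
        B.weightPair n * (∑ k ∈ I, g j k n + ∑ k ∈ Iᶜ, g j k n)) = 0 := by
      refine Finset.sum_eq_zero fun j _ => ?_
      rw [Finset.sum_add_sum_compl]
      exact B.equation n j (V j n)
    rw [Finset.sum_add_distrib, ← Finset.mul_sum, ← Finset.mul_sum, Finset.sum_add_distrib] at e2
    rw [e1]
    linarith
  have h5 := ((B.tendsto_self.const_mul 2).mul h1).add (B.tendsto_pair.mul (h3.add (h2.const_mul 2)))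
  simp only [h4] at h5
  have h6 := tendsto_nhds_unique h5 tendsto_const_nhds
  simpa using h6

/-- The indices whose points lie within `O(r)` of the centre `c`. -/
noncomputable def cluster {E : Type*} [SeminormedAddCommGroup E] (c : ℕ → ℂ) (r : ℕ → E) :
    Finset (Fin N) :=
  open Classical in Finset.univ.filter fun j => (fun n => B.point j n - c n) =O[B.filter] r

lemma mem_cluster {E : Type*} [SeminormedAddCommGroup E] {c : ℕ → ℂ} {r : ℕ → E} {j : Fin N} :
    j ∈ B.cluster c r ↔ (fun n => B.point j n - c n) =O[B.filter] r := by
  classical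
  simp [cluster]

lemma isLittleO_of_notMem_cluster {E : Type*} [SeminormedAddCommGroup E] {c : ℕ → ℂ} {r : ℕ → E}
    {k : Fin N} (hk : k ∉ B.cluster c r) {j : Fin N} (hj : j ∈ B.cluster c r) :
    r =o[B.filter] fun n => B.point k n - B.point j n := by
  rw [mem_cluster] at hk hj
  have h1 := B.filter.isLittleO_of_not_isBigO hk
  refine h1.trans_isBigO (((hj.trans_isLittleO h1).right_isBigO_sub).congr_right fun n => ?_)
  ring

lemma tendsto_fderiv_zero {x y V : ℕ → ℂ} (hx : ∀ n, x n ∈ Ω) (hy : ∀ n, y n ∈ Ω)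
    (h : V =o[B.filter] fun n => bdist Ω (y n)) :
    Tendsto (fun n => fderiv ℝ (H (x n)) (y n) (V n)) B.filter (𝓝 0) := by
  obtain ⟨K, -, hK⟩ := B.regPart.exists_abs_fderiv_le B.isOpen B.isBounded B.nonempty B.frame
  refine squeeze_zero_norm (fun n => hK (x n) (hx n) (y n) (hy n) (V n)) ?_
  simpa using h.norm_left.tendsto_div_nhds_zero.const_mul K

lemma tendsto_inner_div_zero {z V : ℕ → ℂ} (h : V =o[B.filter] z) :
    Tendsto (fun n => inner ℝ (z n) (V n) / ‖z n‖ ^ 2) B.filter (𝓝 0) :=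
  squeeze_zero_norm (fun n => abs_inner_div_norm_sq_le (z n) (V n))
    h.norm_norm.tendsto_div_nhds_zero

lemma tendsto_gradGreen_zero {x y V : ℕ → ℂ} (hx : ∀ n, x n ∈ Ω) (hy : ∀ n, y n ∈ Ω)
    (h1 : V =o[B.filter] fun n => bdist Ω (y n)) (h2 : V =o[B.filter] fun n => y n - x n) :
    Tendsto (fun n => gradGreen H (x n) (y n) (V n)) B.filter (𝓝 0) := by
  simpa [gradGreen] using (B.tendsto_fderiv_zero hx hy h1).sub
    ((B.tendsto_inner_div_zero h2).const_mul (1 / (2 * π)))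

/-- Balance of a cluster that is small compared with its distance to the boundary. -/
lemma balance_interior {E : Type*} [SeminormedAddCommGroup E] (c : ℕ → ℂ) (r : ℕ → E) {a : ℝ}
    (hd : ∀ j ∈ B.cluster c r, r =o[B.filter] fun n => bdist Ω (B.point j n))
    (hpole : ∀ j ∈ B.cluster c r, Tendsto (fun n => ∑ p ∈ Z, (α p / 2) *
      gradGreen H p (B.point j n) (B.point j n - c n)) B.filter (𝓝 (-a))) :
    B.limSelf * ((B.cluster c r).card * a) =
      B.limPair * ((B.cluster c r).card * ((B.cluster c r).card - 1) / (4 * π)) := by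
  have hV : ∀ j ∈ B.cluster c r, (fun n => B.point j n - c n) =o[B.filter]
      fun n => bdist Ω (B.point j n) := fun j hj => (B.mem_cluster.1 hj).trans_isLittleO (hd j hj)
  have h := B.balance (B.cluster c r) (fun j n => B.point j n - c n) (a := a)
    (b := -(1 / (2 * π))) ?_ ?_ ?_
  · field_simp at h ⊢
    linarith
  · intro j hj
    simpa [gradSelf] using (B.tendsto_fderiv_zero (B.mem j) (B.mem j) (hV j hj)).sub (hpole j hj)
  · intro j hj k hk
    refine B.tendsto_gradGreen_zero (B.mem k) (B.mem j) (hV j hj) ?_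
    exact ((B.mem_cluster.1 hj).trans_isLittleO
      (B.isLittleO_of_notMem_cluster hk hj)).trans_isBigO (isBigO_of_le _ fun n => by
        rw [norm_sub_rev])
  · intro j hj k hk hjk
    have h1 := (B.tendsto_fderiv_zero (B.mem k) (B.mem j) (hV j hj)).add
      (B.tendsto_fderiv_zero (B.mem j) (B.mem k) (hV k hk))
    have h2 := h1.sub (tendsto_const_nhds (x := 1 / (2 * π)))
    rw [add_zero, zero_sub] at h2
    refine h2.congr fun n => ?_
    have hne : B.point j n - B.point k n ≠ 0 := sub_ne_zero.2 (B.ne n j k hjk)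
    have e := inner_div_add_inner_div hne (c n)
    rw [gradGreen, gradGreen]
    linear_combination (1 / (2 * π)) * e

lemma isLittleO_of_tendsto {E E' : Type*} [NormedAddCommGroup E] [SeminormedAddCommGroup E']
    {f : ℕ → E'} {g : ℕ → E} {b : E} (hf : Tendsto f B.filter (𝓝 0)) (hg : Tendsto g B.filter (𝓝 b))
    (hb : b ≠ 0) : f =o[B.filter] g := by
  have h1 : (fun _ => (1 : ℝ)) =O[B.filter] g := by
    have hpos := norm_pos_iff.2 hb
    refine IsBigO.of_bound (2 / ‖b‖) ?_
    filter_upwards [hg.norm.eventually (lt_mem_nhds (half_lt_self hpos))] with n hn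
    rw [norm_one, div_mul_eq_mul_div, le_div_iff₀ hpos]
    linarith
  exact ((isLittleO_one_iff ℝ).2 hf).trans_isBigO h1

/-- A collision at a scale smaller than the distance to the boundary and to the poles kills the
pair interaction. -/
lemma limPair_eq_zero_of_collision {j₀ k₀ : Fin N} (hjk : j₀ ≠ k₀)
    (hd : (fun n => B.point k₀ n - B.point j₀ n) =o[B.filter]
      fun n => bdist Ω (B.point j₀ n))
    (hZ : ∀ p ∈ Z, (fun n => B.point k₀ n - B.point j₀ n) =o[B.filter]
      fun n => B.point j₀ n - p) : B.limPair = 0 := by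
  set r : ℕ → ℂ := fun n => B.point k₀ n - B.point j₀ n with hr
  set I := B.cluster (B.point j₀) r with hI
  have hj₀ : j₀ ∈ I := B.mem_cluster.2 (by simpa using isBigO_zero _ _)
  have hk₀ : k₀ ∈ I := B.mem_cluster.2 (isBigO_refl _ _)
  have hd' : ∀ j ∈ I, r =o[B.filter] fun n => bdist Ω (B.point j n) := by
    intro j hj
    refine hd.trans_isBigO ?_
    refine IsBigO.of_bound 2 ?_
    filter_upwards [((B.mem_cluster.1 hj).trans_isLittleO hd).bound (c := 1 / 2) (by norm_num)]
      with n hn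
    have h3 := bdist_le_add Ω (B.point j₀ n) (B.point j n)
    rw [norm_sub_rev] at h3
    rw [Real.norm_of_nonneg (B.bdist_point_pos _ _).le] at hn ⊢
    rw [Real.norm_of_nonneg (B.bdist_point_pos _ _).le]
    linarith
  have h := B.balance_interior (B.point j₀) r (a := 0) hd' ?_
  · have hc : (1 : ℝ) < I.card := by
      exact_mod_cast Finset.one_lt_card.2 ⟨j₀, hj₀, k₀, hk₀, hjk⟩
    rw [mul_zero, mul_zero, eq_comm, mul_eq_zero] at h
    refine h.resolve_right (ne_of_gt ?_)
    have : 0 < (I.card : ℝ) - 1 := by linarith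
    positivity
  · intro j hj
    have hV := B.mem_cluster.1 hj
    have h0 : (0 : ℝ) = ∑ p ∈ Z, (α p / 2) * 0 := by simp
    rw [neg_zero, h0]
    refine tendsto_finsetSum _ fun p hp => Tendsto.const_mul _ ?_
    refine B.tendsto_gradGreen_zero (fun _ => B.subset hp) (B.mem j)
      (hV.trans_isLittleO (hd' j hj)) ?_
    have h1 := hV.trans_isLittleO (hZ p hp)
    refine h1.trans_isBigO (h1.right_isBigO_add.congr_right fun n => ?_)
    ring

lemma tendsto_gradGreen_pole (c : ℂ) {y : ℕ → ℂ} (hc : c ∈ Ω) (hy : ∀ n, y n ∈ Ω)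
    (hyc : ∀ n, y n ≠ c) (hlim : Tendsto y B.filter (𝓝 c)) :
    Tendsto (fun n => gradGreen H c (y n) (y n - c)) B.filter (𝓝 (-(1 / (2 * π)))) := by
  have hV : Tendsto (fun n => y n - c) B.filter (𝓝 0) := by
    simpa using hlim.sub_const c
  have h1 := B.tendsto_fderiv_zero (x := fun _ => c) (fun _ => hc) hy
    (B.isLittleO_of_tendsto hV (((continuous_bdist Ω).tendsto c).comp hlim)
      (bdist_pos B.isOpen B.frontier_nonempty hc).ne')
  have h2 := h1.sub (tendsto_const_nhds (x := 1 / (2 * π)))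
  rw [zero_sub] at h2
  refine h2.congr fun n => ?_
  have hne : ‖y n - c‖ ^ 2 ≠ 0 := by simpa using sub_ne_zero.2 (hyc n)
  rw [gradGreen, real_inner_self_eq_norm_sq, div_self hne, mul_one]

/-- Balance of the points accumulating at a pole at a given rate. -/
lemma balance_pole {p : ℂ} (hp : p ∈ Z) {j₀ : Fin N} (hj₀ : B.limPoint j₀ = p) :
    α p * B.limSelf =
      ((B.cluster (fun _ => p) fun n => B.point j₀ n - p).card - 1) * B.limPair := by
  set r : ℕ → ℂ := fun n => B.point j₀ n - p with hr
  set I := B.cluster (fun _ => p) r with hI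
  have hr0 : Tendsto r B.filter (𝓝 0) := by
    simpa [hr, hj₀] using (B.tendsto_point j₀).sub_const p
  have hV : ∀ j ∈ I, Tendsto (fun n => B.point j n - p) B.filter (𝓝 0) := fun j hj =>
    (B.mem_cluster.1 hj).trans_tendsto hr0
  have hlim : ∀ j ∈ I, Tendsto (B.point j) B.filter (𝓝 p) := fun j hj => by
    simpa using (hV j hj).add_const p
  have hbd : ∀ j ∈ I, Tendsto (fun n => bdist Ω (B.point j n)) B.filter (𝓝 (bdist Ω p)) :=
    fun j hj => ((continuous_bdist Ω).tendsto p).comp (hlim j hj)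
  have hp0 := (bdist_pos B.isOpen B.frontier_nonempty (B.subset hp)).ne'
  have h := B.balance_interior (fun _ => p) r (a := α p / (4 * π))
    (fun j hj => B.isLittleO_of_tendsto hr0 (hbd j hj) hp0) ?_
  · have hc : (0 : ℝ) < I.card := by
      exact_mod_cast Finset.card_pos.2 ⟨j₀, B.mem_cluster.2 (isBigO_refl _ _)⟩
    rw [← hI] at h
    field_simp at h
    linarith
  · intro j hj
    have h0 : -(α p / (4 * π)) = ∑ q ∈ Z, (α q / 2) * if q = p then -(1 / (2 * π)) else 0 := by
      simp [hp]
      ring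
    rw [h0]
    refine tendsto_finsetSum _ fun q hq => Tendsto.const_mul _ ?_
    by_cases hqp : q = p
    · subst hqp
      rw [if_pos rfl]
      exact B.tendsto_gradGreen_pole q (B.subset hq) (B.mem j)
        (fun n e => B.notMem j n (e ▸ hq)) (hlim j hj)
    · rw [if_neg hqp]
      exact B.tendsto_gradGreen_zero (fun _ => B.subset hq) (B.mem j)
        (B.isLittleO_of_tendsto (hV j hj) (hbd j hj) hp0)
        (B.isLittleO_of_tendsto (hV j hj) ((hlim j hj).sub_const q)
          (sub_ne_zero.2 (Ne.symm hqp)))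

end BalancedSequence

/-! ### Balance of the points closest to the boundary -/

lemma inner_reflect_add_inner_reflect {ν : ℂ} (hν : ‖ν‖ = 1) {X Y : ℂ}
    (h : X - (Y - (2 * inner ℝ Y ν) • ν) ≠ 0) :
    inner ℝ (X - (Y - (2 * inner ℝ Y ν) • ν)) X / ‖X - (Y - (2 * inner ℝ Y ν) • ν)‖ ^ 2 +
      inner ℝ (Y - (X - (2 * inner ℝ X ν) • ν)) Y / ‖Y - (X - (2 * inner ℝ X ν) • ν)‖ ^ 2 = 1 := by
  have hνν : inner ℝ ν ν = (1 : ℝ) := by rw [real_inner_self_eq_norm_sq, hν]; norm_num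
  have hXY := real_inner_comm X Y
  have hXν := real_inner_comm X ν
  have hYν := real_inner_comm Y ν
  have e : ‖Y - (X - (2 * inner ℝ X ν) • ν)‖ ^ 2 = ‖X - (Y - (2 * inner ℝ Y ν) • ν)‖ ^ 2 := by
    simp only [← real_inner_self_eq_norm_sq, inner_sub_left, inner_sub_right,
      real_inner_smul_left, real_inner_smul_right, hνν, hXY, hXν, hYν]
    ring
  have hn : ‖X - (Y - (2 * inner ℝ Y ν) • ν)‖ ^ 2 ≠ 0 := by simpa using h
  rw [e, ← add_div, div_eq_one_iff_eq hn]
  simp only [← real_inner_self_eq_norm_sq, inner_sub_left, inner_sub_right,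
    real_inner_smul_left, real_inner_smul_right, hνν, hXY, hXν, hYν]
  ring

namespace BalancedSequence

variable {Ω : Set ℂ} {H : ℂ → ℂ → ℝ} {Z : Finset ℂ} {α : ℂ → ℝ} {N : ℕ}
  (B : BalancedSequence Ω H Z α N)

/-- The foot on the boundary of the `j`-th point. -/
noncomputable def foot (j : Fin N) (n : ℕ) : ℂ := B.frame.foot (B.point j n)

/-- The distance to the boundary of the `j`-th point. -/
noncomputable def depth (j : Fin N) (n : ℕ) : ℝ := bdist Ω (B.point j n)

/-- The inward normal at the foot of the `j`-th point. -/
noncomputable def normal (j : Fin N) (n : ℕ) : ℂ := B.frame.normal (B.point j n)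

lemma depth_pos (j : Fin N) (n : ℕ) : 0 < B.depth j n := B.bdist_point_pos j n

variable {B} {j₀ : Fin N}

lemma depth_isBigO (h0 : Tendsto (B.depth j₀) B.filter (𝓝 0)) {j : Fin N}
    (hj : j ∈ B.cluster (B.foot j₀) (B.depth j₀)) :
    B.depth j =O[B.filter] B.depth j₀ := by
  refine IsBigO.trans (IsBigO.of_bound 1 ?_) (B.mem_cluster.1 hj)
  filter_upwards [h0.eventually (gt_mem_nhds B.frame.δ_pos)] with n hn
  rw [one_mul, Real.norm_of_nonneg (B.depth_pos j n).le]
  exact bdist_le_norm_sub (B.frame.foot_mem _ (B.mem j₀ n) hn)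

lemma depth_tendsto_zero (h0 : Tendsto (B.depth j₀) B.filter (𝓝 0)) {j : Fin N}
    (hj : j ∈ B.cluster (B.foot j₀) (B.depth j₀)) :
    Tendsto (B.depth j) B.filter (𝓝 0) :=
  (depth_isBigO h0 hj).trans_tendsto h0

lemma eventually_depth_lt (h0 : Tendsto (B.depth j₀) B.filter (𝓝 0)) {j : Fin N}
    (hj : j ∈ B.cluster (B.foot j₀) (B.depth j₀)) :
    ∀ᶠ n in B.filter, B.depth j n < B.frame.δ :=
  (depth_tendsto_zero h0 hj).eventually (gt_mem_nhds B.frame.δ_pos)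

lemma foot_sub_isBigO (h0 : Tendsto (B.depth j₀) B.filter (𝓝 0)) {j : Fin N}
    (hj : j ∈ B.cluster (B.foot j₀) (B.depth j₀)) :
    (fun n => B.foot j n - B.foot j₀ n) =O[B.filter] B.depth j₀ := by
  have h1 : (fun n => B.depth j n • B.normal j n) =O[B.filter] B.depth j₀ := by
    refine IsBigO.trans (IsBigO.of_bound 1 ?_) (depth_isBigO h0 hj)
    filter_upwards [eventually_depth_lt h0 hj] with n hn
    rw [norm_smul, normal, B.frame.norm_normal _ (B.mem j n) hn]
    simp
  refine ((B.mem_cluster.1 hj).sub h1).congr' ?_ (.refl _ _)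
  filter_upwards [eventually_depth_lt h0 hj] with n hn
  nth_rw 1 [B.frame.eq_add _ (B.mem j n) hn]
  simp only [foot, depth, normal]
  ring

lemma exists_tendsto_normal (h0 : Tendsto (B.depth j₀) B.filter (𝓝 0)) : ∃ ν : ℂ, ‖ν‖ = 1 ∧
    ∀ j ∈ B.cluster (B.foot j₀) (B.depth j₀), Tendsto (B.normal j) B.filter (𝓝 ν) := by
  have h1 : ∀ᶠ n in B.filter, ‖B.normal j₀ n‖ = 1 := by
    filter_upwards [h0.eventually (gt_mem_nhds B.frame.δ_pos)] with n hn
    exact B.frame.norm_normal _ (B.mem j₀ n) hn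
  obtain ⟨ν, hν⟩ := B.filter.exists_tendsto_of_norm_le (h1.mono fun n hn => hn.le)
  refine ⟨ν, tendsto_nhds_unique hν.norm (tendsto_const_nhds.congr' (h1.mono fun n hn => hn.symm)),
    fun j hj => ?_⟩
  have h2 : Tendsto (fun n => B.normal j n - B.normal j₀ n) B.filter (𝓝 0) := by
    have h3 : (fun n => B.normal j n - B.normal j₀ n) =O[B.filter] B.depth j₀ := by
      refine IsBigO.trans (IsBigO.of_bound (4 * B.frame.C) ?_) (foot_sub_isBigO h0 hj)
      filter_upwards [eventually_depth_lt h0 hj, h0.eventually (gt_mem_nhds B.frame.δ_pos)]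
        with n hn hn0
      exact B.frame.lip _ (B.mem j n) hn _ (B.mem j₀ n) hn0
    exact h3.trans_tendsto h0
  simpa using h2.add hν

lemma tendsto_depth_div (h0 : Tendsto (B.depth j₀) B.filter (𝓝 0)) {j : Fin N}
    (hj : j ∈ B.cluster (B.foot j₀) (B.depth j₀)) {X ν : ℂ}
    (hν : Tendsto (B.normal j) B.filter (𝓝 ν))
    (hX : Tendsto (fun n => (B.depth j₀ n)⁻¹ • (B.point j n - B.foot j₀ n)) B.filter (𝓝 X)) :
    Tendsto (fun n => (B.depth j₀ n)⁻¹ * B.depth j n) B.filter (𝓝 (inner ℝ X ν)) := by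
  have h1 : Tendsto (fun n => (B.depth j₀ n)⁻¹ *
      inner ℝ (B.foot j₀ n - B.foot j n) (B.normal j n)) B.filter (𝓝 0) := by
    have h2 : (fun n => inner ℝ (B.foot j₀ n - B.foot j n) (B.normal j n)) =o[B.filter]
        B.depth j₀ := by
      have h3 : (fun n => inner ℝ (B.foot j₀ n - B.foot j n) (B.normal j n)) =O[B.filter]
          fun n => ‖B.foot j n - B.foot j₀ n‖ ^ 2 := by
        refine IsBigO.of_bound B.frame.C ?_
        filter_upwards [eventually_depth_lt h0 hj, h0.eventually (gt_mem_nhds B.frame.δ_pos)]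
          with n hn hn0
        have h4 := B.frame.quad _ (B.mem j n) hn _ (B.frame.foot_mem _ (B.mem j₀ n) hn0)
        rw [Real.norm_eq_abs, norm_pow, norm_norm, norm_sub_rev (B.foot j n)]
        exact h4
      refine h3.trans_isLittleO (((foot_sub_isBigO h0 hj).norm_left.pow 2).trans_isLittleO ?_)
      have h5 : (fun n => B.depth j₀ n * B.depth j₀ n) =o[B.filter]
          fun n => B.depth j₀ n * 1 :=
        (isBigO_refl _ _).mul_isLittleO ((isLittleO_one_iff ℝ).2 h0)
      simpa [sq] using h5
    refine h2.tendsto_div_nhds_zero.congr fun n => ?_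
    rw [div_eq_inv_mul]
  have h6 := (hX.inner hν).add h1
  rw [add_zero] at h6
  refine h6.congr' ?_
  filter_upwards [eventually_depth_lt h0 hj] with n hn
  have h7 : B.point j n - B.foot j₀ n =
      B.depth j n • B.normal j n - (B.foot j₀ n - B.foot j n) := by
    nth_rw 1 [B.frame.eq_add _ (B.mem j n) hn]
    simp only [foot, depth, normal]
    ring
  have h8 : inner ℝ (B.normal j n) (B.normal j n) = (1 : ℝ) := by
    rw [real_inner_self_eq_norm_sq, normal, B.frame.norm_normal _ (B.mem j n) hn]
    norm_num
  rw [real_inner_smul_left, h7, inner_sub_left, real_inner_smul_left, h8]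
  ring

lemma exists_tendsto_rescaled {j : Fin N} (hj : j ∈ B.cluster (B.foot j₀) (B.depth j₀)) :
    ∃ X, Tendsto (fun n => (B.depth j₀ n)⁻¹ • (B.point j n - B.foot j₀ n)) B.filter (𝓝 X) := by
  obtain ⟨C, hC⟩ := (B.mem_cluster.1 hj).bound
  refine B.filter.exists_tendsto_of_norm_le (C := C) ?_
  filter_upwards [hC] with n hn
  have hd := B.depth_pos j₀ n
  rw [Real.norm_of_nonneg hd.le] at hn
  rw [norm_smul, norm_inv, Real.norm_of_nonneg hd.le, inv_mul_le_iff₀ hd, mul_comm]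
  exact hn

lemma tendsto_fderiv_regPart (h0 : Tendsto (B.depth j₀) B.filter (𝓝 0))
    (hmin : ∀ᶠ n in B.filter, ∀ k, B.depth j₀ n ≤ B.depth k n) :
    ∃ L : Fin N → Fin N → ℝ,
      (∀ j ∈ B.cluster (B.foot j₀) (B.depth j₀), ∀ k ∈ B.cluster (B.foot j₀) (B.depth j₀),
        L j k + L k j = 1 / (2 * π)) ∧
      ∀ j ∈ B.cluster (B.foot j₀) (B.depth j₀), ∀ k ∈ B.cluster (B.foot j₀) (B.depth j₀),
        Tendsto (fun n => fderiv ℝ (H (B.point k n)) (B.point j n)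
          (B.point j n - B.foot j₀ n)) B.filter (𝓝 (L j k)) := by
  classical
  set I := B.cluster (B.foot j₀) (B.depth j₀) with hI
  obtain ⟨ν, hν1, hν⟩ := exists_tendsto_normal h0
  have hX : ∀ j, ∃ X, j ∈ I → Tendsto (fun n => (B.depth j₀ n)⁻¹ •
      (B.point j n - B.foot j₀ n)) B.filter (𝓝 X) := by
    intro j
    by_cases hj : j ∈ I
    · obtain ⟨X, hX⟩ := exists_tendsto_rescaled hj
      exact ⟨X, fun _ => hX⟩
    · exact ⟨0, fun h => absurd h hj⟩
  choose X hX using hX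
  set W : Fin N → Fin N → ℂ := fun j k => X j - (X k - (2 * inner ℝ (X k) ν) • ν) with hW
  have hWlim : ∀ j ∈ I, ∀ k ∈ I, Tendsto (fun n => (B.depth j₀ n)⁻¹ •
      (B.point j n - B.frame.refl (B.point k n))) B.filter (𝓝 (W j k)) := by
    intro j hj k hk
    have h1 := (hX j hj).sub ((hX k hk).sub
      (((tendsto_depth_div h0 hk (hν k hk) (hX k hk)).const_mul 2).smul (hν k hk)))
    refine h1.congr' ?_
    filter_upwards [eventually_depth_lt h0 hk] with n hn
    have h2 := B.frame.sub_refl (B.mem k n) hn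
    have h3 : B.frame.refl (B.point k n) =
        B.point k n - (2 * B.depth k n) • B.normal k n := by
      rw [depth, normal, ← h2]; ring
    rw [h3]
    module
  have hWne : ∀ j ∈ I, ∀ k ∈ I, W j k ≠ 0 := by
    intro j hj k hk
    have h1 : 1 ≤ ‖W j k‖ := by
      refine ge_of_tendsto (hWlim j hj k hk).norm ?_
      filter_upwards [hmin, eventually_depth_lt h0 hk] with n hn hn'
      have hd := B.depth_pos j₀ n
      rw [norm_smul, norm_inv, Real.norm_of_nonneg hd.le, ← div_eq_inv_mul, one_le_div hd]
      exact (hn j).trans (B.frame.bdist_le_norm_sub_refl (B.mem k n) hn' (B.mem j n))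
    exact norm_pos_iff.1 (by linarith)
  refine ⟨fun j k => 1 / (2 * π) * (inner ℝ (W j k) (X j) / ‖W j k‖ ^ 2), ?_, ?_⟩
  · intro j hj k hk
    rw [← mul_add, inner_reflect_add_inner_reflect hν1 (hWne j hj k hk), mul_one]
  · intro j hj k hk
    have h1 := ((hWlim j hj k hk).inner (hX j hj)).div ((hWlim j hj k hk).norm.pow 2)
      (by simpa using hWne j hj k hk)
    have h2 : Tendsto (fun n => fderiv ℝ (H (B.point k n)) (B.point j n)
        (B.point j n - B.foot j₀ n) - 1 / (2 * π) *
        (inner ℝ (B.point j n - B.frame.refl (B.point k n)) (B.point j n - B.foot j₀ n) /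
          ‖B.point j n - B.frame.refl (B.point k n)‖ ^ 2)) B.filter (𝓝 0) := by
      obtain ⟨C, hC⟩ := (B.mem_cluster.1 hj).bound
      have h3 := (depth_tendsto_zero h0 hk).const_mul (32 * B.frame.C * C)
      rw [mul_zero] at h3
      refine squeeze_zero_norm' ?_ h3
      filter_upwards [eventually_depth_lt h0 hk, hC, hmin] with n hn hCn hmn
      refine (B.regPart.abs_fderiv_sub_refl_le B.isOpen B.isBounded B.frame (B.mem k n) hn
        (B.mem j n) _).trans ?_
      have hd := B.depth_pos j n
      have hd0 := B.depth_pos j₀ n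
      have hdk := B.depth_pos k n
      have hFC := B.frame.C_pos
      rw [Real.norm_of_nonneg hd0.le] at hCn
      have hC0 : 0 ≤ C := by
        by_contra! hneg
        have := norm_nonneg (B.point j n - B.foot j₀ n)
        nlinarith
      have h4 : ‖B.point j n - B.foot j₀ n‖ ≤ C * B.depth j n :=
        hCn.trans (by gcongr; exact hmn j)
      calc _ ≤ 32 * B.frame.C * B.depth k n / B.depth j n * (C * B.depth j n) := by
            simp only [depth] at *
            gcongr
        _ = _ := by field_simp
    have h5 := h2.add (h1.const_mul (1 / (2 * π)))
    rw [zero_add] at h5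
    refine h5.congr fun n => ?_
    have hd := B.depth_pos j₀ n
    have e : inner ℝ ((B.depth j₀ n)⁻¹ • (B.point j n - B.frame.refl (B.point k n)))
          ((B.depth j₀ n)⁻¹ • (B.point j n - B.foot j₀ n)) /
          ‖(B.depth j₀ n)⁻¹ • (B.point j n - B.frame.refl (B.point k n))‖ ^ 2 =
        inner ℝ (B.point j n - B.frame.refl (B.point k n)) (B.point j n - B.foot j₀ n) /
          ‖B.point j n - B.frame.refl (B.point k n)‖ ^ 2 := by
      rw [real_inner_smul_left, real_inner_smul_right, norm_smul, norm_inv,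
        Real.norm_of_nonneg hd.le, mul_pow, ← mul_assoc, ← sq]
      exact mul_div_mul_left _ _ (by positivity)
    rw [Pi.div_apply, e]
    ring

/-- If some points accumulate at the boundary then the self interaction is killed. -/
lemma limSelf_eq_zero_of_boundary (h0 : Tendsto (B.depth j₀) B.filter (𝓝 0))
    (hmin : ∀ᶠ n in B.filter, ∀ k, B.depth j₀ n ≤ B.depth k n) : B.limSelf = 0 := by
  set I := B.cluster (B.foot j₀) (B.depth j₀) with hI
  obtain ⟨L, hL, hLlim⟩ := tendsto_fderiv_regPart h0 hmin
  have hj₀ : j₀ ∈ I := by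
    refine B.mem_cluster.2 (IsBigO.of_bound 1 ?_)
    filter_upwards [h0.eventually (gt_mem_nhds B.frame.δ_pos)] with n hn
    nth_rw 1 [B.frame.eq_add _ (B.mem j₀ n) hn]
    rw [foot, add_sub_cancel_left, norm_smul, B.frame.norm_normal _ (B.mem j₀ n) hn, depth]
    simp
  obtain ⟨K, hK, hG⟩ := B.regPart.exists_abs_gradGreen_le B.isOpen B.isBounded B.nonempty B.frame
  have hfar : ∀ j ∈ I, ∀ x : ℕ → ℂ, (∀ n, x n ∈ Ω) →
      B.depth j₀ =o[B.filter] (fun n => x n - B.point j n) →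
      Tendsto (fun n => gradGreen H (x n) (B.point j n) (B.point j n - B.foot j₀ n))
        B.filter (𝓝 0) := by
    intro j hj x hx hxo
    have h1 := ((B.mem_cluster.1 hj).trans_isLittleO hxo).norm_norm.tendsto_div_nhds_zero
    have h1 := h1.const_mul K
    rw [mul_zero] at h1
    refine squeeze_zero_norm' ?_ h1
    filter_upwards [(depth_tendsto_zero h0 hj).eventually (gt_mem_nhds (half_pos B.frame.δ_pos)),
      ((depth_isBigO h0 hj).trans_isLittleO hxo).bound (c := 1 / 8) (by norm_num)] with n hn hn'
    rw [Real.norm_of_nonneg (B.depth_pos j n).le] at hn'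
    simp only [depth] at hn hn'
    exact hG _ (hx n) _ (B.mem j n) (by linarith) (by linarith) _
  have h := B.balance I (fun j n => B.point j n - B.foot j₀ n) (a := 1 / (4 * π)) (b := 0) ?_ ?_ ?_
  · have hc : (I.card : ℝ) ≠ 0 := by
      exact_mod_cast (Finset.card_pos.2 ⟨j₀, hj₀⟩).ne'
    simpa [hc, Real.pi_ne_zero] using h
  · intro j hj
    have h1 : Tendsto (fun n => ∑ p ∈ Z, (α p / 2) * gradGreen H p (B.point j n)
        (B.point j n - B.foot j₀ n)) B.filter (𝓝 (∑ p ∈ Z, (α p / 2) * 0)) := by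
      refine tendsto_finsetSum _ fun p hp => Tendsto.const_mul _ ?_
      refine hfar j hj (fun _ => p) (fun _ => B.subset hp) ?_
      have hp0 := bdist_pos B.isOpen B.frontier_nonempty (B.subset hp)
      have h2 : (fun _ => (1 : ℝ)) =O[B.filter] fun n => p - B.point j n := by
        refine IsBigO.of_bound (2 / bdist Ω p) ?_
        filter_upwards [(depth_tendsto_zero h0 hj).eventually (gt_mem_nhds (half_pos hp0))]
          with n hn
        have h3 := bdist_le_add Ω p (B.point j n)
        rw [depth] at hn
        rw [norm_one, div_mul_eq_mul_div, le_div_iff₀ hp0]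
        linarith
      exact ((isLittleO_one_iff ℝ).2 h0).trans_isBigO h2
    have h4 := (hLlim j hj j hj).sub h1
    have h5 := hL j hj j hj
    have h6 : L j j = 1 / (4 * π) := by
      have : 1 / (2 * π) = 2 * (1 / (4 * π)) := by field_simp; norm_num
      linarith
    simpa [h6, gradSelf] using h4
  · intro j hj k hk
    exact hfar j hj _ (B.mem k) (B.isLittleO_of_notMem_cluster hk hj)
  · intro j hj k hk hjk
    have h1 := ((hLlim j hj k hk).add (hLlim k hk j hj)).sub
      (tendsto_const_nhds (x := 1 / (2 * π)))
    rw [hL j hj k hk, sub_self] at h1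
    refine h1.congr fun n => ?_
    have hne : B.point j n - B.point k n ≠ 0 := sub_ne_zero.2 (B.ne n j k hjk)
    have e := inner_div_add_inner_div hne (B.foot j₀ n)
    rw [gradGreen, gradGreen]
    linear_combination (1 / (2 * π)) * e

end BalancedSequence

/-! ### Asymptotics of the energy -/

section asymptotics

variable {β : Type*}

lemma tendsto_finsetSum_atBot {ι : Type*} {l : Filter β} {s : Finset ι} {f : ι → β → ℝ} {i : ι}
    (hi : i ∈ s) (hlim : Tendsto (f i) l atBot)
    (hb : ∀ k ∈ s, IsBoundedUnder (· ≤ ·) l (f k)) :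
    Tendsto (fun n => ∑ k ∈ s, f k n) l atBot := by
  classical
  obtain ⟨M, hM⟩ := isBoundedUnder_le_sum (s.erase i) fun k hk => hb k (Finset.mem_of_mem_erase hk)
  refine tendsto_atBot_mono' l ?_ (tendsto_atBot_add_const_right l M hlim)
  filter_upwards [eventually_map.1 hM] with n hn
  rw [← Finset.add_sum_erase s _ hi]
  simp only [Finset.sum_apply] at hn
  gcongr

lemma isBoundedUnder_le_fun_sum {ι : Type*} {l : Filter β} {s : Finset ι} {f : ι → β → ℝ}
    (hb : ∀ k ∈ s, IsBoundedUnder (· ≤ ·) l (f k)) :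
    IsBoundedUnder (· ≤ ·) l (fun n => ∑ k ∈ s, f k n) := by
  have := isBoundedUnder_le_sum s hb
  convert this using 2
  simp

lemma Filter.Tendsto.not_isBigO_one {l : Filter β} [l.NeBot] {f : β → ℝ} (h : Tendsto f l atBot) :
    ¬ f =O[l] fun _ => (1 : ℝ) := fun hO => by
  obtain ⟨C, hC⟩ := hO.bound
  obtain ⟨n, h1, h2⟩ := (hC.and (h.eventually (eventually_lt_atBot (-C)))).exists
  rw [norm_one, mul_one, Real.norm_eq_abs] at h1
  linarith [neg_abs_le (f n)]

lemma tendsto_log_norm_atBot {l : Filter β} {f : β → ℂ} (h : Tendsto f l (𝓝 0))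
    (hne : ∀ n, f n ≠ 0) : Tendsto (fun n => Real.log ‖f n‖) l atBot := by
  refine Real.tendsto_log_nhdsNE_zero.comp (tendsto_nhdsWithin_iff.2 ⟨?_, ?_⟩)
  · simpa using h.norm
  · exact Eventually.of_forall fun n => norm_ne_zero_iff.2 (hne n)

lemma isBigO_log_norm {l : Filter β} {f : β → ℂ} {b : ℂ} (h : Tendsto f l (𝓝 b)) (hb : b ≠ 0) :
    (fun n => Real.log ‖f n‖) =O[l] fun _ => (1 : ℝ) :=
  (h.norm.log (norm_ne_zero_iff.2 hb)).isBigO_one ℝ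

lemma isBigO_log_norm_sub_log_norm {l : Filter β} {f g : β → ℂ} (hf : ∀ n, f n ≠ 0)
    (hg : ∀ n, g n ≠ 0) (hfg : f =O[l] g) (hgf : g =O[l] f) :
    (fun n => Real.log ‖f n‖ - Real.log ‖g n‖) =O[l] fun _ => (1 : ℝ) := by
  have key : ∀ {f g : β → ℂ}, (∀ n, f n ≠ 0) → (∀ n, g n ≠ 0) → f =O[l] g →
      ∃ C, ∀ᶠ n in l, Real.log ‖f n‖ - Real.log ‖g n‖ ≤ C := by
    intro f g hf hg hfg
    obtain ⟨c, hc, h⟩ := hfg.exists_pos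
    refine ⟨Real.log c, ?_⟩
    filter_upwards [h.bound] with n hn
    have h1 := norm_pos_iff.2 (hf n)
    have h2 := norm_pos_iff.2 (hg n)
    have h3 := Real.log_le_log h1 hn
    rw [Real.log_mul hc.ne' h2.ne'] at h3
    linarith
  obtain ⟨C, hC⟩ := key hf hg hfg
  obtain ⟨C', hC'⟩ := key hg hf hgf
  refine IsBigO.of_bound (max C C') ?_
  filter_upwards [hC, hC'] with n h1 h2
  rw [norm_one, mul_one, Real.norm_eq_abs, abs_le]
  constructor
  · linarith [le_max_right C C']
  · linarith [le_max_left C C']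

end asymptotics

namespace BalancedSequence

variable {Ω : Set ℂ} {H : ℂ → ℂ → ℝ} {Z : Finset ℂ} {α : ℂ → ℝ} {N : ℕ}
  (B : BalancedSequence Ω H Z α N)

lemma point_sub_ne {j k : Fin N} (h : j ≠ k) (n : ℕ) : B.point j n - B.point k n ≠ 0 :=
  sub_ne_zero.2 (B.ne n j k h)

lemma point_sub_pole_ne {p : ℂ} (hp : p ∈ Z) (j : Fin N) (n : ℕ) : B.point j n - p ≠ 0 :=
  sub_ne_zero.2 fun e => B.notMem j n (e ▸ hp)

lemma tendsto_point_sub_pole {p : ℂ} {j : Fin N} (hj : B.limPoint j = p) :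
    Tendsto (fun n => B.point j n - p) B.filter (𝓝 0) := by
  simpa [hj] using (B.tendsto_point j).sub_const p

lemma tendsto_point_sub_point {j k : Fin N} (h : B.limPoint j = B.limPoint k) :
    Tendsto (fun n => B.point k n - B.point j n) B.filter (𝓝 0) := by
  simpa [h] using (B.tendsto_point k).sub (B.tendsto_point j)

lemma limPoint_mem_closure (j : Fin N) : B.limPoint j ∈ closure Ω :=
  mem_closure_of_tendsto (B.tendsto_point j) (Eventually.of_forall (B.mem j))

/-- The indices whose points converge to `p`. -/
noncomputable def fiber (p : ℂ) : Finset (Fin N) :=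
  open Classical in Finset.univ.filter fun j => B.limPoint j = p

lemma mem_fiber {p : ℂ} {j : Fin N} : j ∈ B.fiber p ↔ B.limPoint j = p := by
  classical
  simp [fiber]

/-- If the pair interaction survives, all points accumulating at a pole do so at the same rate. -/
lemma cluster_eq_fiber (hT : B.limPair ≠ 0) {p : ℂ} (hp : p ∈ Z) {j : Fin N}
    (hj : B.limPoint j = p) :
    B.cluster (fun _ => p) (fun n => B.point j n - p) = B.fiber p := by
  ext k
  rw [mem_fiber]
  constructor
  · intro hk
    have h1 := (B.mem_cluster.1 hk).trans_tendsto (B.tendsto_point_sub_pole hj)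
    have h2 := tendsto_nhds_unique h1 ((B.tendsto_point k).sub_const p)
    exact (sub_eq_zero.1 h2.symm)
  · intro hk
    by_contra hcon
    have h1 := B.filter.isLittleO_of_not_isBigO (mt B.mem_cluster.2 hcon)
    have hsub : B.cluster (fun _ => p) (fun n => B.point j n - p) ⊆
        B.cluster (fun _ => p) (fun n => B.point k n - p) := fun i hi =>
      B.mem_cluster.2 ((B.mem_cluster.1 hi).trans h1.isBigO)
    have hk' : k ∈ B.cluster (fun _ => p) (fun n => B.point k n - p) :=
      B.mem_cluster.2 (isBigO_refl _ _)
    have hlt := Finset.card_lt_card (Finset.ssubset_iff_subset_ne.2 ⟨hsub, fun e =>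
      hcon (e ▸ hk')⟩)
    have e1 := B.balance_pole hp hj
    rw [B.balance_pole hp hk] at e1
    have e2 := mul_right_cancel₀ hT e1
    have e3 := sub_left_injective e2
    exact absurd (Nat.cast_injective e3) hlt.ne'

lemma isBigO_of_mem_fiber (hT : B.limPair ≠ 0) {p : ℂ} (hp : p ∈ Z) {j k : Fin N}
    (hj : B.limPoint j = p) (hk : B.limPoint k = p) :
    (fun n => B.point k n - p) =O[B.filter] fun n => B.point j n - p := by
  rw [← B.mem_cluster (c := fun _ => p), B.cluster_eq_fiber hT hp hj]
  exact B.mem_fiber.2 hk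

lemma card_fiber_eq (hT : B.limPair ≠ 0) {p : ℂ} (hp : p ∈ Z) {j : Fin N}
    (hj : B.limPoint j = p) : α p * B.limSelf = ((B.fiber p).card - 1) * B.limPair := by
  rw [B.balance_pole hp hj, B.cluster_eq_fiber hT hp hj]

lemma one_lt_card_fiber {p : ℂ} {j k : Fin N} (hjk : j ≠ k) (hj : B.limPoint j = p)
    (hk : B.limPoint k = p) : 1 < (B.fiber p).card :=
  Finset.one_lt_card.2 ⟨j, B.mem_fiber.2 hj, k, B.mem_fiber.2 hk, hjk⟩

/-- If the pair interaction survives, two colliding points are either comparable with their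
distance to the boundary or with their distance to a pole. -/
lemma collision_alternative (hT : B.limPair ≠ 0) {j k : Fin N} (hjk : j ≠ k)
    (hlim : B.limPoint j = B.limPoint k) :
    (B.limPoint j ∈ frontier Ω ∧
      (fun n => bdist Ω (B.point j n)) =O[B.filter] fun n => B.point k n - B.point j n) ∨
    (B.limPoint j ∈ Z ∧ (fun n => B.point j n - B.limPoint j) =O[B.filter]
      fun n => B.point k n - B.point j n) := by
  have hr := B.tendsto_point_sub_point hlim
  have hflip : ∀ {E : Type} [SeminormedAddCommGroup E] {f : ℕ → E},
      ¬ (fun n => B.point k n - B.point j n) =o[B.filter] f →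
      f =O[B.filter] fun n => B.point k n - B.point j n := fun h => by
    by_contra hcon
    exact h (B.filter.isLittleO_of_not_isBigO hcon)
  by_cases h1 : (fun n => B.point k n - B.point j n) =o[B.filter] fun n => bdist Ω (B.point j n)
  · right
    by_contra hcon
    refine hT (B.limPair_eq_zero_of_collision hjk h1 fun p hp => ?_)
    by_cases hpj : B.limPoint j = p
    · subst hpj
      by_contra h2
      exact hcon ⟨hp, hflip h2⟩
    · exact B.isLittleO_of_tendsto hr ((B.tendsto_point j).sub_const p) (sub_ne_zero.2 hpj)
  · left
    refine ⟨?_, hflip h1⟩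
    by_contra h2
    have h3 : B.limPoint j ∈ Ω := by
      have := B.limPoint_mem_closure j
      rw [closure_eq_self_union_frontier] at this
      exact this.resolve_right h2
    exact h1 (B.isLittleO_of_tendsto hr (B.tendsto_bdist j)
      (bdist_pos B.isOpen B.frontier_nonempty h3).ne')

lemma isBigO_log_sub_of_ne {j k : Fin N} (h : B.limPoint j ≠ B.limPoint k) :
    (fun n => Real.log ‖B.point j n - B.point k n‖) =O[B.filter] fun _ => (1 : ℝ) :=
  isBigO_log_norm ((B.tendsto_point j).sub (B.tendsto_point k)) (sub_ne_zero.2 h)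

lemma isBoundedUnder_log_sub (j k : Fin N) :
    IsBoundedUnder (· ≤ ·) B.filter fun n => Real.log ‖B.point j n - B.point k n‖ := by
  obtain ⟨D, -, hD, -⟩ := B.regPart.exists_le B.isOpen B.isBounded
  exact isBoundedUnder_of_eventually_le (a := D) (Eventually.of_forall fun n =>
    (Real.log_le_self (norm_nonneg _)).trans
      (hD _ (subset_closure (B.mem j n)) _ (subset_closure (B.mem k n))))

/-- The energy `Ψ` along the sequence. -/
noncomputable def energy (n : ℕ) : ℝ := PsiFun H Z α fun j => B.point j n

/-- The weighted logarithmic distance from the point `j` to the poles. -/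
noncomputable def poleLog (j : Fin N) (n : ℕ) : ℝ := ∑ p ∈ Z, α p * Real.log ‖B.point j n - p‖

/-- The total logarithmic distance from the point `j` to the other points. -/
noncomputable def pairLog (j : Fin N) (n : ℕ) : ℝ :=
  ∑ k, if j ≠ k then Real.log ‖B.point j n - B.point k n‖ else 0

lemma isBoundedUnder_log_sub_pole {p : ℂ} (hp : p ∈ Z) (j : Fin N) :
    IsBoundedUnder (· ≤ ·) B.filter fun n => Real.log ‖B.point j n - p‖ := by
  obtain ⟨D, -, hD, -⟩ := B.regPart.exists_le B.isOpen B.isBounded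
  exact isBoundedUnder_of_eventually_le (a := D) (Eventually.of_forall fun n =>
    (Real.log_le_self (norm_nonneg _)).trans
      (hD _ (subset_closure (B.mem j n)) _ (subset_closure (B.subset hp))))

lemma isBoundedUnder_pairLog (j : Fin N) : IsBoundedUnder (· ≤ ·) B.filter (B.pairLog j) := by
  refine isBoundedUnder_le_fun_sum fun k _ => ?_
  by_cases hjk : j = k
  · simpa [hjk] using isBoundedUnder_const
  · simpa [hjk] using B.isBoundedUnder_log_sub j k

lemma isBoundedUnder_const_mul {l : Filter ℕ} {f : ℕ → ℝ} {c : ℝ} (hc : 0 ≤ c)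
    (h : IsBoundedUnder (· ≤ ·) l f) : IsBoundedUnder (· ≤ ·) l fun n => c * f n := by
  obtain ⟨M, hM⟩ := h
  refine isBoundedUnder_of_eventually_le (a := c * M) ?_
  filter_upwards [eventually_map.1 hM] with n hn
  gcongr

lemma isBoundedUnder_poleLog (hα : ∀ p ∈ Z, 0 < α p) (j : Fin N) :
    IsBoundedUnder (· ≤ ·) B.filter (B.poleLog j) :=
  isBoundedUnder_le_fun_sum fun p hp =>
    isBoundedUnder_const_mul (hα p hp).le (B.isBoundedUnder_log_sub_pole hp j)

lemma isBoundedUnder_neg_green {p : ℂ} (hp : p ∈ Z) (j : Fin N) :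
    IsBoundedUnder (· ≤ ·) B.filter fun n => -green H (B.point j n) p := by
  obtain ⟨M, hM⟩ := B.isBoundedUnder_log_sub_pole hp j
  have h1 : Tendsto (fun n => H p (B.point j n)) B.filter (𝓝 (H p (B.limPoint j))) :=
    ((B.regPart.1 p (B.subset hp)).2.1 _ (B.limPoint_mem_closure j)).tendsto.comp
      (tendsto_nhdsWithin_iff.2 ⟨B.tendsto_point j,
        Eventually.of_forall fun n => subset_closure (B.mem j n)⟩)
  refine isBoundedUnder_of_eventually_le
    (a := 1 / (2 * π) * M - (H p (B.limPoint j) - 1)) ?_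
  filter_upwards [eventually_map.1 hM, h1.eventually (eventually_gt_nhds (sub_one_lt _))]
    with n hn hn'
  rw [green_eq, B.regPart.symm (B.mem j n) (B.subset hp)]
  have := mul_le_mul_of_nonneg_left hn one_div_two_pi_pos.le
  linarith

lemma isBoundedUnder_green_of_ne {j k : Fin N} (h : B.limPoint j ≠ B.limPoint k) :
    IsBoundedUnder (· ≤ ·) B.filter fun n => green H (B.point j n) (B.point k n) := by
  obtain ⟨D, -, -, hD⟩ := B.regPart.exists_le B.isOpen B.isBounded
  obtain ⟨C, hC⟩ := (B.isBigO_log_sub_of_ne h).bound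
  refine isBoundedUnder_of_eventually_le (a := D + 1 / (2 * π) * C) ?_
  filter_upwards [hC] with n hn
  rw [norm_one, mul_one, Real.norm_eq_abs] at hn
  have h1 := mul_le_mul_of_nonneg_left (neg_le.1 (abs_le.1 hn).1) one_div_two_pi_pos.le
  have h2 := hD _ (B.mem j n) _ (subset_closure (B.mem k n))
  rw [green_eq]
  linarith

lemma isBoundedUnder_green_of_isBigO {j k : Fin N} (hjk : j ≠ k) (h : B.limPoint j ∈ frontier Ω)
    (hO : (fun n => bdist Ω (B.point j n)) =O[B.filter] fun n => B.point k n - B.point j n) :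
    IsBoundedUnder (· ≤ ·) B.filter fun n => green H (B.point j n) (B.point k n) := by
  obtain ⟨K, hK, hgreen⟩ := B.regPart.exists_green_le B.isOpen B.isBounded B.frame
  obtain ⟨C, hC⟩ := hO.bound
  have h0 : bdist Ω (B.limPoint j) = 0 := infDist_zero_of_mem h
  have hlt := (B.tendsto_bdist j).eventually (eventually_lt_nhds (h0.trans_lt B.frame.δ_pos))
  refine isBoundedUnder_of_eventually_le (a := K * C) ?_
  filter_upwards [hC, hlt] with n hn hd
  refine (hgreen _ (B.mem j n) hd _ (B.mem k n) (B.ne n j k hjk)).1.trans ?_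
  gcongr
  rw [div_le_iff₀ (norm_pos_iff.2 (B.point_sub_ne hjk n)), norm_sub_rev (B.point j n)]
  rwa [Real.norm_of_nonneg (bdist_nonneg _ _)] at hn

lemma exists_eventually_depth_le [NeZero N] :
    ∃ j₀, ∀ᶠ n in B.filter, ∀ k, B.depth j₀ n ≤ B.depth k n :=
  B.filter.exists_eventually_of_eventually_exists
    (Eventually.of_forall fun n => Finite.exists_min fun k => B.depth k n)

lemma tendsto_regPart_self_atBot {j : Fin N} (h0 : Tendsto (B.depth j) B.filter (𝓝 0)) :
    Tendsto (fun n => H (B.point j n) (B.point j n)) B.filter atBot := by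
  have hlog : Tendsto (fun n => Real.log (B.depth j n)) B.filter atBot :=
    Real.tendsto_log_nhdsNE_zero.comp (tendsto_nhdsWithin_iff.2
      ⟨h0, Eventually.of_forall fun n => (B.depth_pos j n).ne'⟩)
  have h1 := tendsto_atBot_add_const_right _
    (4 * B.frame.C * B.frame.δ + 1 / (2 * π) * Real.log 2)
    (hlog.const_mul_atBot one_div_two_pi_pos)
  refine tendsto_atBot_mono' _ ?_ h1
  filter_upwards [h0.eventually (eventually_lt_nhds B.frame.δ_pos)] with n hn
  have h2 := (abs_le.1 (B.regPart.abs_sub_log_refl_le B.isOpen B.isBounded B.frame (B.mem j n) hn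
    (subset_closure (B.mem j n)))).2
  rw [norm_sub_rev, B.frame.norm_sub_refl (B.mem j n) hn,
    Real.log_mul two_ne_zero (B.bdist_point_pos j n).ne'] at h2
  have h3 : 4 * B.frame.C * bdist Ω (B.point j n) ≤ 4 * B.frame.C * B.frame.δ := by
    have := B.frame.C_pos
    have : bdist Ω (B.point j n) ≤ B.frame.δ := hn.le
    gcongr
  simp only [depth]
  linarith

lemma isBoundedUnder_regPart_self (j : Fin N) :
    IsBoundedUnder (· ≤ ·) B.filter fun n => H (B.point j n) (B.point j n) := by
  obtain ⟨D, -, -, hD⟩ := B.regPart.exists_le B.isOpen B.isBounded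
  exact isBoundedUnder_of_eventually_le (a := D) (Eventually.of_forall fun n =>
    hD _ (B.mem j n) _ (subset_closure (B.mem j n)))

/-- If some point approaches the boundary, the energy tends to `-∞`. -/
lemma tendsto_energy_atBot (hα : ∀ p ∈ Z, 0 < α p) (hlim : B.limSelf = 0 → B.limPair ≠ 0)
    {i : Fin N} (hi : B.limPoint i ∈ frontier Ω) : Tendsto B.energy B.filter atBot := by
  have : NeZero N := ⟨fun h => (h ▸ i).elim0⟩
  obtain ⟨j₀, hmin⟩ := B.exists_eventually_depth_le
  have hdi : Tendsto (B.depth i) B.filter (𝓝 0) := by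
    have := B.tendsto_bdist i
    rwa [show bdist Ω (B.limPoint i) = 0 from infDist_zero_of_mem hi] at this
  have h0 : Tendsto (B.depth j₀) B.filter (𝓝 0) :=
    tendsto_of_tendsto_of_tendsto_of_le_of_le' tendsto_const_nhds hdi
      (Eventually.of_forall fun n => (B.depth_pos j₀ n).le) (hmin.mono fun n hn => hn i)
  have hS := B.limSelf_eq_zero_of_boundary h0 hmin
  have hT := hlim hS
  have hgreen : ∀ j k, j ≠ k →
      IsBoundedUnder (· ≤ ·) B.filter fun n => green H (B.point j n) (B.point k n) := by
    intro j k hjk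
    by_cases hl : B.limPoint j = B.limPoint k
    · rcases B.collision_alternative hT hjk hl with ⟨h1, h2⟩ | ⟨h1, -⟩
      · exact B.isBoundedUnder_green_of_isBigO hjk h1 h2
      · have h2 := B.card_fiber_eq hT h1 rfl
        have h3 : (1 : ℝ) < (B.fiber (B.limPoint j)).card := by
          exact_mod_cast B.one_lt_card_fiber hjk rfl hl.symm
        rw [hS, mul_zero, eq_comm, mul_eq_zero] at h2
        exact absurd (h2.resolve_right hT) (by linarith)
    · exact B.isBoundedUnder_green_of_ne hl
  have e1 : Tendsto (fun n => ∑ j, H (B.point j n) (B.point j n)) B.filter atBot :=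
    tendsto_finsetSum_atBot (Finset.mem_univ j₀) (B.tendsto_regPart_self_atBot h0)
      fun k _ => B.isBoundedUnder_regPart_self k
  have e2 : IsBoundedUnder (· ≤ ·) B.filter fun n =>
      ∑ p ∈ Z, (α p / 2) * ∑ j, -green H (B.point j n) p :=
    isBoundedUnder_le_fun_sum fun p hp => isBoundedUnder_const_mul (half_pos (hα p hp)).le
      (isBoundedUnder_le_fun_sum fun j _ => B.isBoundedUnder_neg_green hp j)
  have e3 : IsBoundedUnder (· ≤ ·) B.filter fun n =>
      ∑ j, ∑ k, if j ≠ k then green H (B.point j n) (B.point k n) else 0 := by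
    refine isBoundedUnder_le_fun_sum fun j _ => isBoundedUnder_le_fun_sum fun k _ => ?_
    by_cases hjk : j = k
    · simpa [hjk] using isBoundedUnder_const
    · simpa [hjk] using hgreen j k hjk
  obtain ⟨M, hM⟩ := e2
  obtain ⟨M', hM'⟩ := e3
  refine tendsto_atBot_mono' _ ?_ (tendsto_atBot_add_const_right _ (M + 1 / 2 * M')
    (e1.const_mul_atBot one_half_pos))
  filter_upwards [eventually_map.1 hM, eventually_map.1 hM'] with n h1 h2
  simp only [Finset.sum_neg_distrib, mul_neg] at h1
  simp only [energy, PsiFun]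
  linarith

/-- For interior limits, the energy is governed by the logarithmic terms. -/
lemma energy_sub_isBigO (hHC1 : ContDiffOn ℝ 1 (fun q : ℂ × ℂ => H q.1 q.2) (Ω ×ˢ Ω))
    (hint : ∀ j, B.limPoint j ∈ Ω) :
    (fun n => B.energy n - 1 / (4 * π) * (∑ j, B.poleLog j n - ∑ j, B.pairLog j n))
      =O[B.filter] fun _ => (1 : ℝ) := by
  have hlim : ∀ {f g : ℕ → ℂ} {a b : ℂ}, Tendsto f B.filter (𝓝 a) → Tendsto g B.filter (𝓝 b) →
      a ∈ Ω → b ∈ Ω → Tendsto (fun n => H (f n) (g n)) B.filter (𝓝 (H a b)) :=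
    fun {f g a b} hf hg ha hb =>
    ((hHC1.continuousOn.continuousAt ((B.isOpen.prod B.isOpen).mem_nhds
      (show (a, b) ∈ Ω ×ˢ Ω from ⟨ha, hb⟩))).tendsto).comp (hf.prodMk_nhds hg)
  have h1 := tendsto_finsetSum Finset.univ fun j _ =>
    hlim (B.tendsto_point j) (B.tendsto_point j) (hint j) (hint j)
  have h2 := tendsto_finsetSum Z fun p hp => (tendsto_finsetSum Finset.univ fun j _ =>
    hlim (B.tendsto_point j) (tendsto_const_nhds (x := p)) (hint j) (B.subset hp)).const_mul
      (α p / 2)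
  have h3 := tendsto_finsetSum (Finset.univ : Finset (Fin N × Fin N)) fun q _ =>
    (hlim (B.tendsto_point q.1) (B.tendsto_point q.2) (hint q.1) (hint q.2)).const_mul
      (if q.1 ≠ q.2 then (1 : ℝ) else 0)
  refine (((h1.const_mul (1 / 2)).sub h2).add (h3.const_mul (1 / 2))).isBigO_one ℝ |>.congr_left
    fun n => ?_
  have e1 : ∑ p ∈ Z, α p / 2 * ∑ j, green H (B.point j n) p =
      ∑ p ∈ Z, α p / 2 * ∑ j, H (B.point j n) p - 1 / (4 * π) * ∑ j, B.poleLog j n := by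
    simp only [poleLog]
    rw [Finset.sum_comm, Finset.mul_sum, ← Finset.sum_sub_distrib]
    refine Finset.sum_congr rfl fun p _ => ?_
    simp only [green_eq, Finset.sum_sub_distrib, ← Finset.mul_sum]
    field_simp
    ring
  have e2 : ∑ j, ∑ k, (if j ≠ k then green H (B.point j n) (B.point k n) else 0) =
      ∑ q : Fin N × Fin N, (if q.1 ≠ q.2 then (1 : ℝ) else 0) *
        H (B.point q.1 n) (B.point q.2 n) - 1 / (2 * π) * ∑ j, B.pairLog j n := by
    simp only [pairLog]
    rw [Fintype.sum_prod_type, Finset.mul_sum, ← Finset.sum_sub_distrib]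
    refine Finset.sum_congr rfl fun j _ => ?_
    rw [Finset.mul_sum, ← Finset.sum_sub_distrib]
    refine Finset.sum_congr rfl fun k _ => ?_
    by_cases hjk : j = k
    · simp [hjk]
    · simp [hjk, green_eq]
  simp only [energy, PsiFun, e1, e2]
  field_simp
  ring

lemma poleLog_isBigO {j : Fin N} (hj : B.limPoint j ∉ Z) :
    B.poleLog j =O[B.filter] fun _ => (1 : ℝ) := by
  refine IsBigO.fun_sum fun p hp => IsBigO.const_mul_left ?_ _
  exact isBigO_log_norm ((B.tendsto_point j).sub_const p)
    (sub_ne_zero.2 fun e => hj (e ▸ hp))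

lemma tendsto_sum_pairLog_atBot {j k : Fin N} (hjk : j ≠ k)
    (hlim : B.limPoint j = B.limPoint k) :
    Tendsto (fun n => ∑ i, B.pairLog i n) B.filter atBot := by
  refine tendsto_finsetSum_atBot (Finset.mem_univ k) ?_ fun i _ => B.isBoundedUnder_pairLog i
  refine tendsto_finsetSum_atBot (Finset.mem_univ j) ?_ fun i _ => ?_
  · simpa [hjk.symm] using tendsto_log_norm_atBot (B.tendsto_point_sub_point hlim)
      (B.point_sub_ne hjk.symm)
  · by_cases hki : k = i
    · simpa [hki] using isBoundedUnder_const
    · simpa [hki] using B.isBoundedUnder_log_sub k i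

lemma tendsto_sum_poleLog_atBot (hα : ∀ p ∈ Z, 0 < α p) {j : Fin N} (hj : B.limPoint j ∈ Z) :
    Tendsto (fun n => ∑ i, B.poleLog i n) B.filter atBot := by
  refine tendsto_finsetSum_atBot (Finset.mem_univ j) ?_ fun i _ => B.isBoundedUnder_poleLog hα i
  refine tendsto_finsetSum_atBot hj ?_ fun p hp =>
    isBoundedUnder_const_mul (hα p hp).le (B.isBoundedUnder_log_sub_pole hp j)
  exact (tendsto_log_norm_atBot (B.tendsto_point_sub_pole rfl)
    (B.point_sub_pole_ne hj j)).const_mul_atBot (hα _ hj)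

/-- If the pair interaction survives and the limits are interior, the pair logarithms are
proportional to the pole logarithms. -/
lemma pairLog_sub_poleLog_isBigO (hT : B.limPair ≠ 0) (hint : ∀ j, B.limPoint j ∈ Ω)
    (j : Fin N) :
    (fun n => B.pairLog j n - B.limSelf / B.limPair * B.poleLog j n)
      =O[B.filter] fun _ => (1 : ℝ) := by
  have hpole : ∀ k, j ≠ k → B.limPoint j = B.limPoint k → B.limPoint j ∈ Z ∧
      (fun n => B.point j n - B.limPoint j) =O[B.filter] fun n => B.point k n - B.point j n := by
    intro k hjk hl
    refine (B.collision_alternative hT hjk hl).resolve_left fun h => ?_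
    have := h.1
    rw [B.isOpen.frontier_eq] at this
    exact this.2 (hint j)
  by_cases hj : B.limPoint j ∈ Z
  · set L : ℕ → ℝ := fun n => Real.log ‖B.point j n - B.limPoint j‖ with hL
    have h1 : (fun n => B.poleLog j n - α (B.limPoint j) * L n) =O[B.filter]
        fun _ => (1 : ℝ) := by
      have : (fun n => ∑ p ∈ Z.erase (B.limPoint j), α p * Real.log ‖B.point j n - p‖)
          =O[B.filter] fun _ => (1 : ℝ) :=
        IsBigO.fun_sum fun p hp => IsBigO.const_mul_left (isBigO_log_norm
          ((B.tendsto_point j).sub_const p) (sub_ne_zero.2 (Finset.ne_of_mem_erase hp).symm)) _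
      refine this.congr_left fun n => ?_
      rw [eq_sub_iff_add_eq', poleLog]
      exact Finset.add_sum_erase Z (fun p => α p * Real.log ‖B.point j n - p‖) hj
    have h2 : (fun n => B.pairLog j n - ((B.fiber (B.limPoint j)).card - 1) * L n)
        =O[B.filter] fun _ => (1 : ℝ) := by
      have : (fun n => ∑ k, ((if j ≠ k then Real.log ‖B.point j n - B.point k n‖ else 0) -
          if k ∈ (B.fiber (B.limPoint j)).erase j then L n else 0)) =O[B.filter]
          fun _ => (1 : ℝ) := by
        refine IsBigO.fun_sum fun k _ => ?_
        by_cases hjk : j = k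
        · subst hjk
          simpa using isBoundedUnder_const
        by_cases hl : B.limPoint j = B.limPoint k
        · have hk : k ∈ (B.fiber (B.limPoint j)).erase j :=
            Finset.mem_erase.2 ⟨Ne.symm hjk, B.mem_fiber.2 hl.symm⟩
          simp only [ne_eq, hjk, not_false_eq_true, if_true, hk, hL]
          have hO := (hpole k hjk hl).2
          refine isBigO_log_norm_sub_log_norm (B.point_sub_ne hjk) (B.point_sub_pole_ne hj j) ?_ ?_
          · simpa using (isBigO_refl _ _).sub (B.isBigO_of_mem_fiber hT hj rfl hl.symm)
          · exact hO.trans (isBigO_of_le _ fun n => (norm_sub_rev _ _).le)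
        · have hk : k ∉ (B.fiber (B.limPoint j)).erase j := fun h =>
            hl (B.mem_fiber.1 (Finset.mem_of_mem_erase h)).symm
          simpa [hjk, hk] using B.isBigO_log_sub_of_ne hl
      refine this.congr_left fun n => ?_
      have hmem : j ∈ B.fiber (B.limPoint j) := B.mem_fiber.2 rfl
      rw [Finset.sum_sub_distrib, Finset.sum_ite_mem, Finset.univ_inter, Finset.sum_const,
        nsmul_eq_mul, Finset.cast_card_erase_of_mem hmem, pairLog]
    refine (h2.sub (h1.const_mul_left (B.limSelf / B.limPair))).congr_left fun n => ?_
    have h3 := B.card_fiber_eq hT hj rfl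
    have h4 : ((B.fiber (B.limPoint j)).card - 1 : ℝ) =
        B.limSelf / B.limPair * α (B.limPoint j) := by
      field_simp
      linarith
    rw [h4]
    ring
  · refine IsBigO.sub (IsBigO.fun_sum fun k _ => ?_) ((B.poleLog_isBigO hj).const_mul_left _)
    by_cases hjk : j = k
    · subst hjk
      simpa using isBoundedUnder_const
    · simpa [hjk] using B.isBigO_log_sub_of_ne fun hl => hj (hpole k hjk hl).1

/-- A collision with all limits interior and noninteger pole weights forces unbounded energy. -/
lemma energy_not_isBigO_of_interior
    (hHC1 : ContDiffOn ℝ 1 (fun q : ℂ × ℂ => H q.1 q.2) (Ω ×ˢ Ω)) (hα : ∀ p ∈ Z, 0 < α p)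
    (hα' : ∀ p ∈ Z, ∀ n : ℕ, 1 ≤ n → n ≤ N - 1 → α p ≠ n)
    (hlim : B.limPair = 0 → B.limSelf ≠ 0) (hint : ∀ j, B.limPoint j ∈ Ω) {j k : Fin N}
    (hjk : j ≠ k) (hcol : B.limPoint j = B.limPoint k) :
    ¬ B.energy =O[B.filter] fun _ => (1 : ℝ) := by
  intro hE
  have h1 : (fun n => ∑ j, B.poleLog j n - ∑ j, B.pairLog j n) =O[B.filter]
      fun _ => (1 : ℝ) := by
    refine ((hE.sub (B.energy_sub_isBigO hHC1 hint)).const_mul_left (4 * π)).congr_left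
      fun n => ?_
    field_simp
    ring
  by_cases hT : B.limPair = 0
  · have hZ : ∀ i, B.limPoint i ∉ Z := fun i hi => by
      have := B.balance_pole hi rfl
      rw [hT, mul_zero, mul_eq_zero] at this
      exact this.elim (hα _ hi).ne' (hlim hT)
    refine (B.tendsto_sum_pairLog_atBot hjk hcol).not_isBigO_one ?_
    have h2 : (fun n => ∑ i, B.poleLog i n) =O[B.filter] fun _ => (1 : ℝ) :=
      IsBigO.fun_sum fun i _ => B.poleLog_isBigO (hZ i)
    simpa using h2.sub h1
  · have hpole : B.limPoint j ∈ Z := by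
      refine ((B.collision_alternative hT hjk hcol).resolve_left fun h => ?_).1
      have := h.1
      rw [B.isOpen.frontier_eq] at this
      exact this.2 (hint j)
    have hne : 1 - B.limSelf / B.limPair ≠ 0 := by
      intro h
      have h2 : B.limSelf = B.limPair := by
        rw [sub_eq_zero, eq_div_iff hT, one_mul] at h
        exact h.symm
      have h3 := B.card_fiber_eq hT hpole rfl
      rw [h2] at h3
      have h4 := B.one_lt_card_fiber hjk rfl hcol.symm
      have h5 := Finset.card_le_univ (B.fiber (B.limPoint j))
      rw [Fintype.card_fin] at h5
      refine hα' _ hpole ((B.fiber (B.limPoint j)).card - 1) (by omega) (by omega) ?_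
      rw [mul_right_cancel₀ hT h3, Nat.cast_sub h4.le, Nat.cast_one]
    refine (B.tendsto_sum_poleLog_atBot hα hpole).not_isBigO_one ?_
    have h2 : (fun n => ∑ i, (B.pairLog i n - B.limSelf / B.limPair * B.poleLog i n))
        =O[B.filter] fun _ => (1 : ℝ) :=
      IsBigO.fun_sum fun i _ => B.pairLog_sub_poleLog_isBigO hT hint i
    refine ((h1.add h2).const_mul_left (1 - B.limSelf / B.limPair)⁻¹).congr_left fun n => ?_
    rw [inv_mul_eq_iff_eq_mul₀ hne, Finset.sum_sub_distrib, ← Finset.mul_sum]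
    ring

end BalancedSequence

/-- Along an ultrafilter finer than `atTop`, a sequence of solutions with bounded weights is a
balanced sequence. -/
lemma exists_balancedSequence {Ω : Set ℂ} (hΩo : IsOpen Ω) (hΩ : Ω.Nonempty)
    (hΩb : Bornology.IsBounded Ω) (b : C2Boundary Ω) {H : ℂ → ℂ → ℝ} (hH : RegPart Ω H)
    (hHC1 : ContDiffOn ℝ 1 (fun q : ℂ × ℂ => H q.1 q.2) (Ω ×ˢ Ω)) {Z : Finset ℂ}
    (hZ : (Z : Set ℂ) ⊆ Ω) (α : ℂ → ℝ) {N : ℕ} {ξs : ℕ → Fin N → ℂ} {β₁ β₂ : ℕ → ℝ}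
    (hξ : ∀ n, memM Ω Z (ξs n)) (hβ : ∀ n, (β₁ n) ^ 2 + (β₂ n) ^ 2 = 1)
    (heq : ∀ n, β₁ n • fderiv ℝ (fun ξ : Fin N → ℂ => PsiFun H Z α ξ) (ξs n) +
      β₂ n • fderiv ℝ (fun ξ : Fin N → ℂ => PhiFun H Z α ξ) (ξs n) = 0) (ℓ : Ultrafilter ℕ) :
    ∃ B : BalancedSequence Ω H Z α N, B.filter = ℓ ∧ (∀ j n, B.point j n = ξs n j) ∧
      B.limSelf ^ 2 + B.limPair ^ 2 = 2 := by
  obtain ⟨R, hR⟩ := hΩb.exists_norm_le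
  have hpt : ∀ j, ∃ a, Tendsto (fun n => ξs n j) ℓ (𝓝 a) := fun j =>
    ℓ.exists_tendsto_of_norm_le (Eventually.of_forall fun n => hR _ ((hξ n).1 j).1)
  choose x hx using hpt
  obtain ⟨s, hs⟩ := ℓ.exists_tendsto_of_norm_le (f := fun n => β₁ n + β₂ n) (C := 2)
    (Eventually.of_forall fun n => abs_le_of_sq_le_sq (by
      nlinarith [hβ n, sq_nonneg (β₁ n - β₂ n)]) zero_le_two)
  obtain ⟨t, ht⟩ := ℓ.exists_tendsto_of_norm_le (f := fun n => β₁ n - β₂ n) (C := 2)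
    (Eventually.of_forall fun n => abs_le_of_sq_le_sq (by
      nlinarith [hβ n, sq_nonneg (β₁ n + β₂ n)]) zero_le_two)
  let B : BalancedSequence Ω H Z α N :=
    { isOpen := hΩo
      isBounded := hΩb
      nonempty := hΩ
      frame := b.frame hΩo
      regPart := hH
      subset := hZ
      filter := ℓ
      point := fun j n => ξs n j
      weightSelf := fun n => β₁ n + β₂ n
      weightPair := fun n => β₁ n - β₂ n
      limPoint := x
      limSelf := s
      limPair := t
      mem := fun j n => ((hξ n).1 j).1
      notMem := fun j n => ((hξ n).1 j).2
      ne := fun n j k hjk h => hjk ((hξ n).2 h)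
      equation := fun n j v => hH.gradient_eq hΩo hHC1 hZ α (hξ n) (heq n) j v
      tendsto_point := hx
      tendsto_self := hs
      tendsto_pair := ht }
  refine ⟨B, rfl, fun _ _ => rfl, ?_⟩
  refine tendsto_nhds_unique ((hs.pow 2).add (ht.pow 2)) (tendsto_const_nhds.congr fun n => ?_)
  linarith [hβ n, add_sq (β₁ n) (β₂ n), sub_sq (β₁ n) (β₂ n)]

lemma Ultrafilter.exists_limit_eq_of_norm_sub_lt {N : ℕ} {ξs : ℕ → Fin N → ℂ} {x : Fin N → ℂ}
    (ℓ : Ultrafilter ℕ) (hx : ∀ j, Tendsto (fun n => ξs n j) ℓ (𝓝 (x j)))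
    (h : ∀ ε > (0 : ℝ), ∀ᶠ n in ℓ, ∃ j k : Fin N, j ≠ k ∧ ‖ξs n j - ξs n k‖ < ε) :
    ∃ j k : Fin N, j ≠ k ∧ x j = x k := by
  by_contra! hcon
  have h1 : ∃ ε > (0 : ℝ), ∀ j k, j ≠ k → ε < ‖x j - x k‖ := by
    have : ∀ᶠ ε in 𝓝[>] (0 : ℝ), ∀ j k, j ≠ k → ε < ‖x j - x k‖ := by
      refine eventually_all.2 fun j => eventually_all.2 fun k => ?_
      by_cases hjk : j = k
      · simp [hjk]
      · exact nhdsWithin_le_nhds ((eventually_lt_nhds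
          (norm_pos_iff.2 (sub_ne_zero.2 (hcon j k hjk)))).mono fun _ h _ => h)
    obtain ⟨ε, h1, h2⟩ := (this.and self_mem_nhdsWithin).exists
    exact ⟨ε, h2, h1⟩
  obtain ⟨ε, hε, hsep⟩ := h1
  have h2 : ∀ᶠ n in ℓ, ∀ j k, j ≠ k → ε < ‖ξs n j - ξs n k‖ := by
    refine eventually_all.2 fun j => eventually_all.2 fun k => ?_
    by_cases hjk : j = k
    · simp [hjk]
    · exact (((hx j).sub (hx k)).norm.eventually (eventually_gt_nhds (hsep j k hjk))).mono
        fun _ h _ => h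
  obtain ⟨n, ⟨j, k, hjk, h3⟩, h4⟩ := ((h ε hε).and h2).exists
  exact lt_asymm h3 (h4 j k hjk)

/-- compactness: if N ≥ 2 and α_p avoids the integers 1,…,N−1 for every
p ∈ Z, there is no sequence ξ_n in ℳ with min_{j≠k}|ξ_jⁿ−ξ_kⁿ| → 0, Ψ(ξ_n) bounded,
and β₁ⁿ∇Ψ(ξ_n) + β₂ⁿ∇Φ(ξ_n) = 0 with (β₁ⁿ)² + (β₂ⁿ)² = 1. -/
theorem no_collision_with_bounded_energy_and_dependent_gradients (Ω : Set ℂ)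
    (hΩo : IsOpen Ω) (hΩc : IsConnected Ω) (hΩb : Bornology.IsBounded Ω)
    (b : C2Boundary Ω) (H : ℂ → ℂ → ℝ) (hH : RegPart Ω H)
    (hHC1 : ContDiffOn ℝ 1 (fun q : ℂ × ℂ => H q.1 q.2) (Ω ×ˢ Ω))
    (Z : Finset ℂ) (hZ : (Z : Set ℂ) ⊆ Ω) (α : ℂ → ℝ) (hα : ∀ p ∈ Z, 0 < α p)
    (N : ℕ) (hN : 2 ≤ N)
    (hα' : ∀ p ∈ Z, ∀ n : ℕ, 1 ≤ n → n ≤ N - 1 → α p ≠ n) :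
    ¬∃ (ξs : ℕ → Fin N → ℂ) (β₁ β₂ : ℕ → ℝ),
        (∀ n, memM Ω Z (ξs n)) ∧
        (∀ n, (β₁ n) ^ 2 + (β₂ n) ^ 2 = 1) ∧
        (∀ ε > (0 : ℝ), ∃ n₀ : ℕ, ∀ n ≥ n₀, ∃ j k : Fin N, j ≠ k ∧ ‖ξs n j - ξs n k‖ < ε) ∧
        (∃ C : ℝ, ∀ n, |PsiFun H Z α (ξs n)| ≤ C) ∧
        (∀ n, β₁ n • fderiv ℝ (fun ξ : Fin N → ℂ => PsiFun H Z α ξ) (ξs n) +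
            β₂ n • fderiv ℝ (fun ξ : Fin N → ℂ => PhiFun H Z α ξ) (ξs n) = 0) := by
  rintro ⟨ξs, β₁, β₂, hξ, hβ, hcol, ⟨C, hC⟩, heq⟩
  obtain ⟨B, hℓ, hpoint, hnorm⟩ := exists_balancedSequence hΩo hΩc.nonempty hΩb b hH hHC1 hZ α
    hξ hβ heq (hyperfilter ℕ)
  have henergy : B.energy =O[B.filter] fun _ => (1 : ℝ) := by
    refine IsBigO.of_bound C (Eventually.of_forall fun n => ?_)
    rw [norm_one, mul_one, Real.norm_eq_abs, BalancedSequence.energy]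
    simpa only [hpoint] using hC n
  obtain ⟨j, k, hjk, hlim⟩ : ∃ j k : Fin N, j ≠ k ∧ B.limPoint j = B.limPoint k := by
    refine (hyperfilter ℕ).exists_limit_eq_of_norm_sub_lt (ξs := ξs) (fun j => ?_) fun ε hε => ?_
    · rw [← hℓ]
      exact (B.tendsto_point j).congr (hpoint j)
    · exact Nat.hyperfilter_le_atTop (eventually_atTop.2 (hcol ε hε))
  by_cases hint : ∀ j, B.limPoint j ∈ Ω
  · refine B.energy_not_isBigO_of_interior hHC1 hα hα' (fun h1 h2 => ?_) hint hjk hlim henergy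
    simp [h1, h2] at hnorm
  · push Not at hint
    obtain ⟨i, hi⟩ := hint
    have hfr : B.limPoint i ∈ frontier Ω := by
      rw [hΩo.frontier_eq]
      exact ⟨B.limPoint_mem_closure i, hi⟩
    refine (B.tendsto_energy_atBot hα (fun h1 h2 => ?_) hfr).not_isBigO_one henergy
    simp [h1, h2] at hnorm
end

section
/- Fix δ > 0, 0 < μ₁ ≤ μ₂ and 0 < A₁ ≤ A₂. There exist ε₀ > 0 and C > 0 such that for all ε ∈ (0,ε₀), all ξ ∈ Ω with dist(ξ,∂Ω) ≥ δ, all μ ∈ [μ₁,μ₂] and all A ∈ [A₁,A₂], the function P U_{ε,μ,ξ} satisfies sup_{x∈Ω} | P U_{ε,μ,ξ}(x) − U_{ε,μ,ξ}(x) − 8π H(x,ξ) + log(8μ²/A) | ≤ C ε². -/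
open Real Set Metric Filter MeasureTheory

/-- The bubble U_{ε,μ,ξ}(x) = log( 8μ² / ((μ²ε² + |x−ξ|²)²·A) ). -/
noncomputable def bubbleU (ε μ A : ℝ) (ξ x : ℂ) : ℝ :=
  Real.log (8 * μ ^ 2 / ((μ ^ 2 * ε ^ 2 + ‖x - ξ‖ ^ 2) ^ 2 * A))

/-- `IsProj Ω PU ε μ A ξ`: PU is the projection of U_{ε,μ,ξ} onto zero boundary values:
PU is continuous on the closure of Ω, PU − U is harmonic in Ω, and PU = 0 on ∂Ω. -/
def IsProj (Ω : Set ℂ) (PU : ℂ → ℝ) (ε μ A : ℝ) (ξ : ℂ) : Prop :=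
  ContinuousOn PU (closure Ω) ∧
  HarmonicOnSet (fun x => PU x - bubbleU ε μ A ξ x) Ω ∧
  ∀ x ∈ frontier Ω, PU x = 0

section PlaneLaplacian

variable {f g : ℂ → ℝ} {x : ℂ}

theorem ContDiffAt.differentiableAt_fderiv_apply (hf : ContDiffAt ℝ 2 f x) (e : ℂ) :
    DifferentiableAt ℝ (fun y => fderiv ℝ f y e) x := by
  have h : DifferentiableAt ℝ (fderiv ℝ f) x :=
    (hf.fderiv_right (m := 1) (by norm_num)).differentiableAt (by norm_num)
  exact h.clm_apply (differentiableAt_const e)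

theorem ContDiffAt.eventually_differentiableAt (hf : ContDiffAt ℝ 2 f x) :
    ∀ᶠ y in nhds x, DifferentiableAt ℝ f y := by
  filter_upwards [hf.eventually (by simp)] with y hy
  exact hy.differentiableAt (by norm_num)

theorem fderiv_fderiv_add (hf : ContDiffAt ℝ 2 f x) (hg : ContDiffAt ℝ 2 g x) (e : ℂ) :
    fderiv ℝ (fun y => fderiv ℝ (fun z => f z + g z) y e) x e =
      fderiv ℝ (fun y => fderiv ℝ f y e) x e + fderiv ℝ (fun y => fderiv ℝ g y e) x e := by
  have h : (fun y => fderiv ℝ (fun z => f z + g z) y e) =ᶠ[nhds x]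
      fun y => fderiv ℝ f y e + fderiv ℝ g y e := by
    filter_upwards [hf.eventually_differentiableAt, hg.eventually_differentiableAt] with y h₁ h₂
    rw [fderiv_fun_add h₁ h₂, add_apply]
  rw [h.fderiv_eq, fderiv_fun_add (hf.differentiableAt_fderiv_apply e)
    (hg.differentiableAt_fderiv_apply e), add_apply]

theorem planeLap_add (hf : ContDiffAt ℝ 2 f x) (hg : ContDiffAt ℝ 2 g x) :
    planeLap (fun y => f y + g y) x = planeLap f x + planeLap g x := by
  simp only [planeLap, fderiv_fderiv_add hf hg]
  ring

theorem planeLap_const_mul (hf : ContDiffAt ℝ 2 f x) (c : ℝ) :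
    planeLap (fun y => c * f y) x = c * planeLap f x := by
  have h (e : ℂ) : fderiv ℝ (fun y => fderiv ℝ (fun z => c * f z) y e) x e =
      c * fderiv ℝ (fun y => fderiv ℝ f y e) x e := by
    have h' : (fun y => fderiv ℝ (fun z => c * f z) y e) =ᶠ[nhds x]
        fun y => c * fderiv ℝ f y e := by
      filter_upwards [hf.eventually_differentiableAt] with y h₁
      rw [fderiv_const_mul h₁, smul_apply, smul_eq_mul]
    rw [h'.fderiv_eq, fderiv_const_mul (hf.differentiableAt_fderiv_apply e),
      smul_apply, smul_eq_mul]
  simp only [planeLap, h]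
  ring

theorem planeLap_const (c : ℝ) : planeLap (fun _ => c) x = 0 := by
  simp [planeLap]

theorem planeLap_norm_sq : planeLap (fun y : ℂ => ‖y‖ ^ 2) x = 4 := by
  have h (e y : ℂ) : fderiv ℝ (fun z : ℂ => ‖z‖ ^ 2) y e = 2 * inner ℝ y e := by
    rw [(hasStrictFDerivAt_norm_sq y).hasFDerivAt.fderiv]
    simp [mul_add]
  have h' (e : ℂ) : fderiv ℝ (fun y : ℂ => 2 * inner ℝ y e) x e = 2 * ‖e‖ ^ 2 := by
    have hd : DifferentiableAt ℝ (fun y : ℂ => inner ℝ y e) x :=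
      differentiableAt_id.inner ℝ (differentiableAt_const e)
    rw [fderiv_const_mul hd, smul_apply, fderiv_inner_apply ℝ differentiableAt_fun_id
      (differentiableAt_const e), ← real_inner_self_eq_norm_sq]
    simp
  simp only [planeLap, h, h']
  norm_num

theorem IsLocalMax.fderiv_fderiv_nonpos (h : IsLocalMax f x) (hf : ContDiffAt ℝ 2 f x) (e : ℂ) :
    fderiv ℝ (fun y => fderiv ℝ f y e) x e ≤ 0 := by
  by_contra! hpos
  have hl (t : ℝ) : HasDerivAt (fun t : ℝ => x + t • e) e t := by
    simpa using ((hasDerivAt_id t).smul_const e).const_add x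
  have ht : Tendsto (fun t : ℝ => x + t • e) (nhds 0) (nhds x) := by
    simpa using (hl 0).continuousAt.tendsto
  have hd : deriv (fun t : ℝ => f (x + t • e)) =ᶠ[nhds 0] fun t => fderiv ℝ f (x + t • e) e := by
    filter_upwards [ht.eventually hf.eventually_differentiableAt] with t h₁
    exact (h₁.hasFDerivAt.comp_hasDerivAt t (hl t)).deriv
  have hdd : deriv (deriv fun t : ℝ => f (x + t • e)) 0 =
      fderiv ℝ (fun y => fderiv ℝ f y e) x e := by
    rw [hd.deriv_eq]
    have h₁ := (hf.differentiableAt_fderiv_apply e).hasFDerivAt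
    have h₂ : HasFDerivAt (fun y => fderiv ℝ f y e) (fderiv ℝ (fun y => fderiv ℝ f y e) x)
        (x + (0 : ℝ) • e) := by simpa using h₁
    exact (h₂.comp_hasDerivAt (0 : ℝ) (hl 0)).deriv
  have hmax : IsLocalMax (fun t : ℝ => f (x + t • e)) 0 := by
    filter_upwards [ht.eventually h] with t h₁
    simpa using h₁
  have hcont : ContinuousAt (fun t : ℝ => f (x + t • e)) 0 :=
    ContinuousAt.comp (g := f) (by simpa using hf.continuousAt) (hl 0).continuousAt
  have hmin := isLocalMin_of_deriv_deriv_pos (hdd ▸ hpos) hmax.deriv_eq_zero hcont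
  have hconst : (fun t : ℝ => f (x + t • e)) =ᶠ[nhds 0] fun _ => f (x + (0 : ℝ) • e) := by
    filter_upwards [hmax, hmin] with t h₁ h₂
    exact le_antisymm h₁ h₂
  have hzero := hconst.deriv.deriv_eq
  rw [hdd] at hzero
  simp at hzero
  exact hpos.ne' hzero

theorem IsLocalMax.planeLap_nonpos (h : IsLocalMax f x) (hf : ContDiffAt ℝ 2 f x) :
    planeLap f x ≤ 0 :=
  add_nonpos (h.fderiv_fderiv_nonpos hf 1) (h.fderiv_fderiv_nonpos hf Complex.I)

end PlaneLaplacian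

section HarmonicOnSet

variable {Ω : Set ℂ} {u v : ℂ → ℝ}

theorem HarmonicOnSet.contDiffAt (hu : HarmonicOnSet u Ω) (hΩ : IsOpen Ω) {x : ℂ} (hx : x ∈ Ω) :
    ContDiffAt ℝ 2 u x :=
  hu.1.contDiffAt (hΩ.mem_nhds hx)

theorem HarmonicOnSet.const_mul (hu : HarmonicOnSet u Ω) (hΩ : IsOpen Ω) (c : ℝ) :
    HarmonicOnSet (fun x => c * u x) Ω := by
  refine ⟨contDiffOn_const.mul hu.1, fun x hx => ?_⟩
  rw [planeLap_const_mul (hu.contDiffAt hΩ hx), hu.2 x hx, mul_zero]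

theorem HarmonicOnSet.add (hu : HarmonicOnSet u Ω) (hv : HarmonicOnSet v Ω) (hΩ : IsOpen Ω) :
    HarmonicOnSet (fun x => u x + v x) Ω := by
  refine ⟨hu.1.add hv.1, fun x hx => ?_⟩
  rw [planeLap_add (hu.contDiffAt hΩ hx) (hv.contDiffAt hΩ hx), hu.2 x hx, hv.2 x hx, add_zero]

theorem harmonicOnSet_const (c : ℝ) : HarmonicOnSet (fun _ => c) Ω :=
  ⟨contDiffOn_const, fun _ _ => planeLap_const c⟩

/-- The weak maximum principle. -/
theorem HarmonicOnSet.le_of_frontier_le (hu : HarmonicOnSet u Ω) (hΩ : IsOpen Ω)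
    (hb : Bornology.IsBounded Ω) (hc : ContinuousOn u (closure Ω)) {M : ℝ}
    (hM : ∀ x ∈ frontier Ω, u x ≤ M) {x : ℂ} (hx : x ∈ Ω) : u x ≤ M := by
  obtain ⟨R, hR0, hR⟩ := hb.closure.exists_pos_norm_le
  refine le_of_forall_pos_le_add fun η hη => ?_
  have hk : 0 < η / R ^ 2 := by positivity
  obtain ⟨y, hy, hmax⟩ := hb.isCompact_closure.exists_isMaxOn ⟨x, subset_closure hx⟩
    (hc.fun_add (by fun_prop : ContinuousOn (fun z : ℂ => η / R ^ 2 * ‖z‖ ^ 2) (closure Ω)))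
  have hyΩ : y ∉ Ω := by
    intro hyΩ
    have hn : ContDiffAt ℝ 2 (fun z : ℂ => ‖z‖ ^ 2) y := (contDiff_norm_sq ℝ).contDiffAt
    have hmul : ContDiffAt ℝ 2 (fun z : ℂ => η / R ^ 2 * ‖z‖ ^ 2) y := contDiffAt_const.mul hn
    have hloc := hmax.isLocalMax (mem_of_superset (hΩ.mem_nhds hyΩ) subset_closure)
    have hle := hloc.planeLap_nonpos ((hu.contDiffAt hΩ hyΩ).add hmul)
    rw [planeLap_add (hu.contDiffAt hΩ hyΩ) hmul, planeLap_const_mul hn, planeLap_norm_sq,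
      hu.2 y hyΩ] at hle
    linarith
  have hyM := hM y (by rw [hΩ.frontier_eq]; exact ⟨hy, hyΩ⟩)
  have hxy : u x + η / R ^ 2 * ‖x‖ ^ 2 ≤ u y + η / R ^ 2 * ‖y‖ ^ 2 := hmax (subset_closure hx)
  have hyR : η / R ^ 2 * ‖y‖ ^ 2 ≤ η := by
    calc η / R ^ 2 * ‖y‖ ^ 2 ≤ η / R ^ 2 * R ^ 2 := by gcongr; exact hR y hy
      _ = η := by field_simp
  have : 0 ≤ η / R ^ 2 * ‖x‖ ^ 2 := by positivity
  linarith

theorem HarmonicOnSet.abs_le_of_frontier_abs_le (hu : HarmonicOnSet u Ω) (hΩ : IsOpen Ω)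
    (hb : Bornology.IsBounded Ω) (hc : ContinuousOn u (closure Ω)) {M : ℝ}
    (hM : ∀ x ∈ frontier Ω, |u x| ≤ M) {x : ℂ} (hx : x ∈ Ω) : |u x| ≤ M := by
  refine abs_le'.2 ⟨hu.le_of_frontier_le hΩ hb hc (fun y hy => (abs_le'.1 (hM y hy)).1) hx, ?_⟩
  have h := (hu.const_mul hΩ (-1)).le_of_frontier_le hΩ hb (continuousOn_const.mul hc)
    (fun y hy => by simpa using (abs_le'.1 (hM y hy)).2) hx
  simpa using h

end HarmonicOnSet

section Bubble

variable {ε μ A : ℝ}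

theorem continuous_bubbleU (hε : 0 < ε) (hμ : 0 < μ) (hA : 0 < A) (ξ : ℂ) :
    Continuous (bubbleU ε μ A ξ) := by
  have h (x : ℂ) : 0 < (μ ^ 2 * ε ^ 2 + ‖x - ξ‖ ^ 2) ^ 2 * A := by positivity
  refine Continuous.log (Continuous.div (by fun_prop) (by fun_prop) fun x => (h x).ne') fun x => ?_
  exact (div_pos (by positivity) (h x)).ne'

theorem bubbleU_eq (hε : 0 < ε) (hμ : 0 < μ) (hA : 0 < A) {ξ x : ℂ} (hx : x ≠ ξ) :
    bubbleU ε μ A ξ x = Real.log (8 * μ ^ 2 / A) - 4 * Real.log ‖x - ξ‖ -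
      2 * Real.log (1 + μ ^ 2 * ε ^ 2 / ‖x - ξ‖ ^ 2) := by
  have hr : 0 < ‖x - ξ‖ := norm_pos_iff.2 (sub_ne_zero.2 hx)
  have h : 8 * μ ^ 2 / ((μ ^ 2 * ε ^ 2 + ‖x - ξ‖ ^ 2) ^ 2 * A) =
      8 * μ ^ 2 / A / ‖x - ξ‖ ^ 4 / (1 + μ ^ 2 * ε ^ 2 / ‖x - ξ‖ ^ 2) ^ 2 := by
    field_simp
    ring
  rw [bubbleU, h, Real.log_div (by positivity) (by positivity),
    Real.log_div (by positivity) (by positivity), Real.log_pow, Real.log_pow]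
  norm_num

end Bubble


/-- PU_{ε,μ,ξ}(x) = U_{ε,μ,ξ}(x) + 8πH(x,ξ) − log(8μ²/A) + O(ε²)
uniformly in Ω, uniformly for ξ at distance ≥ δ from ∂Ω, μ ∈ [μ₁,μ₂], A ∈ [A₁,A₂]. -/
theorem projection_expansion_global (Ω : Set ℂ) (hΩo : IsOpen Ω) (hΩc : IsConnected Ω)
    (hΩb : Bornology.IsBounded Ω) (H : ℂ → ℂ → ℝ) (hH : RegPart Ω H)
    (δ μ₁ μ₂ A₁ A₂ : ℝ) (hδ : 0 < δ) (hμ₁ : 0 < μ₁) (hμ : μ₁ ≤ μ₂) (hA₁ : 0 < A₁)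
    (hA : A₁ ≤ A₂) (PU : ℝ → ℝ → ℝ → ℂ → ℂ → ℝ)
    (hPU : ∀ ε > (0 : ℝ), ∀ μ ∈ Set.Icc μ₁ μ₂, ∀ A ∈ Set.Icc A₁ A₂, ∀ ξ ∈ Ω,
      IsProj Ω (PU ε μ A ξ) ε μ A ξ) :
    ∃ ε₀ > (0 : ℝ), ∃ C > (0 : ℝ), ∀ ε ∈ Set.Ioo 0 ε₀, ∀ ξ ∈ Ω,
      δ ≤ Metric.infDist ξ (frontier Ω) → ∀ μ ∈ Set.Icc μ₁ μ₂, ∀ A ∈ Set.Icc A₁ A₂,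
      ∀ x ∈ Ω,
        |PU ε μ A ξ x - bubbleU ε μ A ξ x - 8 * π * H x ξ + Real.log (8 * μ ^ 2 / A)| ≤
          C * ε ^ 2 := by
  refine ⟨1, one_pos, 2 * μ₂ ^ 2 / δ ^ 2, by have := hμ₁.trans_le hμ; positivity, ?_⟩
  intro ε hε ξ hξ hdist μ hμI A hAI x hx
  have hε0 : 0 < ε := hε.1
  have hμ0 : 0 < μ := hμ₁.trans_le hμI.1
  have hA0 : 0 < A := hA₁.trans_le hAI.1
  obtain ⟨hPc, hPh, hPb⟩ := hPU ε hε0 μ hμI A hAI ξ hξ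
  obtain ⟨hHh, hHc, hHb⟩ := hH.1 ξ hξ
  have hw := (hPh.add (hHh.const_mul hΩo (-(8 * π))) hΩo).add
    (harmonicOnSet_const (Real.log (8 * μ ^ 2 / A))) hΩo
  have hwc := ((hPc.sub (continuous_bubbleU hε0 hμ0 hA0 ξ).continuousOn).add
    (continuousOn_const (c := -(8 * π)) |>.mul hHc)).add
      (continuousOn_const (c := Real.log (8 * μ ^ 2 / A)))
  have hfr : ∀ y ∈ frontier Ω, |PU ε μ A ξ y - bubbleU ε μ A ξ y + -(8 * π) * H ξ y +
      Real.log (8 * μ ^ 2 / A)| ≤ 2 * μ₂ ^ 2 / δ ^ 2 * ε ^ 2 := by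
    intro y hy
    have hr : δ ≤ ‖y - ξ‖ := by
      rw [← dist_eq_norm, dist_comm]
      exact hdist.trans (infDist_le_dist_of_mem hy)
    have hyξ : y ≠ ξ := by
      rintro rfl
      simp at hr
      linarith
    have hval : PU ε μ A ξ y - bubbleU ε μ A ξ y + -(8 * π) * H ξ y +
        Real.log (8 * μ ^ 2 / A) = 2 * Real.log (1 + μ ^ 2 * ε ^ 2 / ‖y - ξ‖ ^ 2) := by
      rw [hPb y hy, hHb y hy, bubbleU_eq hε0 hμ0 hA0 hyξ, norm_sub_rev ξ y]
      field_simp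
      ring
    have hq : 0 ≤ μ ^ 2 * ε ^ 2 / ‖y - ξ‖ ^ 2 := by positivity
    have hlog := Real.log_le_sub_one_of_pos (by linarith : 0 < 1 + μ ^ 2 * ε ^ 2 / ‖y - ξ‖ ^ 2)
    have hlog0 := Real.log_nonneg (by linarith : 1 ≤ 1 + μ ^ 2 * ε ^ 2 / ‖y - ξ‖ ^ 2)
    have hq' : μ ^ 2 * ε ^ 2 / ‖y - ξ‖ ^ 2 ≤ μ₂ ^ 2 * ε ^ 2 / δ ^ 2 := by
      gcongr
      exact hμI.2
    have hC : 2 * μ₂ ^ 2 / δ ^ 2 * ε ^ 2 = 2 * (μ₂ ^ 2 * ε ^ 2 / δ ^ 2) := by ring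
    rw [hval, abs_of_nonneg (by linarith), hC]
    linarith
  have h := hw.abs_le_of_frontier_abs_le hΩo hΩb hwc hfr hx
  rw [hH.2 x hx ξ hξ]
  simpa only [neg_mul, ← sub_eq_add_neg] using h
end

section
/- There exists a constant C > 0 such that the Robin function satisfies H(x,x) ≤ (1/(2π))·log(2 d(x)) + C for all x ∈ Ω₀; in particular H(x,x) → −∞ as d(x) = dist(x,∂Ω) → 0. -/
open Real Set Metric Filter MeasureTheory

open InnerProductSpace Topology in
/-- A harmonic function on a nonempty bounded open set which is continuous up to the boundary
attains its maximum on the boundary. -/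
theorem exists_mem_frontier_forall_le_of_harmonicOnNhd {Ω : Set ℂ} {v : ℂ → ℝ}
    (hΩo : IsOpen Ω) (hΩn : Ω.Nonempty) (hΩb : Bornology.IsBounded Ω)
    (hv : HarmonicOnNhd v Ω) (hc : ContinuousOn v (closure Ω)) :
    ∃ y ∈ frontier Ω, ∀ x ∈ closure Ω, v x ≤ v y := by
  have hK : IsCompact (closure Ω) := hΩb.isCompact_closure
  obtain ⟨a, ha, hmax⟩ := hK.exists_isMaxOn hΩn.closure hc
  by_contra! hcon
  have hS : closure Ω ∩ v ⁻¹' {v a} ⊆ Ω := by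
    rintro y ⟨hy, hya⟩
    by_contra hyΩ
    obtain ⟨x, hx, hlt⟩ := hcon y (by rw [hΩo.frontier_eq]; exact ⟨hy, hyΩ⟩)
    exact absurd (hmax hx) (by simpa [← show v y = v a from hya] using hlt)
  have hclosed : IsClosed (closure Ω ∩ v ⁻¹' {v a}) :=
    hc.preimage_isClosed_of_isClosed isClosed_closure isClosed_singleton
  have hopen : IsOpen (closure Ω ∩ v ⁻¹' {v a}) := by
    rw [isOpen_iff_mem_nhds]
    intro z hz
    obtain ⟨r, hr, hball⟩ := Metric.isOpen_iff.1 hΩo z (hS hz)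
    obtain ⟨F, hF, hFre⟩ := (hv.mono hball).exists_analyticOnNhd_ball_re_eq
    have hnorm : ∀ w ∈ ball z r, ‖Complex.exp (F w)‖ = Real.exp (v w) := fun w hw => by
      rw [Complex.norm_exp]
      exact congrArg _ (hFre hw)
    have hball' : ball z r ∈ 𝓝 z := ball_mem_nhds z hr
    have hzr : z ∈ ball z r := mem_ball_self hr
    have hconst : ∀ᶠ w in 𝓝 z, ‖Complex.exp (F w)‖ = ‖Complex.exp (F z)‖ := by
      refine Complex.norm_eventually_eq_of_isLocalMax ?_ ?_
      · filter_upwards [hball'] with w hw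
        exact ((hF w hw).differentiableAt).cexp
      · filter_upwards [hball'] with w hw
        simp only [Function.comp_apply, hnorm w hw, hnorm z hzr, Real.exp_le_exp]
        exact (show v z = v a from hz.2) ▸ hmax (subset_closure (hball hw))
    filter_upwards [hball', hconst] with w hw hwz
    rw [hnorm w hw, hnorm z hzr, Real.exp_eq_exp] at hwz
    exact ⟨subset_closure (hball hw), hwz.trans hz.2⟩
  have huniv := IsClopen.eq_univ ⟨hclosed, hopen⟩ ⟨a, ha, rfl⟩
  exact NormedSpace.unbounded_univ ℝ ℂ (hΩb.subset (huniv ▸ hS))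

open InnerProductSpace Topology in
theorem HarmonicOnSet.harmonicOnNhd {Ω : Set ℂ} {f : ℂ → ℝ} (hΩ : IsOpen Ω)
    (hf : HarmonicOnSet f Ω) : HarmonicOnNhd f Ω := by
  have key : ∀ x ∈ Ω, Laplacian.laplacian f x = 0 := by
    intro x hx
    have hd : DifferentiableAt ℝ (fderiv ℝ f) x :=
      ((hf.1.contDiffAt (hΩ.mem_nhds hx)).fderiv_right (m := 1) (by norm_num)).differentiableAt
        (by norm_num)
    have h := hf.2 x hx
    rw [planeLap, fderiv_clm_apply hd (by fun_prop), fderiv_clm_apply hd (by fun_prop)] at h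
    simpa [laplacian_eq_iteratedFDeriv_complexPlane, iteratedFDeriv_two_apply] using h
  intro x hx
  refine ⟨hf.1.contDiffAt (hΩ.mem_nhds hx), ?_⟩
  filter_upwards [hΩ.mem_nhds hx] with y hy
  exact key y hy

/-- Near the boundary, the distances from a point and from its reflection to a boundary point are
comparable. -/
theorem C2Boundary.norm_sub_le_refl {Ω : Set ℂ} (b : C2Boundary Ω) {x y : ℂ}
    (hx : x ∈ collar Ω b.δ₀) (hxp : 0 < ‖x - b.proj x‖)
    (hd : ‖x - b.proj x‖ ≤ 1 / (4 * b.C₀)) (hy : y ∈ frontier Ω) :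
    ‖x - b.proj x‖ ^ 2 + ‖y - b.proj x‖ ^ 2 / 2 ≤ ‖b.refl x - y‖ ^ 2 ∧
      ‖x - y‖ ^ 2 ≤ ‖x - b.proj x‖ ^ 2 + 3 / 2 * ‖y - b.proj x‖ ^ 2 := by
  have hq := b.quad _ (b.proj_mem x hx) y hy
  rw [b.ν_compat x hx] at hq
  set p := b.proj x
  set d := ‖x - p‖
  have hC := b.C₀_pos
  have hd' : d * b.C₀ ≤ 1 / 4 := by
    rw [le_div_iff₀ (by positivity)] at hd
    linarith
  have hq' : |2 * rinner (y - p) (x - p)| ≤ ‖y - p‖ ^ 2 / 2 := by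
    have h1 : rinner (y - p) (x - p) = d * rinner (y - p) (d⁻¹ • (x - p)) := by
      simp only [rinner, Complex.smul_re, Complex.smul_im, smul_eq_mul]
      field_simp
    rw [h1, abs_mul, abs_mul, abs_of_pos hxp, abs_two]
    nlinarith [mul_le_mul_of_nonneg_left hq hxp.le,
      mul_le_mul_of_nonneg_right hd' (sq_nonneg ‖y - p‖)]
  have h1 : ‖b.refl x - y‖ ^ 2 = d ^ 2 + ‖y - p‖ ^ 2 + 2 * rinner (y - p) (x - p) := by
    simp only [d, C2Boundary.refl, rinner, Complex.sq_norm, Complex.normSq_apply, Complex.sub_re,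
      Complex.sub_im, Complex.mul_re, Complex.mul_im, Complex.re_ofNat, Complex.im_ofNat]
    ring
  have h2 : ‖x - y‖ ^ 2 = d ^ 2 + ‖y - p‖ ^ 2 - 2 * rinner (y - p) (x - p) := by
    simp only [d, rinner, Complex.sq_norm, Complex.normSq_apply, Complex.sub_re, Complex.sub_im]
    ring
  have := abs_le.1 hq'
  constructor <;> linarith

theorem C2Boundary.norm_refl_sub_proj {Ω : Set ℂ} (b : C2Boundary Ω) (x : ℂ) :
    ‖b.refl x - b.proj x‖ = ‖x - b.proj x‖ := by
  rw [← norm_neg (x - b.proj x)]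
  congr 1
  simp only [C2Boundary.refl]
  ring

theorem C2Boundary.refl_notMem_closure {Ω : Set ℂ} (hΩo : IsOpen Ω) (b : C2Boundary Ω) {x : ℂ}
    (hx : x ∈ collar Ω b.δ₀) (hxp : 0 < ‖x - b.proj x‖)
    (hd : ‖x - b.proj x‖ ≤ 1 / (4 * b.C₀)) : b.refl x ∉ closure Ω := by
  intro hmem
  have hle : ∀ y ∈ frontier Ω, ‖x - b.proj x‖ ≤ ‖b.refl x - y‖ := fun y hy => by
    have := (b.norm_sub_le_refl hx hxp hd hy).1
    exact le_of_sq_le_sq (by nlinarith [sq_nonneg ‖y - b.proj x‖]) (norm_nonneg _)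
  by_cases hΩ : b.refl x ∈ Ω
  · have hdist : ‖b.refl x - b.proj x‖ = infDist (b.refl x) (frontier Ω) := by
      refine le_antisymm ?_ ?_
      · refine (le_infDist ⟨_, b.proj_mem x hx⟩).2 fun y hy => ?_
        rw [b.norm_refl_sub_proj, dist_eq_norm]
        exact hle y hy
      · rw [← dist_eq_norm]
        exact infDist_le_dist_of_mem (b.proj_mem x hx)
    have hcollar : b.refl x ∈ collar Ω b.δ₀ :=
      ⟨hΩ, by rw [← hdist, b.norm_refl_sub_proj, b.proj_dist x hx]; exact hx.2⟩
    have hproj := b.proj_unique _ hcollar _ (b.proj_mem x hx) hdist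
    have hν := b.ν_compat _ hcollar
    rw [← hproj, b.ν_compat x hx, b.norm_refl_sub_proj] at hν
    have heq := smul_right_injective ℂ (inv_ne_zero hxp.ne') hν
    have h0 : x - b.proj x = 0 := by
      simp only [C2Boundary.refl] at heq
      linear_combination heq / 2
    simp [h0] at hxp
  · have := hle (b.refl x) (by rw [hΩo.frontier_eq]; exact ⟨hmem, hΩ⟩)
    simp only [sub_self, norm_zero] at this
    exact absurd this (not_le.2 hxp)

open InnerProductSpace Topology in
theorem RegPart.diag_le_of_norm_refl {Ω : Set ℂ} (hΩo : IsOpen Ω) (hΩb : Bornology.IsBounded Ω)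
    (b : C2Boundary Ω) {H : ℂ → ℂ → ℝ} (hH : RegPart Ω H) {x : ℂ} (hx : x ∈ collar Ω b.δ₀)
    (hxp : 0 < ‖x - b.proj x‖) (hd : ‖x - b.proj x‖ ≤ 1 / (4 * b.C₀)) :
    H x x ≤ 1 / (2 * π) * Real.log (2 * ‖x - b.proj x‖) + 1 / (2 * π) * Real.log 3 := by
  obtain ⟨hharm, hcont, hbd⟩ := hH.1 x hx.1
  have hout := b.refl_notMem_closure hΩo hx hxp hd
  have hne : ∀ y ∈ closure Ω, b.refl x - y ≠ 0 := fun y hy h =>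
    hout (by rwa [sub_eq_zero.1 h])
  have hlog : HarmonicOnNhd (fun y => Real.log ‖b.refl x - y‖) Ω := fun y hy =>
    AnalyticAt.harmonicAt_log_norm (f := fun y => b.refl x - y) (by fun_prop)
      (hne y (subset_closure hy))
  have hlogc : ContinuousOn (fun y => Real.log ‖b.refl x - y‖) (closure Ω) :=
    ContinuousOn.log (by fun_prop) fun y hy => norm_ne_zero_iff.2 (hne y hy)
  obtain ⟨y, hy, hmax⟩ := exists_mem_frontier_forall_le_of_harmonicOnNhd hΩo ⟨x, hx.1⟩ hΩb
    ((hharm.harmonicOnNhd hΩo).sub (hlog.const_smul (c := 1 / (2 * π))))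
    (hcont.sub (hlogc.const_smul (1 / (2 * π))))
  have hxy := hmax x (subset_closure hx.1)
  simp only [Pi.sub_apply, Pi.smul_apply, smul_eq_mul, hbd y hy] at hxy
  obtain ⟨h1, h2⟩ := b.norm_sub_le_refl hx hxp hd hy
  have hpos : 0 < ‖b.refl x - y‖ := norm_pos_iff.2 (hne y (frontier_subset_closure hy))
  have hxypos : 0 < ‖x - y‖ := by
    refine norm_pos_iff.2 (sub_ne_zero.2 ?_)
    rintro rfl
    rw [hΩo.frontier_eq] at hy
    exact hy.2 hx.1
  have hle : ‖x - y‖ ≤ 3 * ‖b.refl x - y‖ :=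
    le_of_sq_le_sq (by nlinarith [sq_nonneg ‖y - b.proj x‖, sq_nonneg ‖x - b.proj x‖])
      (by positivity)
  have hll := Real.log_le_log hxypos hle
  rw [Real.log_mul (by norm_num) hpos.ne'] at hll
  have hrefl : ‖b.refl x - x‖ = 2 * ‖x - b.proj x‖ := by
    rw [show b.refl x - x = -(2 * (x - b.proj x)) by simp only [C2Boundary.refl]; ring, norm_neg,
      norm_mul, Complex.norm_ofNat]
  rw [hrefl] at hxy
  have := mul_le_mul_of_nonneg_left hll (show 0 ≤ 1 / (2 * π) by positivity)
  linarith

theorem RegPart.diag_le_log_of_norm_le {Ω : Set ℂ} (hΩo : IsOpen Ω) (hΩb : Bornology.IsBounded Ω)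
    {H : ℂ → ℂ → ℝ} (hH : RegPart Ω H) {D : ℝ} (hD : ∀ y ∈ closure Ω, ‖y‖ ≤ D) {x : ℂ}
    (hx : x ∈ Ω) : H x x ≤ 1 / (2 * π) * Real.log (2 * D) := by
  obtain ⟨hharm, hcont, hbd⟩ := hH.1 x hx
  obtain ⟨y, hy, hmax⟩ := exists_mem_frontier_forall_le_of_harmonicOnNhd hΩo ⟨x, hx⟩ hΩb
    (hharm.harmonicOnNhd hΩo) hcont
  refine (hmax x (subset_closure hx)).trans ?_
  rw [hbd y hy]
  have hxypos : 0 < ‖x - y‖ := by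
    refine norm_pos_iff.2 (sub_ne_zero.2 ?_)
    rintro rfl
    rw [hΩo.frontier_eq] at hy
    exact hy.2 hx
  have := norm_sub_le x y
  gcongr
  linarith [hD x (subset_closure hx), hD y (frontier_subset_closure hy)]

theorem C2Boundary.norm_sub_proj_pos {Ω : Set ℂ} (hΩo : IsOpen Ω) (b : C2Boundary Ω) {x : ℂ}
    (hx : x ∈ collar Ω b.δ₀) : 0 < ‖x - b.proj x‖ := by
  refine norm_pos_iff.2 (sub_ne_zero.2 fun h => ?_)
  have hp := b.proj_mem x hx
  rw [← h, hΩo.frontier_eq] at hp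
  exact hp.2 hx.1

theorem RegPart.exists_diag_le_log_infDist {Ω : Set ℂ} (hΩo : IsOpen Ω)
    (hΩb : Bornology.IsBounded Ω) (b : C2Boundary Ω) {H : ℂ → ℂ → ℝ} (hH : RegPart Ω H) :
    ∃ C > 0, ∀ x ∈ collar Ω b.δ₀,
      H x x ≤ 1 / (2 * π) * Real.log (2 * infDist x (frontier Ω)) + C := by
  obtain ⟨D, hD⟩ := hΩb.closure.exists_norm_le
  have hC := b.C₀_pos
  refine ⟨max (1 / (2 * π) * Real.log 3)
    (1 / (2 * π) * Real.log (2 * D) - 1 / (2 * π) * Real.log (2 * (1 / (4 * b.C₀)))),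
    lt_max_of_lt_left (mul_pos (by positivity) (Real.log_pos (by norm_num))), fun x hx => ?_⟩
  rw [← b.proj_dist x hx]
  have hxp := b.norm_sub_proj_pos hΩo hx
  rcases le_total ‖x - b.proj x‖ (1 / (4 * b.C₀)) with hd | hd
  · exact (hH.diag_le_of_norm_refl hΩo hΩb b hx hxp hd).trans (by gcongr; exact le_max_left _ _)
  · have h1 := hH.diag_le_log_of_norm_le hΩo hΩb hD hx.1
    have h2 : 1 / (2 * π) * Real.log (2 * (1 / (4 * b.C₀))) ≤
        1 / (2 * π) * Real.log (2 * ‖x - b.proj x‖) := by gcongr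
    linarith [le_max_right (1 / (2 * π) * Real.log 3)
      (1 / (2 * π) * Real.log (2 * D) - 1 / (2 * π) * Real.log (2 * (1 / (4 * b.C₀))))]

/-- the Robin function satisfies H(x,x) ≤ (1/(2π))·log(2d(x)) + C on the
collar Ω₀; in particular H(x,x) → −∞ as d(x) → 0. -/
theorem robin_function_boundary_estimate (Ω : Set ℂ) (hΩo : IsOpen Ω) (hΩc : IsConnected Ω)
    (hΩb : Bornology.IsBounded Ω) (b : C2Boundary Ω) (H : ℂ → ℂ → ℝ) (hH : RegPart Ω H) :
    (∃ C > 0, ∀ x ∈ collar Ω b.δ₀,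
        H x x ≤ (1 / (2 * π)) * Real.log (2 * Metric.infDist x (frontier Ω)) + C) ∧
      ∀ R : ℝ, ∃ η > 0, ∀ x ∈ Ω, Metric.infDist x (frontier Ω) < η → H x x < R := by
  obtain ⟨C, hC, hle⟩ := hH.exists_diag_le_log_infDist hΩo hΩb b
  refine ⟨⟨C, hC, hle⟩, fun R => ?_⟩
  refine ⟨min b.δ₀ (Real.exp ((R - C) * (2 * π)) / 2), lt_min b.δ₀_pos (by positivity),
    fun x hx hlt => ?_⟩
  obtain ⟨hlt₁, hlt₂⟩ := lt_min_iff.1 hlt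
  have hcol : x ∈ collar Ω b.δ₀ := ⟨hx, hlt₁⟩
  have hpos : 0 < infDist x (frontier Ω) := b.proj_dist x hcol ▸ b.norm_sub_proj_pos hΩo hcol
  have hlog : Real.log (2 * infDist x (frontier Ω)) < (R - C) * (2 * π) := by
    rw [Real.log_lt_iff_lt_exp (by positivity)]
    linarith
  have hmul : 1 / (2 * π) * Real.log (2 * infDist x (frontier Ω)) < R - C := by
    rw [one_div_mul_eq_div, div_lt_iff₀ (by positivity)]
    exact hlog
  linarith [hle x hcol]
end
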